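/- arXiv:2103.12205 — 9 statements merged into one kernel-verified Lean document; each statement's English description precedes it below -/
import Mathlib

section
/- Let p ≥ 1 and φ ∈ (0, π/2), and let θ₁, θ₂ ∈ [−φ, φ]. Define f(η₁, η₂) := (η₁ cos θ₁ − η₂ cos θ₂)² + p (η₁ sin θ₁ − η₂ sin θ₂)². Then for all η₁, η₂ ∈ [0, 1] it holds that f(η₁, η₂) ≤ max(4 p sin² φ, 1 + (p − 1) sin² φ). -/
open Real Set

lemma quad_aux (a b c M x y : ℝ) (ha : 0 ≤ a) (hb : 0 ≤ b) (haM : a ≤ M) (hbM : b ≤ M)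
    (hc : a + b - 2 * c ≤ M) (hx0 : 0 ≤ x) (hx1 : x ≤ 1) (hy0 : 0 ≤ y) (hy1 : y ≤ 1) :
    a * x ^ 2 + b * y ^ 2 - 2 * c * (x * y) ≤ M := by
  have hyy : y ^ 2 ≤ y := by nlinarith
  have hxx : x ^ 2 ≤ x := by nlinarith
  have e1 : b * y ^ 2 ≤ b * y := mul_le_mul_of_nonneg_left hyy hb
  have e2 : a * x ^ 2 ≤ a * x := mul_le_mul_of_nonneg_left hxx ha
  have e3 : b * y ≤ M := by nlinarith
  have e4 : a + b * y ^ 2 - 2 * c * y ≤ M := by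
    have h1 := mul_le_mul_of_nonneg_left hc hy0
    have h2 := mul_le_mul_of_nonneg_left haM (sub_nonneg.2 hy1)
    nlinarith
  have h1 := mul_le_mul_of_nonneg_left e4 hx0
  have h2 := mul_le_mul_of_nonneg_left (e1.trans e3) (sub_nonneg.2 hx1)
  nlinarith

theorem stmt0 (p φ θ₁ θ₂ : ℝ) (hp : 1 ≤ p) (hφ : φ ∈ Set.Ioo 0 (Real.pi/2))
    (h1 : θ₁ ∈ Set.Icc (-φ) φ) (h2 : θ₂ ∈ Set.Icc (-φ) φ) :
    ∀ η₁ ∈ Set.Icc (0:ℝ) 1, ∀ η₂ ∈ Set.Icc (0:ℝ) 1,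
      (η₁ * Real.cos θ₁ - η₂ * Real.cos θ₂)^2 + p * (η₁ * Real.sin θ₁ - η₂ * Real.sin θ₂)^2
        ≤ max (4 * p * Real.sin φ ^ 2) (1 + (p - 1) * Real.sin φ ^ 2) := by
  intro x hx y hy
  obtain ⟨hφ0, hφ1⟩ := hφ
  have key : ∀ θ ∈ Set.Icc (-φ) φ, cos θ ^ 2 + p * sin θ ^ 2 ≤ 1 + (p - 1) * sin φ ^ 2 := by
    intro θ hθ
    have hs1 : sin θ ≤ sin φ :=
      sin_le_sin_of_le_of_le_pi_div_two (by linarith [hθ.1]) hφ1.le hθ.2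
    have hs2 : sin (-φ) ≤ sin θ :=
      sin_le_sin_of_le_of_le_pi_div_two (by linarith) (by linarith [hθ.2]) hθ.1
    rw [sin_neg] at hs2
    have hs : sin θ ^ 2 ≤ sin φ ^ 2 := sq_le_sq' hs2 hs1
    nlinarith [sin_sq_add_cos_sq θ]
  have hcos : cos (2 * φ) ≤ cos (θ₁ - θ₂) := by
    rw [← cos_abs (θ₁ - θ₂)]
    apply cos_le_cos_of_nonneg_of_le_pi (abs_nonneg _) (by linarith)
    rw [abs_le]
    constructor <;> linarith [h1.1, h1.2, h2.1, h2.2]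
  rw [cos_sub, cos_two_mul] at hcos
  have q := quad_aux (cos θ₁ ^ 2 + p * sin θ₁ ^ 2) (cos θ₂ ^ 2 + p * sin θ₂ ^ 2)
    (cos θ₁ * cos θ₂ + p * (sin θ₁ * sin θ₂))
    (max (4 * p * Real.sin φ ^ 2) (1 + (p - 1) * Real.sin φ ^ 2)) x y
    (by positivity) (by positivity) ((key _ h1).trans (le_max_right _ _))
    ((key _ h2).trans (le_max_right _ _))
    (by
      refine le_trans ?_ (le_max_left _ _)
      have e1 := sin_sq_add_cos_sq θ₁
      have e2 := sin_sq_add_cos_sq θ₂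
      have e3 := sin_sq_add_cos_sq φ
      have g : (cos θ₁ - cos θ₂) ^ 2 + (sin θ₁ - sin θ₂) ^ 2 ≤ 4 * sin φ ^ 2 := by nlinarith
      have g1 := mul_le_mul_of_nonneg_left g (by linarith : 0 ≤ p)
      have g2 := mul_nonneg (sub_nonneg.2 hp) (sq_nonneg (cos θ₁ - cos θ₂))
      nlinarith)
    hx.1 hx.2 hy.1 hy.2
  refine le_trans (le_of_eq ?_) q
  ring
end

section
/- Let σ > 0, p ≥ 1, φ ∈ (0, π/2), θ₁, θ₂ ∈ [−φ, φ] and (x, y) ∈ ℝ². If there exist η₁, η₂ ∈ [0, 1] such that η₁ σ cos θ₁ = x + η₂ σ cos θ₂ and η₁ σ sin θ₁ = y + η₂ σ sin θ₂ (i.e., the line segments I₁ = {(η σ cos θ₁, η σ sin θ₁) : η ∈ [0,1]} and I₂ = {(x + η σ cos θ₂, y + η σ sin θ₂) : η ∈ [0,1]} intersect), then √(x² + p y²) ≤ σ max(2 √p sin φ, √(1 + (p − 1) sin² φ)). -/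
open Real Set

theorem stmt1 (σ p φ θ₁ θ₂ x y : ℝ) (hσ : 0 < σ) (hp : 1 ≤ p)
    (hφ : φ ∈ Set.Ioo 0 (Real.pi/2))
    (h1 : θ₁ ∈ Set.Icc (-φ) φ) (h2 : θ₂ ∈ Set.Icc (-φ) φ)
    (hint : ∃ η₁ ∈ Set.Icc (0:ℝ) 1, ∃ η₂ ∈ Set.Icc (0:ℝ) 1,
      η₁ * σ * Real.cos θ₁ = x + η₂ * σ * Real.cos θ₂ ∧
      η₁ * σ * Real.sin θ₁ = y + η₂ * σ * Real.sin θ₂) :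
    Real.sqrt (x^2 + p * y^2) ≤
      σ * max (2 * Real.sqrt p * Real.sin φ) (Real.sqrt (1 + (p - 1) * Real.sin φ ^ 2)) := by
  obtain ⟨a, ⟨ha0, ha1⟩, b, ⟨hb0, hb1⟩, hx, hy⟩ := hint
  obtain ⟨hφ0, hφ1⟩ := hφ
  have hS : 0 < Real.sin φ := Real.sin_pos_of_pos_of_lt_pi hφ0 (by linarith)
  have key : ∀ θ ∈ Set.Icc (-φ) φ, -Real.sin φ ≤ Real.sin θ ∧ Real.sin θ ≤ Real.sin φ := by
    intro θ h
    constructor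
    · rw [← Real.sin_neg]
      exact Real.sin_le_sin_of_le_of_le_pi_div_two (by linarith) (by linarith [h.2]) h.1
    · exact Real.sin_le_sin_of_le_of_le_pi_div_two (by linarith [h.1]) (by linarith) h.2
  obtain ⟨k1, k2⟩ := key θ₁ h1
  obtain ⟨l1, l2⟩ := key θ₂ h2
  have hcos : Real.cos (2 * φ) ≤ Real.cos (θ₁ - θ₂) := by
    rw [← Real.cos_abs (θ₁ - θ₂)]
    apply Real.cos_le_cos_of_nonneg_of_le_pi (abs_nonneg _) (by linarith)
    rw [abs_le]
    constructor <;> linarith [h1.1, h1.2, h2.1, h2.2]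
  rw [Real.cos_sub, Real.cos_two_mul] at hcos
  have e0 := Real.sin_sq_add_cos_sq φ
  have e1 := Real.sin_sq_add_cos_sq θ₁
  have e2 := Real.sin_sq_add_cos_sq θ₂
  set M := max (2 * Real.sqrt p * Real.sin φ) (Real.sqrt (1 + (p - 1) * Real.sin φ ^ 2)) with hM
  have hM1 : 4 * p * Real.sin φ ^ 2 ≤ M ^ 2 := by
    have h : 2 * Real.sqrt p * Real.sin φ ≤ M := le_max_left _ _
    have h' := pow_le_pow_left₀ (by positivity) h 2
    have hs := Real.sq_sqrt (show 0 ≤ p by linarith)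
    calc 4 * p * Real.sin φ ^ 2 = (2 * Real.sqrt p * Real.sin φ) ^ 2 := by
          rw [mul_pow, mul_pow, hs]; ring
      _ ≤ M ^ 2 := h'
  have hM2 : 1 + (p - 1) * Real.sin φ ^ 2 ≤ M ^ 2 := by
    have h : Real.sqrt (1 + (p - 1) * Real.sin φ ^ 2) ≤ M := le_max_right _ _
    have h' := pow_le_pow_left₀ (Real.sqrt_nonneg _) h 2
    rwa [Real.sq_sqrt (by nlinarith [sq_nonneg (Real.sin φ)])] at h'
  have hM0 : 0 ≤ M := le_trans (Real.sqrt_nonneg _) (le_max_right _ _)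
  clear_value M
  have hx' : x = σ * (a * Real.cos θ₁ - b * Real.cos θ₂) := by linarith
  have hy' : y = σ * (a * Real.sin θ₁ - b * Real.sin θ₂) := by linarith
  subst hx' hy'
  clear hx hy key
  generalize Real.sin φ = S at *
  generalize Real.cos φ = C at *
  generalize Real.sin θ₁ = s at *
  generalize Real.cos θ₁ = c at *
  generalize Real.sin θ₂ = t at *
  generalize Real.cos θ₂ = d at *
  have hp' : 0 ≤ p - 1 := by linarith
  have hA : c ^ 2 + p * s ^ 2 ≤ M ^ 2 := by
    have : s ^ 2 ≤ S ^ 2 := by nlinarith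
    nlinarith [mul_le_mul_of_nonneg_left this hp']
  have hB : d ^ 2 + p * t ^ 2 ≤ M ^ 2 := by
    have : t ^ 2 ≤ S ^ 2 := by nlinarith
    nlinarith [mul_le_mul_of_nonneg_left this hp']
  have hD : (c - d) ^ 2 + p * (s - t) ^ 2 ≤ M ^ 2 := by
    have : (s - t) ^ 2 ≤ 4 * S ^ 2 := by
      have := sq_le_sq' (show -(2 * S) ≤ s - t by linarith) (show s - t ≤ 2 * S by linarith)
      linarith
    nlinarith [mul_le_mul_of_nonneg_left this hp']
  have hA0 : 0 ≤ c ^ 2 + p * s ^ 2 := by positivity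
  have hB0 : 0 ≤ d ^ 2 + p * t ^ 2 := by positivity
  have hF : (a * c - b * d) ^ 2 + p * (a * s - b * t) ^ 2 ≤ M ^ 2 := by
    have e : (a * c - b * d) ^ 2 + p * (a * s - b * t) ^ 2 =
      a * (a - b) * (c ^ 2 + p * s ^ 2) + b * (b - a) * (d ^ 2 + p * t ^ 2)
        + a * b * ((c - d) ^ 2 + p * (s - t) ^ 2) := by ring
    rw [e]
    have i3 := mul_le_mul_of_nonneg_left hD (mul_nonneg ha0 hb0)
    rcases le_total b a with h | h
    · have i1 := mul_le_mul_of_nonneg_left hA (mul_nonneg ha0 (sub_nonneg.2 h))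
      have i2 := mul_nonneg (mul_nonneg hb0 (sub_nonneg.2 h)) hB0
      have i4 := mul_le_mul_of_nonneg_right (show a ^ 2 ≤ 1 by nlinarith) (sq_nonneg M)
      linarith
    · have i1 := mul_le_mul_of_nonneg_left hB (mul_nonneg hb0 (sub_nonneg.2 h))
      have i2 := mul_nonneg (mul_nonneg ha0 (sub_nonneg.2 h)) hA0
      have i4 := mul_le_mul_of_nonneg_right (show b ^ 2 ≤ 1 by nlinarith) (sq_nonneg M)
      linarith
  apply Real.sqrt_le_iff.2
  refine ⟨by positivity, ?_⟩
  have := mul_le_mul_of_nonneg_left hF (sq_nonneg σ)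
  linarith
end

section
/- Let p ≥ 1 and φ ∈ (0, π/2). Then the maximum of g(θ₁, θ₂) := (cos θ₁ − cos θ₂)² + p (sin θ₁ − sin θ₂)² over all (θ₁, θ₂) ∈ [−φ, φ]² equals 4 p sin² φ, and it is attained at (θ₁, θ₂) = (−φ, φ). -/
open Real Set

theorem stmt3 (p φ : ℝ) (hp : 1 ≤ p) (hφ : φ ∈ Set.Ioo 0 (Real.pi/2)) :
    (∀ θ₁ ∈ Set.Icc (-φ) φ, ∀ θ₂ ∈ Set.Icc (-φ) φ,
      (Real.cos θ₁ - Real.cos θ₂)^2 + p * (Real.sin θ₁ - Real.sin θ₂)^2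
        ≤ 4 * p * Real.sin φ ^ 2) ∧
    (Real.cos (-φ) - Real.cos φ)^2 + p * (Real.sin (-φ) - Real.sin φ)^2
      = 4 * p * Real.sin φ ^ 2 := by
  obtain ⟨h0, h1⟩ := hφ
  constructor
  · rintro a ⟨ha1, ha2⟩ b ⟨hb1, hb2⟩
    have hd1 : Real.sin ((a - b) / 2) ≤ Real.sin φ :=
      Real.sin_le_sin_of_le_of_le_pi_div_two (by linarith) (by linarith) (by linarith)
    have hd2 : Real.sin (-φ) ≤ Real.sin ((a - b) / 2) :=
      Real.sin_le_sin_of_le_of_le_pi_div_two (by linarith) (by linarith) (by linarith)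
    rw [Real.sin_neg] at hd2
    have hsq : Real.sin ((a - b) / 2) ^ 2 ≤ Real.sin φ ^ 2 := sq_le_sq' hd2 hd1
    have e : (Real.cos a - Real.cos b)^2 + (Real.sin a - Real.sin b)^2
        = 4 * Real.sin ((a - b) / 2) ^ 2 := by
      rw [Real.cos_sub_cos, Real.sin_sub_sin]
      linear_combination 4 * Real.sin ((a - b) / 2) ^ 2 * Real.sin_sq_add_cos_sq ((a + b) / 2)
    have h2 : 0 ≤ (p - 1) * (Real.cos a - Real.cos b)^2 :=
      mul_nonneg (by linarith) (sq_nonneg _)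
    have h3 := mul_le_mul_of_nonneg_left hsq (show 0 ≤ 4 * p by linarith)
    have h4 := congrArg (fun x => p * x) e
    nlinarith [h2, h3, h4]
  · rw [Real.cos_neg, Real.sin_neg]
    ring
end

section
/- Let σ > 0 and φ ∈ (0, π/2), and for p ≥ 1 define ℓ(p) := σ max(2 √p sin φ, √(1 + (p − 1) sin² φ)) / √p. Then min_{p ≥ 1} ℓ(p) = 2 σ sin φ; moreover, if φ ≤ π/6 the minimum is attained at p = 1/(3 tan² φ), and if φ > π/6 the minimum is attained at p = 1. -/
open Real Set

noncomputable def semiMinor (σ φ p : ℝ) : ℝ :=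
  σ * max (2 * Real.sqrt p * Real.sin φ) (Real.sqrt (1 + (p - 1) * Real.sin φ ^ 2)) / Real.sqrt p

theorem stmt6 (σ φ : ℝ) (hσ : 0 < σ) (hφ : φ ∈ Set.Ioo 0 (Real.pi/2)) :
    (∀ p, 1 ≤ p → 2 * σ * Real.sin φ ≤ semiMinor σ φ p) ∧
    (φ ≤ Real.pi/6 → 1 ≤ 1 / (3 * Real.tan φ ^ 2) ∧
      semiMinor σ φ (1 / (3 * Real.tan φ ^ 2)) = 2 * σ * Real.sin φ) ∧
    (Real.pi/6 < φ → semiMinor σ φ 1 = 2 * σ * Real.sin φ) := by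
  obtain ⟨h0, h1⟩ := hφ
  have hs : 0 < Real.sin φ := Real.sin_pos_of_pos_of_lt_pi h0 (by linarith [Real.pi_pos])
  have hc : 0 < Real.cos φ := Real.cos_pos_of_mem_Ioo ⟨by linarith [Real.pi_pos], h1⟩
  have hsc := Real.sin_sq_add_cos_sq φ
  have key : ∀ p, 1 ≤ p → 1 + (p - 1) * Real.sin φ ^ 2 ≤ 4 * p * Real.sin φ ^ 2 →
      semiMinor σ φ p = 2 * σ * Real.sin φ := by
    intro p hp h
    have hq : 0 < Real.sqrt p := Real.sqrt_pos.2 (by linarith)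
    have hq2 : Real.sqrt p ^ 2 = p := Real.sq_sqrt (by linarith)
    unfold semiMinor
    rw [max_eq_left]
    · field_simp
    · apply Real.sqrt_le_iff.2
      refine ⟨by positivity, ?_⟩
      rw [mul_pow, mul_pow, hq2]
      linarith
  refine ⟨?_, ?_, ?_⟩
  · intro p hp
    have hq : 0 < Real.sqrt p := Real.sqrt_pos.2 (by linarith)
    unfold semiMinor
    rw [le_div_iff₀ hq]
    calc 2 * σ * Real.sin φ * Real.sqrt p = σ * (2 * Real.sqrt p * Real.sin φ) := by ring
      _ ≤ _ := mul_le_mul_of_nonneg_left (le_max_left _ _) hσ.le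
  · intro h
    have hs2 : Real.sin φ ≤ 1 / 2 := by
      rw [← Real.sin_pi_div_six]
      exact Real.sin_le_sin_of_le_of_le_pi_div_two (by linarith [Real.pi_pos])
        (by linarith [Real.pi_pos]) h
    have e : 1 / (3 * Real.tan φ ^ 2) = Real.cos φ ^ 2 / (3 * Real.sin φ ^ 2) := by
      rw [Real.tan_eq_sin_div_cos]
      field_simp
    have hp : 1 ≤ 1 / (3 * Real.tan φ ^ 2) := by
      rw [e, le_div_iff₀ (by positivity)]
      nlinarith
    refine ⟨hp, key _ hp ?_⟩
    have e2 : 1 / (3 * Real.tan φ ^ 2) * (3 * Real.sin φ ^ 2) = Real.cos φ ^ 2 := by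
      rw [e]
      field_simp
    linarith
  · intro h
    have hs2 : 1 / 2 < Real.sin φ := by
      rw [← Real.sin_pi_div_six]
      exact Real.sin_lt_sin_of_lt_of_le_pi_div_two (by linarith [Real.pi_pos]) h1.le h
    exact key 1 le_rfl (by nlinarith)
end

section
/- Let c > 0 be a constant and let β : [0, c) → [0, ∞) be a non-decreasing function with β(0) = 0 and lim_{s → c⁻} β(s) = +∞. Then there exist a constant s* ∈ [0, c) and a continuous non-decreasing function β̄ : [0, c) → [0, ∞) such that: lim_{s → c⁻} β̄(s) = +∞; β̄(s*) = 0; β̄(s) ≤ β(s) for all s ∈ [0, c); and β̄ is strictly increasing on [s*, c). -/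
open Real Set Filter

theorem stmt7 (c : ℝ) (hc : 0 < c) (β : ℝ → ℝ)
    (hβnonneg : ∀ s ∈ Set.Ico 0 c, 0 ≤ β s)
    (hβmono : MonotoneOn β (Set.Ico 0 c))
    (hβ0 : β 0 = 0)
    (hβlim : Filter.Tendsto β (nhdsWithin c (Set.Iio c)) Filter.atTop) :
    ∃ sstar ∈ Set.Ico 0 c, ∃ βbar : ℝ → ℝ,
      ContinuousOn βbar (Set.Ico 0 c) ∧
      MonotoneOn βbar (Set.Ico 0 c) ∧
      (∀ s ∈ Set.Ico 0 c, 0 ≤ βbar s) ∧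
      Filter.Tendsto βbar (nhdsWithin c (Set.Iio c)) Filter.atTop ∧
      βbar sstar = 0 ∧
      (∀ s ∈ Set.Ico 0 c, βbar s ≤ β s) ∧
      StrictMonoOn βbar (Set.Ico sstar c) := by
  have : Nonempty (Set.Ico 0 c) := ⟨⟨0, le_refl 0, hc⟩⟩
  -- inf-convolution in the variable `y = 1 / (c - s)`
  let x : ℝ → ℝ := fun s => (c - s)⁻¹
  let h : ℝ → ℝ := fun y => ⨅ t : Set.Ico 0 c, (β t + max (y - x t) 0)
  have hb : ∀ y, BddBelow (Set.range fun t : Set.Ico 0 c => β t + max (y - x t) 0) := by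
    intro y
    refine ⟨0, ?_⟩
    rintro _ ⟨t, rfl⟩
    exact add_nonneg (hβnonneg t t.2) (le_max_right _ _)
  have hmono : Monotone h := by
    intro y z hyz
    refine ciInf_mono (hb y) fun t => ?_
    gcongr
  have hnn : ∀ y, 0 ≤ h y := fun y =>
    le_ciInf fun t => add_nonneg (hβnonneg t t.2) (le_max_right _ _)
  have hle : ∀ s ∈ Set.Ico 0 c, h (x s) ≤ β s := by
    intro s hs
    have := ciInf_le (hb (x s)) ⟨s, hs⟩
    simpa [h] using this
  have hlip : LipschitzWith 1 h := by
    apply LipschitzWith.of_le_add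
    intro y z
    have : h y - dist y z ≤ h z := by
      refine le_ciInf fun t => ?_
      have h1 : h y ≤ β t + max (y - x t) 0 := ciInf_le (hb y) t
      have h2 : max (y - x t) 0 ≤ max (z - x t) 0 + dist y z := by
        have h3 := le_abs_self (y - z)
        rw [← Real.dist_eq] at h3
        have h4 := le_max_left (z - x t) 0
        have h5 := le_max_right (z - x t) 0
        have h6 := dist_nonneg (x := y) (y := z)
        exact max_le (by linarith) (by linarith)
      linarith
    linarith
  have hxmono : ∀ s t, s ≤ t → t < c → x s ≤ x t := by
    intro s t hst ht
    exact inv_anti₀ (by linarith) (by linarith)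
  have hxlim : Tendsto x (nhdsWithin c (Set.Iio c)) atTop := by
    refine tendsto_inv_nhdsGT_zero.comp ?_
    refine tendsto_nhdsWithin_iff.2 ⟨?_, ?_⟩
    · have : Tendsto (fun s => c - s) (nhds c) (nhds (c - c)) :=
        (continuous_const.sub continuous_id).tendsto c
      rw [sub_self] at this
      exact this.mono_left nhdsWithin_le_nhds
    · filter_upwards [self_mem_nhdsWithin] with s hs
      exact sub_pos.2 (show s < c from hs)
  have key : ∀ M : ℝ, ∃ d ∈ Set.Ico 0 c, ∀ s ∈ Set.Ico d c, M ≤ β s := by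
    intro M
    have := hβlim.eventually_ge_atTop M
    obtain ⟨l, hl, hl2⟩ := (mem_nhdsLT_iff_exists_Ico_subset).1 this
    exact ⟨max l 0, ⟨le_max_right _ _, max_lt hl hc⟩,
      fun s hs => hl2 ⟨(le_max_left _ _).trans hs.1, hs.2⟩⟩
  have hlim : Tendsto (fun s => h (x s)) (nhdsWithin c (Set.Iio c)) atTop := by
    rw [tendsto_atTop]
    intro M
    obtain ⟨d, hd, hd2⟩ := key M
    filter_upwards [hxlim.eventually_ge_atTop (x d + M)] with s hs
    refine le_ciInf fun t => ?_
    rcases le_total d t with htd | htd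
    · have := hd2 t ⟨htd, t.2.2⟩
      have := le_max_right (x s - x t) 0
      linarith
    · have := hxmono t d htd hd.2
      have := hβnonneg t t.2
      have := le_max_left (x s - x t) 0
      linarith
  obtain ⟨a, ha, ha2⟩ : ∃ a ∈ Set.Ico 0 c, ∀ s ∈ Set.Ico a c, 1 ≤ h (x s) := by
    have := hlim.eventually_ge_atTop 1
    obtain ⟨l, hl, hl2⟩ := (mem_nhdsLT_iff_exists_Ico_subset).1 this
    exact ⟨max l 0, ⟨le_max_right _ _, max_lt hl hc⟩,
      fun s hs => hl2 ⟨(le_max_left _ _).trans hs.1, hs.2⟩⟩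
  have ha0 := ha.1
  refine ⟨a, ha, fun s => max (s - a) 0 / c * h (x s), ?_, ?_, ?_, ?_, ?_, ?_, ?_⟩
  · refine ContinuousOn.mul (by fun_prop) ?_
    refine hlip.continuous.comp_continuousOn ?_
    refine ContinuousOn.inv₀ (by fun_prop) ?_
    intro s hs
    exact (sub_pos.2 hs.2).ne'
  · intro s hs t ht hst
    have h1 := hmono (hxmono s t hst ht.2)
    have h2 := hnn (x s)
    dsimp only
    gcongr
  · intro s hs
    exact mul_nonneg (by positivity) (hnn _)
  · have hf : Tendsto (fun s => max (s - a) 0 / c) (nhdsWithin c (Set.Iio c))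
        (nhds (max (c - a) 0 / c)) := by
      have : Continuous fun s : ℝ => max (s - a) 0 / c := by fun_prop
      exact (this.tendsto c).mono_left nhdsWithin_le_nhds
    refine hf.pos_mul_atTop ?_ hlim
    exact div_pos (lt_max_of_lt_left (sub_pos.2 ha.2)) hc
  · simp
  · intro s hs
    refine le_trans ?_ (hle s hs)
    refine mul_le_of_le_one_left (hnn _) ?_
    rw [div_le_one hc]
    exact max_le (by linarith [hs.2]) hc.le
  · intro s hs t ht hst
    have h1 := hmono (hxmono s t hst.le ht.2)
    have h2 := ha2 t ht
    dsimp only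
    rw [max_eq_left (sub_nonneg.2 hs.1), max_eq_left (sub_nonneg.2 ht.1)]
    have h3 : 0 ≤ (s - a) / c := div_nonneg (sub_nonneg.2 hs.1) hc.le
    have h4 : (s - a) / c < (t - a) / c := by gcongr
    exact mul_lt_mul h4 h1 (by linarith [ha2 s hs]) (h3.trans h4.le)
end

section
/- With the above data, there exist a non-decreasing function κ : [0, ∞) → [0, a), a non-increasing function ρ : [0, ∞) → (L, λ], and a non-decreasing function ω : [0, ∞) → [0, φ) such that for every w ∈ Ω and all indices i, j ∈ {1,…,n} with j ≠ i: |θ_i| ≤ ω(H(w)), |y_i| ≤ κ(H(w)), and d_{i,j} ≥ ρ(H(w)). -/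
open Real Set Filter

noncomputable def dE (p : ℝ) {n : ℕ} (x y : Fin n → ℝ) (i j : Fin n) : ℝ :=
  Real.sqrt ((x i - x j)^2 + p * (y i - y j)^2)

noncomputable def Hfun (p vstar φ A : ℝ) (U V : ℝ → ℝ) {n : ℕ}
    (x y θ v : Fin n → ℝ) : ℝ :=
  (1/2) * ∑ i, (v i * Real.cos (θ i) - vstar)^2
  + (1/2) * ∑ i, (v i)^2 * (Real.sin (θ i))^2
  + ∑ i, U (y i)
  + (1/2) * ∑ i, ∑ j ∈ Finset.univ.erase i, V (dE p x y i j)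
  + A * ∑ i, (1/(Real.cos (θ i) - Real.cos φ) - 1/(1 - Real.cos φ))

def inOmega (a L p vmax φ : ℝ) {n : ℕ} (x y θ v : Fin n → ℝ) : Prop :=
  (∀ i, y i ∈ Set.Ioo (-a) a) ∧ (∀ i, θ i ∈ Set.Ioo (-φ) φ) ∧
  (∀ i, v i ∈ Set.Ioo 0 vmax) ∧ (∀ i j, i ≠ j → L < dE p x y i j)

theorem gen_bound (c : ℝ) (hc : 0 < c) (P : ℝ → ℝ → Prop)
    (hP : ∀ t s s', s ≤ s' → P t s → P t s')
    (h : ∀ s, 0 ≤ s → ∃ b, b < c ∧ ∀ t, P t s → t ≤ b) :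
    ∃ κ : ℝ → ℝ, MonotoneOn κ (Set.Ici 0) ∧ (∀ s, 0 ≤ s → κ s ∈ Set.Ico 0 c) ∧
      ∀ s, 0 ≤ s → ∀ t, P t s → t ≤ κ s := by
  have hbd : ∀ s, 0 ≤ s → BddAbove (insert 0 {t | P t s}) := by
    intro s hs
    obtain ⟨b, _, hb⟩ := h s hs
    exact (BddAbove.insert 0 ⟨b, fun t ht => hb t ht⟩)
  refine ⟨fun s => sSup (insert 0 {t | P t s}), ?_, ?_, ?_⟩
  · intro s hs s' hs' hss
    exact csSup_le_csSup (hbd s' hs') ⟨0, Set.mem_insert _ _⟩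
      (Set.insert_subset_insert fun t ht => hP t s s' hss ht)
  · intro s hs
    refine ⟨le_csSup (hbd s hs) (Set.mem_insert _ _), ?_⟩
    obtain ⟨b, hbc, hb⟩ := h s hs
    refine lt_of_le_of_lt (csSup_le ⟨0, Set.mem_insert _ _⟩ (a := max 0 b) ?_) (max_lt hc hbc)
    rintro t (rfl | ht)
    · exact le_max_left _ _
    · exact (hb t ht).trans (le_max_right _ _)
  · intro s hs t ht
    exact le_csSup (hbd s hs) (Set.mem_insert_of_mem _ ht)

theorem cos_gap {φ t : ℝ} (hφ : φ ∈ Set.Ioo 0 (Real.pi/2)) (ht : t ∈ Set.Ioo (-φ) φ) :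
    Real.cos φ < Real.cos t := by
  rw [← Real.cos_abs t]
  exact Real.cos_lt_cos_of_nonneg_of_le_pi (abs_nonneg _) (by linarith [hφ.2, Real.pi_pos])
    (abs_lt.2 ht)

theorem term_nonneg {φ t : ℝ} (hφ : φ ∈ Set.Ioo 0 (Real.pi/2)) (ht : t ∈ Set.Ioo (-φ) φ) :
    0 ≤ 1/(Real.cos t - Real.cos φ) - 1/(1 - Real.cos φ) := by
  have h1 := cos_gap hφ ht
  have h2 := Real.cos_le_one t
  have := one_div_le_one_div_of_le (a := Real.cos t - Real.cos φ) (b := 1 - Real.cos φ)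
    (by linarith) (by linarith)
  linarith

theorem stmt10 {n : ℕ} (hn : 2 ≤ n) (a L lam p vmax vstar φ A : ℝ)
    (ha : 0 < a) (hL : 0 < L) (hlam : L < lam) (hp : 1 ≤ p)
    (hvmax : 0 < vmax) (hvstar : vstar ∈ Set.Ioo 0 vmax)
    (hφ : φ ∈ Set.Ioo 0 (Real.pi/2)) (hφv : vstar / vmax ≤ Real.cos φ) (hA : 0 < A)
    (V U : ℝ → ℝ)
    (hV : ContDiffOn ℝ 2 V (Set.Ioi L))
    (hVlim : Filter.Tendsto V (nhdsWithin L (Set.Ioi L)) Filter.atTop)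
    (hV0 : ∀ d, lam ≤ d → V d = 0) (hVnonneg : ∀ d, L < d → 0 ≤ V d)
    (hU : ContDiffOn ℝ 2 U (Set.Ioo (-a) a))
    (hUlim1 : Filter.Tendsto U (nhdsWithin (-a) (Set.Ioi (-a))) Filter.atTop)
    (hUlim2 : Filter.Tendsto U (nhdsWithin a (Set.Iio a)) Filter.atTop)
    (hU0 : U 0 = 0) (hUnonneg : ∀ z ∈ Set.Ioo (-a) a, 0 ≤ U z) :
    ∃ κ ρ ω : ℝ → ℝ,
      MonotoneOn κ (Set.Ici 0) ∧ (∀ s, 0 ≤ s → κ s ∈ Set.Ico 0 a) ∧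
      AntitoneOn ρ (Set.Ici 0) ∧ (∀ s, 0 ≤ s → ρ s ∈ Set.Ioc L lam) ∧
      MonotoneOn ω (Set.Ici 0) ∧ (∀ s, 0 ≤ s → ω s ∈ Set.Ico 0 φ) ∧
      ∀ (x y θ v : Fin n → ℝ), inOmega a L p vmax φ x y θ v →
        ∀ i j, j ≠ i →
          |θ i| ≤ ω (Hfun p vstar φ A U V x y θ v) ∧
          |y i| ≤ κ (Hfun p vstar φ A U V x y θ v) ∧
          ρ (Hfun p vstar φ A U V x y θ v) ≤ dE p x y i j := by
  obtain ⟨κ, hκ1, hκ2, hκ3⟩ := gen_bound a ha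
    (fun t s => ∃ z ∈ Set.Ioo (-a) a, t = |z| ∧ U z ≤ s)
    (by rintro t s s' hs ⟨z, hz, h1, h2⟩; exact ⟨z, hz, h1, h2.trans hs⟩)
    (by
      intro s hs
      have e1 := hUlim1.eventually (eventually_gt_atTop s)
      have e2 := hUlim2.eventually (eventually_gt_atTop s)
      obtain ⟨u, hu, hu'⟩ := (mem_nhdsGT_iff_exists_Ioo_subset).1 e1
      obtain ⟨l, hl, hl'⟩ := (mem_nhdsLT_iff_exists_Ioo_subset).1 e2
      simp only [Set.mem_Ioi, Set.mem_Iio] at hu hl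
      refine ⟨max l (-u), max_lt hl (by linarith), ?_⟩
      rintro t ⟨z, hz, rfl, h2⟩
      rw [abs_le]
      constructor
      · by_contra hcon
        have h3 : z < u := by
          have := le_max_right l (-u)
          linarith
        have : s < U z := hu' ⟨hz.1, h3⟩
        linarith
      · by_contra hcon
        have h3 : l < z := by
          have := le_max_left l (-u)
          linarith
        have : s < U z := hl' ⟨h3, hz.2⟩
        linarith)
  obtain ⟨ρ, hρ1, hρ2, hρ3⟩ := gen_bound (lam - L) (by linarith)
    (fun t s => ∃ d, L < d ∧ t = lam - d ∧ (1/2) * V d ≤ s)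
    (by rintro t s s' hs ⟨z, hz, h1, h2⟩; exact ⟨z, hz, h1, h2.trans hs⟩)
    (by
      intro s hs
      have e1 := hVlim.eventually (eventually_gt_atTop (2*s))
      obtain ⟨u, hu, hu'⟩ := (mem_nhdsGT_iff_exists_Ioo_subset).1 e1
      simp only [Set.mem_Ioi] at hu
      refine ⟨lam - u, by linarith, ?_⟩
      rintro t ⟨d, hd, rfl, h2⟩
      by_contra hcon
      have : 2 * s < V d := hu' ⟨hd, by linarith⟩
      linarith)
  have hφ1 : Real.cos φ < 1 := by
    have := cos_gap hφ (t := 0) ⟨by linarith [hφ.1], hφ.1⟩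
    simpa using this
  have hφ0 : 0 < Real.cos φ := Real.cos_pos_of_mem_Ioo ⟨by linarith [hφ.1, Real.pi_pos], hφ.2⟩
  obtain ⟨ω, hω1, hω2, hω3⟩ := gen_bound φ hφ.1
    (fun t s => ∃ z ∈ Set.Ioo (-φ) φ, t = |z| ∧
      A * (1/(Real.cos z - Real.cos φ) - 1/(1 - Real.cos φ)) ≤ s)
    (by rintro t s s' hs ⟨z, hz, h1, h2⟩; exact ⟨z, hz, h1, h2.trans hs⟩)
    (by
      intro s hs
      have hg : 0 < 1/(1 - Real.cos φ) := by
        apply one_div_pos.2; linarith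
      have hsA : 0 ≤ s / A := by positivity
      have hδ0 : 0 < 1/(s/A + 1/(1 - Real.cos φ)) := by positivity
      have hδ1 : 1/(s/A + 1/(1 - Real.cos φ)) ≤ 1 - Real.cos φ := by
        have := one_div_le_one_div_of_le hg (b := s/A + 1/(1 - Real.cos φ)) (by linarith)
        rwa [one_div_one_div] at this
      have hac : ∀ t, 0 ≤ t → t ≤ φ → Real.arccos (Real.cos t) = t := fun t h0 h1 =>
        Real.arccos_cos h0 (by linarith [hφ.2, Real.pi_pos])
      refine ⟨Real.arccos (Real.cos φ + 1/(s/A + 1/(1 - Real.cos φ))), ?_, ?_⟩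
      · conv_rhs => rw [← hac φ hφ.1.le le_rfl]
        exact Real.strictAntiOn_arccos ⟨by linarith, by linarith⟩ ⟨by linarith, by linarith⟩
          (by linarith)
      · rintro t ⟨z, hz, rfl, h2⟩
        have hgap := cos_gap hφ hz
        rw [← hac |z| (abs_nonneg _) (abs_lt.2 hz).le, Real.cos_abs]
        apply Real.antitone_arccos
        have h3 : 1/(Real.cos z - Real.cos φ) ≤ s/A + 1/(1 - Real.cos φ) := by
          have : 1/(Real.cos z - Real.cos φ) - 1/(1 - Real.cos φ) ≤ s/A := by
            rw [le_div_iff₀ hA]; linarith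
          linarith
        have h4 := one_div_le_one_div_of_le (one_div_pos.2 (sub_pos.2 hgap)) h3
        rw [one_div_one_div] at h4
        linarith)
  refine ⟨κ, fun s => lam - ρ s, ω, hκ1, hκ2, ?_, ?_, hω1, hω2, ?_⟩
  · intro s hs s' hs' hss
    have := hρ1 hs hs' hss
    simp only
    linarith
  · intro s hs
    have := hρ2 s hs
    exact ⟨by linarith [this.2], by linarith [this.1]⟩
  rintro x y θ v ⟨hy, hθ, hv, hd⟩ i j hji
  have n1 : 0 ≤ ∑ i, (v i * Real.cos (θ i) - vstar)^2 := Finset.sum_nonneg fun i _ => sq_nonneg _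
  have n2 : 0 ≤ ∑ i, (v i)^2 * (Real.sin (θ i))^2 :=
    Finset.sum_nonneg fun i _ => by positivity
  have n3 : U (y i) ≤ ∑ i, U (y i) :=
    Finset.single_le_sum (f := fun i => U (y i)) (fun k _ => hUnonneg _ (hy k)) (Finset.mem_univ i)
  have hVn : ∀ k, ∀ l ∈ Finset.univ.erase k, 0 ≤ V (dE p x y k l) := fun k l hl =>
    hVnonneg _ (hd k l (Finset.ne_of_mem_erase hl).symm)
  have n4 : V (dE p x y i j) ≤ ∑ i, ∑ j ∈ Finset.univ.erase i, V (dE p x y i j) :=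
    (Finset.single_le_sum (f := fun l => V (dE p x y i l)) (hVn i)
      (Finset.mem_erase.2 ⟨hji, Finset.mem_univ j⟩)).trans
    (Finset.single_le_sum (f := fun k => ∑ j ∈ Finset.univ.erase k, V (dE p x y k j))
      (fun k _ => Finset.sum_nonneg (hVn k)) (Finset.mem_univ i))
  have n5 : A * (1/(Real.cos (θ i) - Real.cos φ) - 1/(1 - Real.cos φ)) ≤
      A * ∑ i, (1/(Real.cos (θ i) - Real.cos φ) - 1/(1 - Real.cos φ)) :=
    mul_le_mul_of_nonneg_left (Finset.single_le_sum
      (f := fun i => 1/(Real.cos (θ i) - Real.cos φ) - 1/(1 - Real.cos φ))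
      (fun k _ => term_nonneg hφ (hθ k)) (Finset.mem_univ i)) hA.le
  have m3 := hUnonneg _ (hy i)
  have m4 := hVnonneg _ (hd i j hji.symm)
  have m5 := mul_nonneg hA.le (term_nonneg hφ (hθ i))
  have hH : Hfun p vstar φ A U V x y θ v = (1/2) * ∑ i, (v i * Real.cos (θ i) - vstar)^2
    + (1/2) * ∑ i, (v i)^2 * (Real.sin (θ i))^2
    + ∑ i, U (y i)
    + (1/2) * ∑ i, ∑ j ∈ Finset.univ.erase i, V (dE p x y i j)
    + A * ∑ i, (1/(Real.cos (θ i) - Real.cos φ) - 1/(1 - Real.cos φ)) := rfl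
  generalize Hfun p vstar φ A U V x y θ v = H at hH ⊢
  have h0 : 0 ≤ H := by linarith
  refine ⟨hω3 H h0 _ ⟨θ i, hθ i, rfl, by linarith⟩, hκ3 H h0 _ ⟨y i, hy i, rfl, by linarith⟩, ?_⟩
  have := hρ3 H h0 _ ⟨dE p x y i j, hd i j hji.symm, rfl, by linarith⟩
  linarith
end

section
/- Let v_max > 0, v* > 0 and θ ∈ (−π/2, π/2) with v_max cos θ > v*, and let v ∈ (0, v_max), S ∈ ℝ and k ≥ 0 satisfy k v* ≥ S ≥ −k (v_max cos θ − v*). Then F := −(k/cos θ)(v cos θ − v*) − S/cos θ satisfies −k v ≤ F ≤ k (v_max − v); in particular −k v_max ≤ F ≤ k v_max. -/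
open Real Set

theorem stmt15 (vmax vstar θ v S k : ℝ) (hvmax : 0 < vmax) (hvstar : 0 < vstar)
    (hθ : θ ∈ Set.Ioo (-(Real.pi/2)) (Real.pi/2)) (hcos : vstar < vmax * Real.cos θ)
    (hv : v ∈ Set.Ioo 0 vmax) (hk : 0 ≤ k)
    (hS1 : S ≤ k * vstar) (hS2 : -(k * (vmax * Real.cos θ - vstar)) ≤ S) :
    -(k * v) ≤ -(k / Real.cos θ) * (v * Real.cos θ - vstar) - S / Real.cos θ ∧
    -(k / Real.cos θ) * (v * Real.cos θ - vstar) - S / Real.cos θ ≤ k * (vmax - v) ∧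
    -(k * vmax) ≤ -(k / Real.cos θ) * (v * Real.cos θ - vstar) - S / Real.cos θ ∧
    -(k / Real.cos θ) * (v * Real.cos θ - vstar) - S / Real.cos θ ≤ k * vmax := by
  have hc : 0 < Real.cos θ := Real.cos_pos_of_mem_Ioo hθ
  obtain ⟨hv0, hv1⟩ := hv
  have hF : -(k / Real.cos θ) * (v * Real.cos θ - vstar) - S / Real.cos θ
      = -(k * v) + (k * vstar - S) / Real.cos θ := by
    field_simp
    ring
  have h1 : 0 ≤ (k * vstar - S) / Real.cos θ := div_nonneg (by linarith) hc.le
  have h2 : (k * vstar - S) / Real.cos θ ≤ k * vmax := by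
    rw [div_le_iff₀ hc]
    nlinarith
  have h3 : 0 ≤ k * v := mul_nonneg hk hv0.le
  have h4 : k * v ≤ k * vmax := mul_le_mul_of_nonneg_left hv1.le hk
  rw [hF]
  refine ⟨?_, ?_, ?_, ?_⟩ <;> linarith
end

section
/- With the above data, for every w₀ ∈ Ω there exists a unique continuously differentiable function w : [0, ∞) → ℝ^{4n} with w(0) = w₀, w(t) ∈ Ω for all t ≥ 0, satisfying the closed-loop dynamics ẋ_i(t) = v_i(t) cos θ_i(t), ẏ_i(t) = v_i(t) sin θ_i(t), θ̇_i(t) = u_i(w(t)), v̇_i(t) = F_i(w(t)) for all t ≥ 0 and i = 1,…,n. Moreover this solution satisfies, for every i = 1,…,n: lim_{t→+∞} v_i(t) = v*, lim_{t→+∞} θ_i(t) = 0, lim_{t→+∞} u_i(w(t)) = 0 and lim_{t→+∞} F_i(w(t)) = 0. In addition, there exist a non-decreasing function κ : [0, ∞) → [0, a) and a non-increasing function ρ : [0, ∞) → (L, λ] such that, with b₁(s) := max{|V'(d)| : s ≤ d ≤ λ}, b₂(s) := max{|U'(y)| : |y| ≤ s}, and R(s) := μ₂ + (m/v*) b₁(ρ(s))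 + v_max (A + s cos φ (1 − cos φ)) · max{f(z) : |z| ≤ m b₁(ρ(s))} / (A v* (v_max − v*) + v* (v_max cos φ − v*)(1 − cos φ) s), the solution satisfies |F_i(w(t))| ≤ R(H(w₀)) v_max and |u_i(w(t))| ≤ (1/v*)((μ₁ + R(H(w₀))) v_max + b₂(κ(H(w₀))) + m √p b₁(ρ(H(w₀)))) for all t ≥ 0 and i = 1,…,n. -/
open Real Set Filter

noncomputable def Sx (p : ℝ) (V : ℝ → ℝ) {n : ℕ} (x y : Fin n → ℝ) (i : Fin n) : ℝ :=
  ∑ j ∈ Finset.univ.erase i, deriv V (dE p x y i j) * (x i - x j) / dE p x y i j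

noncomputable def Sy (p : ℝ) (V : ℝ → ℝ) {n : ℕ} (x y : Fin n → ℝ) (i : Fin n) : ℝ :=
  ∑ j ∈ Finset.univ.erase i, deriv V (dE p x y i j) * (y i - y j) / dE p x y i j

noncomputable def kGain (p vmax vstar μ₂ : ℝ) (f V : ℝ → ℝ) {n : ℕ}
    (x y θ : Fin n → ℝ) (i : Fin n) : ℝ :=
  μ₂ + (1/vstar) * Sx p V x y i
    + (vmax * Real.cos (θ i)) / (vstar * (vmax * Real.cos (θ i) - vstar))
      * f (-(Sx p V x y i))

noncomputable def Fctrl (p vmax vstar μ₂ : ℝ) (f V : ℝ → ℝ) {n : ℕ}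
    (x y θ v : Fin n → ℝ) (i : Fin n) : ℝ :=
  -(kGain p vmax vstar μ₂ f V x y θ i / Real.cos (θ i)) * (v i * Real.cos (θ i) - vstar)
    - (1 / Real.cos (θ i)) * Sx p V x y i

noncomputable def uctrl (p vmax vstar φ A μ₁ μ₂ : ℝ) (f U V : ℝ → ℝ) {n : ℕ}
    (x y θ v : Fin n → ℝ) (i : Fin n) : ℝ :=
  -(vstar + A / (v i * (Real.cos (θ i) - Real.cos φ)^2))⁻¹ *
    (μ₁ * v i * Real.sin (θ i) + deriv U (y i) + p * Sy p V x y i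
      + Real.sin (θ i) * Fctrl p vmax vstar μ₂ f V x y θ v i)

noncomputable def b1 (lam : ℝ) (V : ℝ → ℝ) (s : ℝ) : ℝ :=
  sSup ((fun d => |deriv V d|) '' Set.Icc s lam)

noncomputable def b2 (U : ℝ → ℝ) (s : ℝ) : ℝ :=
  sSup ((fun z => |deriv U z|) '' Set.Icc (-s) s)

noncomputable def Rfun (lam vmax vstar φ A μ₂ : ℝ) (m : ℕ) (f V : ℝ → ℝ)
    (ρ : ℝ → ℝ) (s : ℝ) : ℝ :=
  μ₂ + (m / vstar) * b1 lam V (ρ s)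
    + vmax * (A + s * Real.cos φ * (1 - Real.cos φ))
        * sSup (f '' Set.Icc (-(m * b1 lam V (ρ s))) (m * b1 lam V (ρ s)))
      / (A * vstar * (vmax - vstar)
          + vstar * (vmax * Real.cos φ - vstar) * (1 - Real.cos φ) * s)

def IsSol (a L p vmax vstar φ A μ₁ μ₂ : ℝ) (f U V : ℝ → ℝ) {n : ℕ}
    (x₀ y₀ θ₀ v₀ : Fin n → ℝ) (X Y Θ W : ℝ → Fin n → ℝ) : Prop :=
  X 0 = x₀ ∧ Y 0 = y₀ ∧ Θ 0 = θ₀ ∧ W 0 = v₀ ∧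
  (∀ t ∈ Set.Ici (0:ℝ), inOmega a L p vmax φ (X t) (Y t) (Θ t) (W t)) ∧
  (∀ t ∈ Set.Ici (0:ℝ), ∀ i,
    HasDerivWithinAt (fun s => X s i) (W t i * Real.cos (Θ t i)) (Set.Ici 0) t ∧
    HasDerivWithinAt (fun s => Y s i) (W t i * Real.sin (Θ t i)) (Set.Ici 0) t ∧
    HasDerivWithinAt (fun s => Θ s i)
      (uctrl p vmax vstar φ A μ₁ μ₂ f U V (X t) (Y t) (Θ t) (W t) i) (Set.Ici 0) t ∧
    HasDerivWithinAt (fun s => W s i)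
      (Fctrl p vmax vstar μ₂ f V (X t) (Y t) (Θ t) (W t) i) (Set.Ici 0) t)

section Tools

/-- Bounded Lipschitz real functions. -/
def BL {E : Type*} [PseudoMetricSpace E] (g : E → ℝ) : Prop :=
  (∃ K, LipschitzWith K g) ∧ ∃ B, ∀ x, |g x| ≤ B

theorem lip_iff {E : Type*} [PseudoMetricSpace E] (g : E → ℝ) :
    (∃ K, LipschitzWith K g) ↔ ∃ C : ℝ, 0 ≤ C ∧ ∀ x y, |g x - g y| ≤ C * dist x y := by
  constructor
  · rintro ⟨K, hK⟩
    exact ⟨K, K.2, fun x y => by simpa [Real.dist_eq] using hK.dist_le_mul x y⟩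
  · rintro ⟨C, hC, h⟩
    exact ⟨⟨C, hC⟩, LipschitzWith.of_dist_le_mul fun x y => by
      rw [Real.dist_eq]; exact h x y⟩

namespace BL
variable {E : Type*} [PseudoMetricSpace E] {g h : E → ℝ}

theorem const (c : ℝ) : BL (fun _ : E => c) :=
  ⟨⟨0, LipschitzWith.const c⟩, |c|, fun _ => le_rfl⟩

theorem add (hg : BL g) (hh : BL h) : BL (fun x => g x + h x) := by
  obtain ⟨⟨K, hK⟩, B, hB⟩ := hg
  obtain ⟨⟨K', hK'⟩, B', hB'⟩ := hh
  exact ⟨⟨K + K', hK.add hK'⟩, B + B', fun x =>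
    (abs_add_le _ _).trans (add_le_add (hB x) (hB' x))⟩

theorem neg (hg : BL g) : BL (fun x => - g x) := by
  obtain ⟨⟨K, hK⟩, B, hB⟩ := hg
  exact ⟨⟨K, hK.neg⟩, B, fun x => by simpa using hB x⟩

theorem sub (hg : BL g) (hh : BL h) : BL (fun x => g x - h x) := by
  simpa [sub_eq_add_neg] using hg.add hh.neg

theorem mul (hg : BL g) (hh : BL h) : BL (fun x => g x * h x) := by
  obtain ⟨hK, B, hB⟩ := hg
  obtain ⟨hK', B', hB'⟩ := hh
  obtain ⟨C, hC, h1⟩ := (lip_iff g).1 hK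
  obtain ⟨C', hC', h2⟩ := (lip_iff h).1 hK'
  refine ⟨(lip_iff _).2 ⟨|B| * C' + |B'| * C, by positivity, fun x y => ?_⟩, |B| * |B'|,
    fun x => ?_⟩
  · have e : g x * h x - g y * h y = g x * (h x - h y) + h y * (g x - g y) := by ring
    rw [e]
    refine (abs_add_le _ _).trans ?_
    rw [abs_mul, abs_mul]
    have a1 := (hB x).trans (le_abs_self B)
    have a2 := (hB' y).trans (le_abs_self B')
    have := mul_le_mul a1 (h2 x y) (abs_nonneg _) (abs_nonneg _)
    have := mul_le_mul a2 (h1 x y) (abs_nonneg _) (abs_nonneg _)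
    linarith
  · rw [abs_mul]
    exact mul_le_mul ((hB x).trans (le_abs_self B)) ((hB' x).trans (le_abs_self B'))
      (abs_nonneg _) (abs_nonneg _)

theorem sum {ι : Type*} (s : Finset ι) {g : ι → E → ℝ} (hg : ∀ i ∈ s, BL (g i)) :
    BL (fun x => ∑ i ∈ s, g i x) := by
  classical
  induction s using Finset.induction_on with
  | empty => simpa using BL.const (E := E) 0
  | insert i s hi ih =>
    simp only [Finset.sum_insert hi]
    exact (hg i (by simp)).add (ih fun j hj => hg j (by simp [hj]))

theorem comp {φ : ℝ → ℝ} {lo hi : ℝ} (hg : ∃ K, LipschitzWith K g)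
    (hr : ∀ x, g x ∈ Set.Icc lo hi) (hφ : ∀ r ∈ Set.Icc lo hi, ContDiffAt ℝ 1 φ r) :
    BL (fun x => φ (g x)) := by
  obtain ⟨K, hK⟩ := hg
  have hloc : LocallyLipschitzOn (Set.Icc lo hi) φ := by
    intro r hr
    obtain ⟨K, t, ht, h⟩ := (hφ r hr).exists_lipschitzOnWith
    exact ⟨K, t, mem_nhdsWithin_of_mem_nhds ht, h⟩
  obtain ⟨K', hK'⟩ := hloc.exists_lipschitzOnWith_of_compact isCompact_Icc
  refine ⟨⟨K' * K, ?_⟩, ?_⟩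
  · intro x y
    calc edist (φ (g x)) (φ (g y)) ≤ K' * edist (g x) (g y) := hK' (hr x) (hr y)
      _ ≤ K' * (K * edist x y) := by gcongr; exact hK x y
      _ = _ := by push_cast; ring
  · obtain ⟨B, hB⟩ := isCompact_Icc.exists_bound_of_continuousOn hloc.continuousOn
    exact ⟨B, fun x => by simpa using hB _ (hr x)⟩
end BL

/-- clamp -/
noncomputable def cl (lo hi z : ℝ) : ℝ := max lo (min hi z)

theorem cl_mem {lo hi : ℝ} (h : lo ≤ hi) (z : ℝ) : cl lo hi z ∈ Set.Icc lo hi :=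
  ⟨le_max_left _ _, max_le h (min_le_left _ _)⟩

theorem cl_eq {lo hi z : ℝ} (h : z ∈ Set.Icc lo hi) : cl lo hi z = z := by
  unfold cl; rw [min_eq_right h.2, max_eq_right h.1]

theorem cl_lip {E : Type*} [PseudoMetricSpace E] {g : E → ℝ} (lo hi : ℝ)
    (hg : ∃ K, LipschitzWith K g) : ∃ K, LipschitzWith K (fun x => cl lo hi (g x)) := by
  obtain ⟨K, hK⟩ := hg
  exact ⟨K, (hK.const_min hi).const_max lo⟩

theorem cl_comp {E : Type*} [PseudoMetricSpace E] {g : E → ℝ} {lo hi : ℝ} (h : lo ≤ hi)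
    (hg : ∃ K, LipschitzWith K g) {φ : ℝ → ℝ} (hφ : ∀ r ∈ Set.Icc lo hi, ContDiffAt ℝ 1 φ r) :
    BL (fun x => φ (cl lo hi (g x))) :=
  BL.comp (cl_lip lo hi hg) (fun _ => cl_mem h _) hφ

/-- global existence for bounded globally Lipschitz fields -/
theorem global_exist {E : Type*} [NormedAddCommGroup E] [NormedSpace ℝ E] [CompleteSpace E]
    (G : E → E) (K M : NNReal) (hG : LipschitzWith K G) (hM : ∀ x, ‖G x‖ ≤ M) (x₀ : E) :
    ∃ α : ℝ → E, α 0 = x₀ ∧ ∀ t ∈ Set.Ici (0:ℝ), HasDerivWithinAt α (G (α t)) (Set.Ici 0) t := by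
  have hex : ∀ T : NNReal, ∃ α : ℝ → E, α 0 = x₀ ∧
      ∀ t ∈ Set.Icc (0:ℝ) T, HasDerivWithinAt α (G (α t)) (Set.Icc 0 (T:ℝ)) t := by
    intro T
    have hPL : IsPicardLindelof (fun _ => G) (tmin := 0) (tmax := T) ⟨0, by simp⟩ x₀
        (M * T) 0 M K :=
      { lipschitzOnWith := fun _ _ => hG.lipschitzOnWith
        continuousOn := fun _ _ => continuousOn_const
        norm_le := fun _ _ x _ => hM x
        mul_max_le := by simp }
    exact hPL.exists_eq_forall_mem_Icc_hasDerivWithinAt₀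
  choose α h0 hα using hex
  have huniq : ∀ S T : NNReal, S ≤ T → Set.EqOn (α S) (α T) (Set.Icc 0 (S:ℝ)) := by
    intro S T hST
    have hST' : (S:ℝ) ≤ T := by exact_mod_cast hST
    have key : ∀ R : NNReal, S ≤ R → ∀ t ∈ Set.Ico (0:ℝ) S,
        HasDerivWithinAt (α R) (G (α R t)) (Set.Ici t) t := by
      intro R hR t ht
      have hR' : (S:ℝ) ≤ R := by exact_mod_cast hR
      have h1 := hα R t ⟨ht.1, ht.2.le.trans hR'⟩
      refine h1.mono_of_mem_nhdsWithin ?_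
      have : Set.Ico t (R:ℝ) ∈ nhdsWithin t (Set.Ici t) := Ico_mem_nhdsGE (ht.2.trans_le hR')
      exact Filter.mem_of_superset this fun s hs => ⟨ht.1.trans hs.1, hs.2.le⟩
    have keyc : ∀ R : NNReal, S ≤ R → ContinuousOn (α R) (Set.Icc 0 (S:ℝ)) := by
      intro R hR t ht
      have hR' : (S:ℝ) ≤ R := by exact_mod_cast hR
      exact ((hα R t ⟨ht.1, ht.2.trans hR'⟩).continuousWithinAt).mono
        (Set.Icc_subset_Icc_right hR')
    exact ODE_solution_unique (v := fun _ => G) (fun _ => hG) (keyc S le_rfl) (key S le_rfl)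
      (keyc T hST) (key T hST) (by rw [h0, h0])
  refine ⟨fun t => α (Real.toNNReal (t + 1)) t, h0 _, ?_⟩
  intro t ht
  have ht' : (0:ℝ) ≤ t := ht
  set T : NNReal := Real.toNNReal (t + 2) with hT
  have hTr : (T:ℝ) = t + 2 := Real.coe_toNNReal _ (by linarith)
  have heq : ∀ s ∈ Set.Ico (0:ℝ) (t + 1), α (Real.toNNReal (s + 1)) s = α T s := by
    intro s hs
    apply huniq
    · exact Real.toNNReal_le_toNNReal (by linarith [hs.2])
    · refine ⟨hs.1, ?_⟩
      rw [Real.coe_toNNReal _ (by linarith [hs.1])]; linarith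
  have h1 := hα T t ⟨ht', by rw [hTr]; linarith⟩
  have h2 : HasDerivWithinAt (α T) (G (α T t)) (Set.Ici 0) t := by
    refine h1.mono_of_mem_nhdsWithin ?_
    rw [hTr]
    have : Set.Iio (t+1) ∈ nhds t := Iio_mem_nhds (by linarith)
    filter_upwards [mem_nhdsWithin_of_mem_nhds this, self_mem_nhdsWithin] with s hs1 hs2
    exact ⟨hs2, by have : s < t + 1 := hs1; linarith⟩
  have e0 := heq t ⟨ht', by linarith⟩
  simp only [e0]
  refine h2.congr_of_eventuallyEq ?_ e0
  have : Set.Iio (t+1) ∈ nhds t := Iio_mem_nhds (by linarith)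
  filter_upwards [mem_nhdsWithin_of_mem_nhds this, self_mem_nhdsWithin] with s hs1 hs2
  exact heq s ⟨hs2, hs1⟩

theorem unique_global {E : Type*} [NormedAddCommGroup E] [NormedSpace ℝ E]
    (G : E → E) (K : NNReal) (hG : LipschitzWith K G) (α β : ℝ → E) (h0 : α 0 = β 0)
    (hα : ∀ t ∈ Set.Ici (0:ℝ), HasDerivWithinAt α (G (α t)) (Set.Ici 0) t)
    (hβ : ∀ t ∈ Set.Ici (0:ℝ), HasDerivWithinAt β (G (β t)) (Set.Ici 0) t) :
    ∀ t ∈ Set.Ici (0:ℝ), α t = β t := by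
  intro t ht
  refine ODE_solution_unique (v := fun _ => G) (a := 0) (b := t) (fun _ => hG) ?_ ?_ ?_ ?_ h0
    ⟨ht, le_rfl⟩
  · exact fun s hs => ((hα s hs.1).continuousWithinAt).mono Set.Icc_subset_Ici_self
  · exact fun s hs => (hα s hs.1).mono (Set.Ici_subset_Ici.2 hs.1)
  · exact fun s hs => ((hβ s hs.1).continuousWithinAt).mono Set.Icc_subset_Ici_self
  · exact fun s hs => (hβ s hs.1).mono (Set.Ici_subset_Ici.2 hs.1)

/-- Barbalat-type lemma. -/
theorem barbalat (g h : ℝ → ℝ) (c C : ℝ) (hC : 0 ≤ C)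
    (hg : ∀ t ∈ Set.Ici (0:ℝ), HasDerivWithinAt g (h t) (Set.Ici 0) t)
    (hlim : Filter.Tendsto g Filter.atTop (nhds c))
    (hlip : ∀ s t, 0 ≤ s → s ≤ t → |h s - h t| ≤ C * (t - s)) :
    Filter.Tendsto h Filter.atTop (nhds 0) := by
  rw [Metric.tendsto_atTop]
  intro ε hε
  obtain ⟨δ, hδ, hδC⟩ : ∃ δ : ℝ, 0 < δ ∧ C * δ ≤ ε / 2 := by
    refine ⟨ε / (2 * (C + 1)), by positivity, ?_⟩
    rw [mul_div_assoc', div_le_div_iff₀ (by positivity) (by positivity)]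
    nlinarith
  obtain ⟨N, hN⟩ := Metric.tendsto_atTop.1 hlim (ε * δ / 4) (by positivity)
  refine ⟨max N 0, fun t ht => ?_⟩
  have ht0 : 0 ≤ t := (le_max_right _ _).trans ht
  have htN : N ≤ t := (le_max_left _ _).trans ht
  obtain ⟨ξ, hξ, he⟩ := exists_hasDerivAt_eq_slope g h (show t < t + δ by linarith)
    (fun s hs => ((hg s (ht0.trans hs.1)).continuousWithinAt).mono
      (fun r hr => ht0.trans hr.1))
    (fun s hs => (hg s (ht0.trans hs.1.le)).hasDerivAt (Ici_mem_nhds (ht0.trans_lt hs.1)))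
  have h1 := hN t htN
  have h2 := hN (t + δ) (by linarith)
  rw [Real.dist_eq] at h1 h2
  have h3 := hlip t ξ ht0 hξ.1.le
  have h4 : C * (ξ - t) ≤ C * δ := by
    apply mul_le_mul_of_nonneg_left _ hC
    linarith [hξ.2]
  have h5 : |h ξ| < ε / 2 := by
    rw [he, abs_div, abs_of_pos (show 0 < t + δ - t by linarith), div_lt_iff₀ (by linarith)]
    have e : g (t + δ) - g t = (g (t+δ) - c) - (g t - c) := by ring
    rw [e]
    have := abs_sub (g (t+δ) - c) (g t - c)
    have e2 : ε / 2 * (t + δ - t) = ε * δ / 4 + ε * δ / 4 := by ring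
    linarith
  rw [Real.dist_eq, sub_zero]
  have e : h t = (h t - h ξ) + h ξ := by ring
  rw [e]
  have := abs_add_le (h t - h ξ) (h ξ)
  linarith

/-- positivity propagation under a linear lower bound on the derivative -/
theorem pos_prop (r r' : ℝ → ℝ) (R T : ℝ)
    (h : ∀ t ∈ Set.Ico 0 T, HasDerivWithinAt r (r' t) (Set.Ici 0) t)
    (hr : ∀ t ∈ Set.Ico 0 T, -(R * r t) ≤ r' t) :
    ∀ t ∈ Set.Ico 0 T, r 0 * Real.exp (-(R * t)) ≤ r t := by
  have hm : MonotoneOn (fun t => r t * Real.exp (R * t)) (Set.Ico 0 T) := by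
    have hd : ∀ t ∈ Set.Ico 0 T, HasDerivWithinAt (fun t => r t * Real.exp (R * t))
        (r' t * Real.exp (R * t) + r t * (Real.exp (R * t) * R)) (Set.Ici 0) t := by
      intro t ht
      have := ((hasDerivAt_id t).const_mul R).exp
      exact (h t ht).mul (by simpa using this.hasDerivWithinAt)
    refine monotoneOn_of_hasDerivWithinAt_nonneg
      (f' := fun t => r' t * Real.exp (R * t) + r t * (Real.exp (R * t) * R))
      (convex_Ico 0 T) ?_ ?_ ?_
    · exact fun t ht => ((hd t ht).continuousWithinAt).mono Set.Ico_subset_Ici_self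
    · intro t ht
      exact (hd t (interior_subset ht)).mono
        (interior_subset.trans Set.Ico_subset_Ici_self)
    · intro t ht
      have := hr t (interior_subset ht)
      have h2 := Real.exp_pos (R * t)
      nlinarith
  intro t ht
  have := hm ⟨le_rfl, ht.1.trans_lt ht.2⟩ ht ht.1
  simp only [mul_zero, Real.exp_zero, mul_one] at this
  calc r 0 * Real.exp (-(R*t)) ≤ r t * Real.exp (R * t) * Real.exp (-(R*t)) := by gcongr
    _ = r t := by rw [mul_assoc, ← Real.exp_add]; simp

end Tools

section Static

theorem kappa_exists (a : ℝ) (ha : 0 < a) (U : ℝ → ℝ)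
    (hUlim1 : Filter.Tendsto U (nhdsWithin (-a) (Set.Ioi (-a))) Filter.atTop)
    (hUlim2 : Filter.Tendsto U (nhdsWithin a (Set.Iio a)) Filter.atTop) (hU0 : U 0 = 0) :
    ∃ κ : ℝ → ℝ, MonotoneOn κ (Set.Ici 0) ∧ (∀ s, 0 ≤ s → κ s ∈ Set.Ico 0 a) ∧
      ∀ s, 0 ≤ s → ∀ y ∈ Set.Ioo (-a) a, U y ≤ s → |y| ≤ κ s := by
  let S : ℝ → Set ℝ := fun s => {r | ∃ y ∈ Set.Ioo (-a) a, U y ≤ s ∧ r = |y|}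
  have hbd : ∀ s, ∃ c < a, 0 ≤ c ∧ ∀ r ∈ S s, r ≤ c := by
    intro s
    have e1 := hUlim1.eventually_gt_atTop s
    have e2 := hUlim2.eventually_gt_atTop s
    rw [Filter.Eventually, mem_nhdsGT_iff_exists_Ioo_subset] at e1
    rw [Filter.Eventually, mem_nhdsLT_iff_exists_Ioo_subset] at e2
    obtain ⟨l, hl, hl'⟩ := e1
    obtain ⟨u, hu, hu'⟩ := e2
    have hl2 : -a < l := hl
    have hu2 : u < a := hu
    refine ⟨max (max (-l) u) 0, by simp; exact ⟨⟨by linarith, hu2⟩, ha⟩, le_max_right _ _, ?_⟩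
    rintro r ⟨y, hy, hys, rfl⟩
    apply (abs_le.2 ⟨?_, ?_⟩ : |y| ≤ max (max (-l) u) 0)
    · by_contra hcon
      push Not at hcon
      have : max (-l) u ≤ max (max (-l) u) 0 := le_max_left _ _
      have : -l ≤ max (-l) u := le_max_left _ _
      have : s < U y := hl' ⟨hy.1, by linarith⟩
      linarith
    · by_contra hcon
      push Not at hcon
      have : max (-l) u ≤ max (max (-l) u) 0 := le_max_left _ _
      have : u ≤ max (-l) u := le_max_right _ _
      have : s < U y := hu' ⟨by linarith, hy.2⟩
      linarith
  have hbdd : ∀ s, BddAbove (S s) := fun s => by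
    obtain ⟨c, -, -, h⟩ := hbd s
    exact ⟨c, h⟩
  have h0 : ∀ s, 0 ≤ s → (0:ℝ) ∈ S s := fun s hs =>
    ⟨0, ⟨by linarith, ha⟩, by rw [hU0]; exact hs, by simp⟩
  refine ⟨fun s => sSup (S s), ?_, ?_, ?_⟩
  · intro s hs t ht hst
    refine csSup_le_csSup (hbdd t) ⟨0, h0 s hs⟩ ?_
    rintro r ⟨y, hy, h1, h2⟩
    exact ⟨y, hy, h1.trans hst, h2⟩
  · intro s hs
    obtain ⟨c, hc, hc0, h⟩ := hbd s
    exact ⟨le_csSup (hbdd s) (h0 s hs), (csSup_le ⟨0, h0 s hs⟩ h).trans_lt hc⟩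
  · intro s hs y hy h
    exact le_csSup (hbdd s) ⟨y, hy, h, rfl⟩

theorem rho_exists (L lam : ℝ) (hlam : L < lam) (V : ℝ → ℝ)
    (hVlim : Filter.Tendsto V (nhdsWithin L (Set.Ioi L)) Filter.atTop)
    (hV0 : ∀ d, lam ≤ d → V d = 0) :
    ∃ ρ : ℝ → ℝ, AntitoneOn ρ (Set.Ici 0) ∧ (∀ s, 0 ≤ s → ρ s ∈ Set.Ioc L lam) ∧
      ∀ s, 0 ≤ s → ∀ d, L < d → V d ≤ 2 * s → ρ s ≤ d := by
  let S : ℝ → Set ℝ := fun s => {d | L < d ∧ V d ≤ 2 * s}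
  have hbd : ∀ s, ∃ c, L < c ∧ ∀ r ∈ S s, c ≤ r := by
    intro s
    have e1 := hVlim.eventually_gt_atTop (2 * s)
    rw [Filter.Eventually, mem_nhdsGT_iff_exists_Ioo_subset] at e1
    obtain ⟨l, hl, hl'⟩ := e1
    refine ⟨l, hl, ?_⟩
    rintro r ⟨h1, h2⟩
    by_contra hcon
    push Not at hcon
    have : 2 * s < V r := hl' ⟨h1, hcon⟩
    linarith
  have hbdd : ∀ s, BddBelow (S s) := fun s => by
    obtain ⟨c, -, h⟩ := hbd s
    exact ⟨c, h⟩
  have h0 : ∀ s, 0 ≤ s → lam ∈ S s := fun s hs => ⟨hlam, by rw [hV0 _ le_rfl]; linarith⟩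
  refine ⟨fun s => sInf (S s), ?_, ?_, ?_⟩
  · intro s hs t ht hst
    refine csInf_le_csInf (hbdd t) ⟨lam, h0 s hs⟩ ?_
    rintro r ⟨h1, h2⟩
    exact ⟨h1, by linarith⟩
  · intro s hs
    obtain ⟨c, hc, h⟩ := hbd s
    exact ⟨hc.trans_le (le_csInf ⟨lam, h0 s hs⟩ h), csInf_le (hbdd s) (h0 s hs)⟩
  · intro s hs d hd h
    exact csInf_le (hbdd s) ⟨hd, h⟩

theorem derivV_zero (L lam : ℝ) (hlam : L < lam) (V : ℝ → ℝ)
    (hV : ContDiffOn ℝ 2 V (Set.Ioi L)) (hV0 : ∀ d, lam ≤ d → V d = 0) (d : ℝ) (hd : lam ≤ d) :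
    deriv V d = 0 := by
  have hLd : L < d := hlam.trans_le hd
  have h1 : DifferentiableAt ℝ V d :=
    (hV.differentiableOn (by norm_num)).differentiableAt (Ioi_mem_nhds hLd)
  have h2 : HasDerivWithinAt V 0 (Set.Ici d) d := by
    refine (hasDerivWithinAt_const d (Set.Ici d) (0:ℝ)).congr ?_ ?_
    · intro r hr; exact hV0 r (hd.trans hr)
    · exact hV0 d hd
  exact (uniqueDiffWithinAt_Ici d).eq_deriv _ h1.hasDerivAt.hasDerivWithinAt h2

theorem derivV_contDiff (L : ℝ) (V : ℝ → ℝ) (hV : ContDiffOn ℝ 2 V (Set.Ioi L)) :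
    ContDiffOn ℝ 1 (deriv V) (Set.Ioi L) :=
  hV.deriv_of_isOpen isOpen_Ioi (by norm_num)

theorem derivU_contDiff (a : ℝ) (U : ℝ → ℝ) (hU : ContDiffOn ℝ 2 U (Set.Ioo (-a) a)) :
    ContDiffOn ℝ 1 (deriv U) (Set.Ioo (-a) a) :=
  hU.deriv_of_isOpen isOpen_Ioo (by norm_num)

theorem b1_bound (L lam : ℝ) (hlam : L < lam) (V : ℝ → ℝ)
    (hV : ContDiffOn ℝ 2 V (Set.Ioi L)) (hV0 : ∀ d, lam ≤ d → V d = 0) (r : ℝ)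
    (hr : r ∈ Set.Ioc L lam) : 0 ≤ b1 lam V r ∧ ∀ d, r ≤ d → |deriv V d| ≤ b1 lam V r := by
  have hb : BddAbove ((fun d => |deriv V d|) '' Set.Icc r lam) := by
    apply isCompact_Icc.bddAbove_image
    apply ContinuousOn.abs
    exact (derivV_contDiff L V hV).continuousOn.mono fun d hd => hr.1.trans_le hd.1
  have h1 : ∀ d ∈ Set.Icc r lam, |deriv V d| ≤ b1 lam V r := fun d hd =>
    le_csSup hb ⟨d, hd, rfl⟩
  have h0 : 0 ≤ b1 lam V r := (abs_nonneg _).trans (h1 lam ⟨hr.2, le_rfl⟩)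
  refine ⟨h0, fun d hd => ?_⟩
  by_cases h : d ≤ lam
  · exact h1 d ⟨hd, h⟩
  · rw [derivV_zero L lam hlam V hV hV0 d (by linarith)]; simpa using h0

theorem b2_bound (a : ℝ) (U : ℝ → ℝ) (hU : ContDiffOn ℝ 2 U (Set.Ioo (-a) a)) (s : ℝ)
    (hs : s ∈ Set.Ico 0 a) : ∀ y, |y| ≤ s → |deriv U y| ≤ b2 U s := by
  have hb : BddAbove ((fun d => |deriv U d|) '' Set.Icc (-s) s) := by
    apply isCompact_Icc.bddAbove_image
    apply ContinuousOn.abs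
    exact (derivU_contDiff a U hU).continuousOn.mono fun d hd =>
      ⟨by linarith [hd.1, hs.2], by linarith [hd.2, hs.2]⟩
  intro y hy
  exact le_csSup hb ⟨y, abs_le.1 hy, rfl⟩

theorem fmax_bound (f : ℝ → ℝ) (hf : ContDiff ℝ 1 f) (M : ℝ) :
    ∀ z, |z| ≤ M → f z ≤ sSup (f '' Set.Icc (-M) M) := by
  intro z hz
  exact le_csSup (isCompact_Icc.bddAbove_image hf.continuous.continuousOn) ⟨z, abs_le.1 hz, rfl⟩

theorem dE_comm (p : ℝ) {n : ℕ} (x y : Fin n → ℝ) (i j : Fin n) :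
    dE p x y i j = dE p x y j i := by
  unfold dE; congr 1; ring

theorem abs_x_le_dE (p : ℝ) (hp : 1 ≤ p) {n : ℕ} (x y : Fin n → ℝ) (i j : Fin n) :
    |x i - x j| ≤ dE p x y i j := by
  unfold dE
  apply Real.abs_le_sqrt
  nlinarith [sq_nonneg (y i - y j)]

theorem abs_y_le_dE (p : ℝ) (hp : 1 ≤ p) {n : ℕ} (x y : Fin n → ℝ) (i j : Fin n) :
    Real.sqrt p * |y i - y j| ≤ dE p x y i j := by
  unfold dE
  rw [← Real.sqrt_sq_eq_abs, ← Real.sqrt_mul (by linarith)]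
  apply Real.sqrt_le_sqrt
  nlinarith [sq_nonneg (x i - x j)]

theorem abs_y_le_dE' (p : ℝ) (hp : 1 ≤ p) {n : ℕ} (x y : Fin n → ℝ) (i j : Fin n) :
    |y i - y j| ≤ dE p x y i j := by
  unfold dE
  apply Real.abs_le_sqrt
  nlinarith [sq_nonneg (x i - x j), sq_nonneg (y i - y j)]

theorem count_nbr {n : ℕ} (L lam p : ℝ) (hL : 0 < L) (m : ℕ)
    (hmmax : m ∈ upperBounds {k : ℕ | ∃ S : Finset (ℝ × ℝ), S.card = k ∧
      (∀ z ∈ S, L ≤ Real.sqrt (z.1^2 + p * z.2^2) ∧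
        Real.sqrt (z.1^2 + p * z.2^2) ≤ lam) ∧
      (∀ z ∈ S, ∀ z' ∈ S, z ≠ z' →
        L ≤ Real.sqrt ((z.1 - z'.1)^2 + p * (z.2 - z'.2)^2))})
    (x y : Fin n → ℝ) (hd : ∀ i j, i ≠ j → L < dE p x y i j) (i : Fin n) (g : Fin n → ℝ) (B : ℝ)
    (hB : 0 ≤ B)
    (hg : ∀ j, j ≠ i → |g j| ≤ B) (hg0 : ∀ j, j ≠ i → lam ≤ dE p x y i j → g j = 0) :
    |∑ j ∈ Finset.univ.erase i, g j| ≤ m * B := by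
  classical
  set T := (Finset.univ.erase i).filter (fun j => dE p x y i j < lam) with hT
  have e : ∑ j ∈ Finset.univ.erase i, g j = ∑ j ∈ T, g j := by
    rw [hT, Finset.sum_filter]
    refine Finset.sum_congr rfl fun j hj => ?_
    split_ifs with h
    · rfl
    · exact hg0 j (Finset.ne_of_mem_erase hj) (not_lt.1 h)
  have hcard : T.card ≤ m := by
    let φ : Fin n → ℝ × ℝ := fun j => (x i - x j, y i - y j)
    have hinj : Function.Injective φ := by
      intro j k hjk
      by_contra hne
      have h1 := hd j k hne
      have hx : x j = x k := by have := congrArg Prod.fst hjk; simp only [φ] at this; linarith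
      have hy : y j = y k := by have := congrArg Prod.snd hjk; simp only [φ] at this; linarith
      have : dE p x y j k = 0 := by unfold dE; simp [hx, hy]
      linarith
    apply hmmax
    refine ⟨T.image φ, Finset.card_image_of_injective _ hinj, ?_, ?_⟩
    · intro z hz
      obtain ⟨j, hj, rfl⟩ := Finset.mem_image.1 hz
      rw [hT, Finset.mem_filter] at hj
      exact ⟨(hd i j (Finset.ne_of_mem_erase hj.1).symm).le, hj.2.le⟩
    · intro z hz z' hz' hne
      obtain ⟨j, hj, rfl⟩ := Finset.mem_image.1 hz
      obtain ⟨k, hk, rfl⟩ := Finset.mem_image.1 hz'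
      have hjk : k ≠ j := fun h => hne (by rw [h])
      have := (hd k j hjk).le
      unfold dE at this
      simp only [φ]
      have e : (x i - x j - (x i - x k))^2 + p * (y i - y j - (y i - y k))^2
          = (x k - x j)^2 + p * (y k - y j)^2 := by ring
      rw [e]; exact this
  rw [e]
  calc |∑ j ∈ T, g j| ≤ ∑ j ∈ T, |g j| := Finset.abs_sum_le_sum_abs _ _
    _ ≤ ∑ j ∈ T, B := Finset.sum_le_sum fun j hj => by
        rw [hT, Finset.mem_filter] at hj
        exact hg j (Finset.ne_of_mem_erase hj.1)
    _ = T.card * B := by simp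
    _ ≤ m * B := by gcongr

/-- consequences of `H ≤ s` -/
theorem H_bounds {n : ℕ} (a L p vmax vstar φ A : ℝ) (hφ : φ ∈ Set.Ioo 0 (Real.pi/2))
    (hA : 0 < A) (V U : ℝ → ℝ) (hVnonneg : ∀ d, L < d → 0 ≤ V d)
    (hUnonneg : ∀ z ∈ Set.Ioo (-a) a, 0 ≤ U z) (x y θ v : Fin n → ℝ)
    (hΩ : inOmega a L p vmax φ x y θ v) (s : ℝ) (hs : Hfun p vstar φ A U V x y θ v ≤ s) :
    0 ≤ s ∧ (∀ i, U (y i) ≤ s) ∧ (∀ i j, i ≠ j → V (dE p x y i j) ≤ 2 * s) ∧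
    (∀ i, Real.cos φ < Real.cos (θ i)) ∧
    (∀ i, 1 / (Real.cos (θ i) - Real.cos φ) - 1 / (1 - Real.cos φ) ≤ s / A) := by
  obtain ⟨hy, hθ, hv, hd⟩ := hΩ
  have hpi := Real.pi_pos
  have hc : ∀ i, Real.cos φ < Real.cos (θ i) := by
    intro i
    rw [← Real.cos_abs (θ i)]
    exact Real.cos_lt_cos_of_nonneg_of_le_pi_div_two (abs_nonneg _) hφ.2.le
      (abs_lt.2 ⟨(hθ i).1, (hθ i).2⟩)
  have t1 : 0 ≤ (1/2:ℝ) * ∑ i, (v i * Real.cos (θ i) - vstar)^2 := by positivity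
  have t2 : 0 ≤ (1/2:ℝ) * ∑ i, (v i)^2 * (Real.sin (θ i))^2 := by positivity
  have t3 : ∀ i, 0 ≤ U (y i) := fun i => hUnonneg _ (hy i)
  have t3s : 0 ≤ ∑ i, U (y i) := Finset.sum_nonneg fun i _ => t3 i
  have t4 : ∀ i, ∀ j ∈ Finset.univ.erase i, 0 ≤ V (dE p x y i j) := fun i j hj =>
    hVnonneg _ (hd i j (Finset.ne_of_mem_erase hj).symm)
  have t4s : ∀ i, 0 ≤ ∑ j ∈ Finset.univ.erase i, V (dE p x y i j) := fun i =>
    Finset.sum_nonneg (t4 i)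
  have t4ss : 0 ≤ ∑ i, ∑ j ∈ Finset.univ.erase i, V (dE p x y i j) :=
    Finset.sum_nonneg fun i _ => t4s i
  have t5 : ∀ i, 0 ≤ 1/(Real.cos (θ i) - Real.cos φ) - 1/(1 - Real.cos φ) := fun i => by
    have h1 := hc i
    have h2 := Real.cos_le_one (θ i)
    rw [sub_nonneg]
    exact one_div_le_one_div_of_le (by linarith) (by linarith)
  have t5s : 0 ≤ ∑ i, (1/(Real.cos (θ i) - Real.cos φ) - 1/(1 - Real.cos φ)) :=
    Finset.sum_nonneg fun i _ => t5 i
  have t5A := mul_nonneg hA.le t5s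
  unfold Hfun at hs
  refine ⟨by linarith, ?_, ?_, hc, ?_⟩
  · intro i
    have := Finset.single_le_sum (f := fun i => U (y i)) (fun i _ => t3 i) (Finset.mem_univ i)
    linarith
  · intro i j hij
    have h1 := Finset.single_le_sum (f := fun i => ∑ j ∈ Finset.univ.erase i, V (dE p x y i j))
      (fun i _ => t4s i) (Finset.mem_univ i)
    have h2 := Finset.single_le_sum (f := fun j => V (dE p x y i j)) (t4 i)
      (Finset.mem_erase.2 ⟨hij.symm, Finset.mem_univ j⟩)
    linarith
  · intro i
    have h1 := Finset.single_le_sum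
      (f := fun i => 1/(Real.cos (θ i) - Real.cos φ) - 1/(1 - Real.cos φ))
      (fun i _ => t5 i) (Finset.mem_univ i)
    rw [le_div_iff₀ hA]
    have := mul_le_mul_of_nonneg_left h1 hA.le
    linarith

/-- lower bound for the cosine -/
theorem cos_lower (φ A s C : ℝ) (hA : 0 < A) (hs : 0 ≤ s) (hφ1 : Real.cos φ < 1)
    (hC : Real.cos φ < C) (h : 1 / (C - Real.cos φ) - 1 / (1 - Real.cos φ) ≤ s / A) :
    (A + s * Real.cos φ * (1 - Real.cos φ)) / (A + s * (1 - Real.cos φ)) ≤ C := by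
  set c := Real.cos φ
  have h1 : 0 < 1 - c := by linarith
  have h2 : 0 < C - c := by linarith
  have h3 : 0 < A + s * (1 - c) := by positivity
  rw [div_le_iff₀ h3]
  have h4 : 1 / (C - c) ≤ (s * (1 - c) + A) / (A * (1 - c)) := by
    have : s / A + 1 / (1 - c) = (s * (1 - c) + A) / (A * (1 - c)) := by field_simp
    linarith
  rw [div_le_div_iff₀ h2 (by positivity)] at h4
  nlinarith

/-- the pure-algebra core of the bound on `F`. -/
theorem F_core (vmax vstar C S g μ₂ v : ℝ) (hvs : 0 < vstar) (hμ : 0 < μ₂) (hC : 0 < C)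
    (hCv : 0 < vmax * C - vstar) (hg : 0 ≤ g) (hgS : -S ≤ g)
    (hv : v ∈ Set.Ioo 0 vmax) (k F : ℝ)
    (hk : k = μ₂ + (1/vstar) * S + (vmax * C) / (vstar * (vmax * C - vstar)) * g)
    (hF : F = -(k / C) * (v * C - vstar) - (1 / C) * S) (R Sb gb cb : ℝ)
    (hSb : |S| ≤ Sb) (hgb : g ≤ gb)
    (hcb : (vmax * C) / (vstar * (vmax * C - vstar)) ≤ cb)
    (hR : R = μ₂ + (1 / vstar) * Sb + cb * gb) :
    μ₂ ≤ k ∧ k ≤ R ∧ -(R * v) ≤ F ∧ F ≤ R * (vmax - v) ∧ |F| ≤ R * vmax := by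
  set c := (vmax * C) / (vstar * (vmax * C - vstar)) with hc
  have hvmax : 0 < vmax := hv.1.trans hv.2
  have hc1 : 1 / vstar ≤ c := by
    rw [hc, div_le_div_iff₀ hvs (by positivity)]
    nlinarith
  have hvs' : 0 < 1 / vstar := by positivity
  have hc0 : 0 < c := hvs'.trans_le hc1
  have hkl : μ₂ ≤ k := by
    have h1 : (1/vstar) * g ≤ c * g := mul_le_mul_of_nonneg_right hc1 hg
    have h2 : 0 ≤ (1/vstar) * (S + g) := mul_nonneg hvs'.le (by linarith)
    rw [hk]; nlinarith
  have hcg : c * g ≤ cb * gb := mul_le_mul hcb hgb hg (hc0.le.trans hcb)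
  have hkR : k ≤ R := by
    have h1 : (1/vstar) * S ≤ (1/vstar) * Sb :=
      mul_le_mul_of_nonneg_left ((le_abs_self _).trans hSb) hvs'.le
    rw [hk, hR]; linarith
  have hF0 : F = -(k * v) + (vstar / C) * (μ₂ + c * g) := by
    rw [hF]
    have : S = vstar * (k - μ₂ - c * g) := by rw [hk]; field_simp; ring
    rw [this]; field_simp; ring
  have hF1 : F = k * (vmax - v) - (μ₂ * ((vmax * C - vstar) / C) + (vmax / vstar) * (S + g)) := by
    rw [hF]
    have : k = μ₂ + (1/vstar) * S + c * g := hk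
    have e : c * ((vmax * C - vstar) / C) = vmax / vstar := by
      rw [hc]; field_simp
    have e2 : k * ((vmax * C - vstar)/C) + S / C
        = μ₂ * ((vmax * C - vstar) / C) + (vmax / vstar) * (S + g) := by
      rw [this]
      have : (μ₂ + (1/vstar) * S + c * g) * ((vmax * C - vstar)/C) + S / C
        = μ₂ * ((vmax * C - vstar) / C) + (1/vstar) * S * ((vmax * C - vstar)/C) + S / C
          + (c * ((vmax * C - vstar)/C)) * g := by ring
      rw [this, e]; field_simp; ring
    rw [← e2]; field_simp; ring
  have hlow : 0 ≤ (vstar / C) * (μ₂ + c * g) := by positivity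
  have hup : 0 ≤ μ₂ * ((vmax * C - vstar) / C) + (vmax / vstar) * (S + g) := by
    have : 0 ≤ S + g := by linarith
    positivity
  have hv1 := hv.1
  have hv2 : 0 < vmax - v := by linarith [hv.2]
  have a1 : k * v ≤ R * v := mul_le_mul_of_nonneg_right hkR hv1.le
  have a2 : k * (vmax - v) ≤ R * (vmax - v) := mul_le_mul_of_nonneg_right hkR hv2.le
  have hR0 : 0 < R := (hμ.trans_le hkl).trans_le hkR
  have a3 := mul_pos hR0 hv1
  have a4 := mul_pos hR0 hv2
  refine ⟨hkl, hkR, by linarith, by linarith, abs_le.2 ⟨by linarith, by linarith⟩⟩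

theorem coef_bound (vmax vstar φ A s C : ℝ) (hA : 0 < A) (hs : 0 ≤ s)
    (hφ1 : Real.cos φ < 1) (hvs : 0 < vstar) (hvv : vstar < vmax)
    (hφv : vstar ≤ vmax * Real.cos φ) (hCv : 0 < vmax * C - vstar)
    (hC : (A + s * Real.cos φ * (1 - Real.cos φ)) / (A + s * (1 - Real.cos φ)) ≤ C) :
    (vmax * C) / (vstar * (vmax * C - vstar)) ≤
    vmax * (A + s * Real.cos φ * (1 - Real.cos φ)) / (A * vstar * (vmax - vstar)
          + vstar * (vmax * Real.cos φ - vstar) * (1 - Real.cos φ) * s) := by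
  set c := Real.cos φ
  have h1 : 0 < 1 - c := by linarith
  have h3 : 0 < A + s * (1 - c) := by positivity
  have hD : 0 < A * vstar * (vmax - vstar) + vstar * (vmax * c - vstar) * (1 - c) * s := by
    have : 0 < A * vstar * (vmax - vstar) := mul_pos (mul_pos hA hvs) (by linarith)
    have : 0 ≤ vstar * (vmax * c - vstar) * (1 - c) * s :=
      mul_nonneg (mul_nonneg (mul_nonneg hvs.le (by linarith)) h1.le) hs
    linarith
  rw [div_le_iff₀ h3] at hC
  rw [div_le_div_iff₀ (by positivity) hD]
  have hvm : 0 < vmax := by linarith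
  have := mul_le_mul_of_nonneg_left hC (by positivity : 0 ≤ vmax * vstar * vstar)
  nlinarith

end Static

section Dyn

/-- bundle of the standing assumptions -/
structure Dat (a L lam p vmax vstar φ A μ₁ μ₂ : ℝ) (f V U : ℝ → ℝ) (m : ℕ) : Prop where
  ha : 0 < a
  hL : 0 < L
  hlam : L < lam
  hp : 1 ≤ p
  hvmax : 0 < vmax
  hvs : 0 < vstar
  hvv : vstar < vmax
  hφ : φ ∈ Set.Ioo 0 (Real.pi/2)
  hφv : vstar ≤ vmax * Real.cos φ
  hc0 : 0 < Real.cos φ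
  hc1 : Real.cos φ < 1
  hA : 0 < A
  hμ₁ : 0 < μ₁
  hμ₂ : 0 < μ₂
  hf : ContDiff ℝ 1 f
  hfmax : ∀ z, max z 0 ≤ f z
  hV : ContDiffOn ℝ 2 V (Set.Ioi L)
  hV0 : ∀ d, lam ≤ d → V d = 0
  hVnonneg : ∀ d, L < d → 0 ≤ V d
  hU : ContDiffOn ℝ 2 U (Set.Ioo (-a) a)
  hUnonneg : ∀ z ∈ Set.Ioo (-a) a, 0 ≤ U z
  hmmax : m ∈ upperBounds {k : ℕ | ∃ S : Finset (ℝ × ℝ), S.card = k ∧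
      (∀ z ∈ S, L ≤ Real.sqrt (z.1^2 + p * z.2^2) ∧
        Real.sqrt (z.1^2 + p * z.2^2) ≤ lam) ∧
      (∀ z ∈ S, ∀ z' ∈ S, z ≠ z' →
        L ≤ Real.sqrt ((z.1 - z'.1)^2 + p * (z.2 - z'.2)^2))}

variable {n : ℕ} {a L lam p vmax vstar φ A μ₁ μ₂ : ℝ} {f V U : ℝ → ℝ} {m : ℕ}

theorem S_bounds (D : Dat a L lam p vmax vstar φ A μ₁ μ₂ f V U m) (x y : Fin n → ℝ)
    (hd : ∀ i j, i ≠ j → L < dE p x y i j) (r : ℝ) (hr : r ∈ Set.Ioc L lam)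
    (hdr : ∀ i j, i ≠ j → r ≤ dE p x y i j) (i : Fin n) :
    |Sx p V x y i| ≤ m * b1 lam V r ∧ |p * Sy p V x y i| ≤ m * Real.sqrt p * b1 lam V r := by
  obtain ⟨hb0, hb⟩ := b1_bound L lam D.hlam V D.hV D.hV0 r hr
  have hz : ∀ j, lam ≤ dE p x y i j → deriv V (dE p x y i j) = 0 := fun j h =>
    derivV_zero L lam D.hlam V D.hV D.hV0 _ h
  constructor
  · unfold Sx
    refine count_nbr L lam p D.hL m D.hmmax x y hd i _ _ hb0 ?_ ?_
    · intro j hj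
      have hpos : 0 < dE p x y i j := D.hL.trans (hd i j hj.symm)
      rw [abs_div, abs_mul, abs_of_pos hpos, div_le_iff₀ hpos]
      exact mul_le_mul (hb _ (hdr i j hj.symm)) (abs_x_le_dE p D.hp x y i j) (abs_nonneg _) hb0
    · intro j hj h
      rw [hz j h]; simp
  · unfold Sy
    rw [Finset.mul_sum, mul_assoc]
    refine count_nbr L lam p D.hL m D.hmmax x y hd i _ _ (by positivity) ?_ ?_
    · intro j hj
      have hpos : 0 < dE p x y i j := D.hL.trans (hd i j hj.symm)
      have hp0 : 0 ≤ p := by linarith [D.hp]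
      rw [abs_mul, abs_div, abs_mul, abs_of_pos hpos, abs_of_nonneg hp0, mul_div_assoc',
        div_le_iff₀ hpos]
      have h1 := abs_y_le_dE p D.hp x y i j
      have h2 := hb _ (hdr i j hj.symm)
      have h3 := mul_le_mul h2 h1 (by positivity) hb0
      have h4 := mul_le_mul_of_nonneg_left h3 (Real.sqrt_nonneg p)
      calc p * (|deriv V (dE p x y i j)| * |y i - y j|)
          = (Real.sqrt p * Real.sqrt p) * (|deriv V (dE p x y i j)| * |y i - y j|) := by
            rw [Real.mul_self_sqrt hp0]
        _ ≤ _ := by linarith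
    · intro j hj h
      rw [hz j h]; simp

/-- all the static bounds valid in a sublevel set of `H`. -/
theorem static_all (D : Dat a L lam p vmax vstar φ A μ₁ μ₂ f V U m) (κ ρ : ℝ → ℝ)
    (hκ : ∀ s, 0 ≤ s → κ s ∈ Set.Ico 0 a)
    (hκU : ∀ s, 0 ≤ s → ∀ y ∈ Set.Ioo (-a) a, U y ≤ s → |y| ≤ κ s)
    (hρ : ∀ s, 0 ≤ s → ρ s ∈ Set.Ioc L lam)
    (hρV : ∀ s, 0 ≤ s → ∀ d, L < d → V d ≤ 2 * s → ρ s ≤ d)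
    (x y θ v : Fin n → ℝ) (hΩ : inOmega a L p vmax φ x y θ v) (s : ℝ)
    (hs : Hfun p vstar φ A U V x y θ v ≤ s) :
    0 ≤ s ∧ (∀ i, |y i| ≤ κ s) ∧ (∀ i j, i ≠ j → ρ s ≤ dE p x y i j) ∧
    (∀ i, (A + s * Real.cos φ * (1 - Real.cos φ)) / (A + s * (1 - Real.cos φ)) ≤ Real.cos (θ i)) ∧
    (∀ i, μ₂ ≤ kGain p vmax vstar μ₂ f V x y θ i ∧
      -(Rfun lam vmax vstar φ A μ₂ m f V ρ s * v i) ≤ Fctrl p vmax vstar μ₂ f V x y θ v i ∧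
      Fctrl p vmax vstar μ₂ f V x y θ v i ≤ Rfun lam vmax vstar φ A μ₂ m f V ρ s * (vmax - v i) ∧
      |Fctrl p vmax vstar μ₂ f V x y θ v i| ≤ Rfun lam vmax vstar φ A μ₂ m f V ρ s * vmax ∧
      |uctrl p vmax vstar φ A μ₁ μ₂ f U V x y θ v i|
              ≤ (1/vstar) * ((μ₁ + Rfun lam vmax vstar φ A μ₂ m f V ρ s) * vmax
                  + b2 U (κ s) + m * Real.sqrt p * b1 lam V (ρ s))) := by
  obtain ⟨hs0, hUs, hVs, hc, hcs⟩ := H_bounds a L p vmax vstar φ A D.hφ D.hA V U D.hVnonneg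
    D.hUnonneg x y θ v hΩ s hs
  obtain ⟨hy, hθ, hv, hd⟩ := hΩ
  have hyκ : ∀ i, |y i| ≤ κ s := fun i => hκU s hs0 _ (hy i) (hUs i)
  have hdρ : ∀ i j, i ≠ j → ρ s ≤ dE p x y i j := fun i j hij =>
    hρV s hs0 _ (hd i j hij) (hVs i j hij)
  have hcl : ∀ i, (A + s * Real.cos φ * (1 - Real.cos φ)) / (A + s * (1 - Real.cos φ))
      ≤ Real.cos (θ i) := fun i => cos_lower φ A s _ D.hA hs0 D.hc1 (hc i) (hcs i)
  refine ⟨hs0, hyκ, hdρ, hcl, fun i => ?_⟩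
  obtain ⟨hSx, hSy⟩ := S_bounds D x y hd (ρ s) (hρ s hs0) hdρ i
  have hCv : 0 < vmax * Real.cos (θ i) - vstar := by
    have := mul_lt_mul_of_pos_left (hc i) D.hvmax
    linarith [D.hφv]
  have hC0 : 0 < Real.cos (θ i) := D.hc0.trans (hc i)
  have hfS := D.hfmax (-(Sx p V x y i))
  obtain ⟨h1, -, h3, h4, h5⟩ := F_core vmax vstar (Real.cos (θ i)) (Sx p V x y i)
    (f (-(Sx p V x y i))) μ₂ (v i) D.hvs D.hμ₂ hC0 hCv ((le_max_right _ _).trans hfS)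
    ((le_max_left _ _).trans hfS) (hv i) _ _ rfl rfl (Rfun lam vmax vstar φ A μ₂ m f V ρ s)
    (m * b1 lam V (ρ s)) (sSup (f '' Set.Icc (-(m * b1 lam V (ρ s))) (m * b1 lam V (ρ s)))) _
    hSx (fmax_bound f D.hf _ _ (by rw [abs_neg]; exact hSx))
    (coef_bound vmax vstar φ A s (Real.cos (θ i)) D.hA hs0 D.hc1 D.hvs D.hvv D.hφv hCv (hcl i))
    (by unfold Rfun; ring)
  refine ⟨h1, h3, h4, h5, ?_⟩
  set F := Fctrl p vmax vstar μ₂ f V x y θ v i with hF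
  change |Fctrl p vmax vstar μ₂ f V x y θ v i| ≤ _ at h5
  rw [← hF] at h5
  unfold uctrl
  rw [← hF, abs_mul, abs_neg]
  have hvs := D.hvs
  have hvi := hv i
  have hq : 0 ≤ A / (v i * (Real.cos (θ i) - Real.cos φ)^2) :=
    div_nonneg D.hA.le (mul_nonneg hvi.1.le (sq_nonneg _))
  have hinv : |(vstar + A / (v i * (Real.cos (θ i) - Real.cos φ)^2))⁻¹| ≤ 1 / vstar := by
    rw [abs_of_nonneg (inv_nonneg.2 (by linarith)), one_div]
    exact inv_anti₀ hvs (by linarith)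
  refine mul_le_mul hinv ?_ (abs_nonneg _) (by positivity)
  have hsin := Real.abs_sin_le_one (θ i)
  have e1 : |μ₁ * v i * Real.sin (θ i)| ≤ μ₁ * vmax := by
    rw [abs_mul, abs_of_nonneg (mul_nonneg D.hμ₁.le hvi.1.le)]
    have := mul_le_mul_of_nonneg_left hsin (mul_nonneg D.hμ₁.le hvi.1.le)
    have := mul_le_mul_of_nonneg_left hvi.2.le D.hμ₁.le
    linarith
  have e2 : |deriv U (y i)| ≤ b2 U (κ s) := b2_bound a U D.hU (κ s) (hκ s hs0) _ (hyκ i)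
  have e4 : |Real.sin (θ i) * F| ≤ Rfun lam vmax vstar φ A μ₂ m f V ρ s * vmax := by
    rw [abs_mul]
    have := mul_le_mul_of_nonneg_right hsin (abs_nonneg F)
    linarith
  have b1 := abs_add_le (μ₁ * v i * Real.sin (θ i) + deriv U (y i) + p * Sy p V x y i)
    (Real.sin (θ i) * F)
  have b2 := abs_add_le (μ₁ * v i * Real.sin (θ i) + deriv U (y i)) (p * Sy p V x y i)
  have b3 := abs_add_le (μ₁ * v i * Real.sin (θ i)) (deriv U (y i))
  linarith

theorem antisymm_sum (g : Fin n → Fin n → ℝ) (hg : ∀ i j, g i j = - g j i) (q : Fin n → ℝ) :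
    (1/2) * ∑ i, ∑ j ∈ Finset.univ.erase i, g i j * (q i - q j)
      = ∑ i, (∑ j ∈ Finset.univ.erase i, g i j) * q i := by
  have h0 : ∀ i, g i i = 0 := fun i => by have := hg i i; linarith
  have e1 : ∀ i, ∑ j ∈ Finset.univ.erase i, g i j * (q i - q j) = ∑ j, g i j * (q i - q j) :=
    fun i => Finset.sum_erase _ (by simp)
  have e2 : ∀ i, ∑ j ∈ Finset.univ.erase i, g i j = ∑ j, g i j :=
    fun i => Finset.sum_erase _ (h0 i)
  simp only [e1, e2]
  simp only [Finset.sum_mul, mul_sub, Finset.sum_sub_distrib]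
  have e3 : ∑ i, ∑ j, g i j * q j = - ∑ i, ∑ j, g i j * q i := by
    rw [Finset.sum_comm, ← Finset.sum_neg_distrib]
    refine Finset.sum_congr rfl fun i _ => ?_
    rw [← Finset.sum_neg_distrib]
    refine Finset.sum_congr rfl fun j _ => ?_
    rw [hg j i]; ring
  rw [e3]; ring

theorem antisymm_sum_zero (g : Fin n → Fin n → ℝ) (hg : ∀ i j, g i j = - g j i) :
    ∑ i, (∑ j ∈ Finset.univ.erase i, g i j) = 0 := by
  have := antisymm_sum g hg (fun _ => 1)
  simp only [sub_self, mul_zero, Finset.sum_const_zero, mul_one] at this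
  linarith

theorem Hterm (v C Sn F u k Sxi P U' Dd : ℝ) (hv : v ≠ 0) (hD : Dd ≠ 0) (hC : C ≠ 0)
    (hpos : vstar + A / (v * Dd^2) ≠ 0)
    (hu : u = -(vstar + A / (v * Dd^2))⁻¹ * (μ₁ * v * Sn + U' + P + Sn * F))
    (hF : F = -(k / C) * (v * C - vstar) - (1 / C) * Sxi) :
    (v * C - vstar) * (F * C - v * Sn * u) + (v * Sn) * (F * Sn + v * C * u)
      + U' * (v * Sn) + A * (Sn * u / Dd^2) + Sxi * (v * C) + P * (v * Sn)
    = - (μ₁ * (v * Sn)^2 + k * (v * C - vstar)^2) + vstar * Sxi := by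
  have hu' : (vstar + A / (v * Dd^2)) * u = -(μ₁ * v * Sn + U' + P + Sn * F) := by
    rw [hu, neg_mul, mul_neg, mul_inv_cancel_left₀ hpos]
  have hA' : A * (Sn * u / Dd^2) = v * Sn * (A / (v * Dd^2) * u) := by field_simp
  have hF' : C * F = -k * (v * C - vstar) - Sxi := by rw [hF]; field_simp
  rw [hA']
  linear_combination (v * Sn) * hu' + (v * C - vstar) * hF'

theorem H_deriv (D : Dat a L lam p vmax vstar φ A μ₁ μ₂ f V U m)
    (X Y Θ W : ℝ → Fin n → ℝ) (t : ℝ) (s : Set ℝ)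
    (hΩ : inOmega a L p vmax φ (X t) (Y t) (Θ t) (W t))
    (h : ∀ i,
    HasDerivWithinAt (fun s => X s i) (W t i * Real.cos (Θ t i)) s t ∧
    HasDerivWithinAt (fun s => Y s i) (W t i * Real.sin (Θ t i)) s t ∧
    HasDerivWithinAt (fun s => Θ s i)
      (uctrl p vmax vstar φ A μ₁ μ₂ f U V (X t) (Y t) (Θ t) (W t) i) s t ∧
    HasDerivWithinAt (fun s => W s i)
      (Fctrl p vmax vstar μ₂ f V (X t) (Y t) (Θ t) (W t) i) s t) :
    HasDerivWithinAt (fun τ => Hfun p vstar φ A U V (X τ) (Y τ) (Θ τ) (W τ))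
      (-∑ i, (μ₁ * (W t i * Real.sin (Θ t i))^2 + kGain p vmax vstar μ₂ f V (X t) (Y t) (Θ t) i
        * (W t i * Real.cos (Θ t i) - vstar)^2)) s t := by
  have hc : ∀ i, Real.cos φ < Real.cos (Θ t i) :=
    (H_bounds a L p vmax vstar φ A D.hφ D.hA V U D.hVnonneg
    D.hUnonneg _ _ _ _ hΩ _ le_rfl).2.2.2.1
  obtain ⟨hy, hθ, hv, hd⟩ := hΩ
  set u := uctrl p vmax vstar φ A μ₁ μ₂ f U V (X t) (Y t) (Θ t) (W t) with hu
  set F := Fctrl p vmax vstar μ₂ f V (X t) (Y t) (Θ t) (W t) with hF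
  have hX := fun i => (h i).1
  have hY := fun i => (h i).2.1
  have hT := fun i => (h i).2.2.1
  have hW := fun i => (h i).2.2.2
  have d1 : HasDerivWithinAt (fun τ => (1/2) * ∑ i, (W τ i * Real.cos (Θ τ i) - vstar)^2)
      (∑ i, (W t i * Real.cos (Θ t i) - vstar)
        * (F i * Real.cos (Θ t i) - W t i * Real.sin (Θ t i) * u i)) s t := by
    have := (HasDerivWithinAt.fun_sum (u := Finset.univ) fun i _ =>
      (((hW i).mul (hT i).cos).sub_const vstar).pow 2).const_mul (1/2:ℝ)
    refine this.congr_deriv ?_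
    rw [Finset.mul_sum]
    refine Finset.sum_congr rfl fun i _ => ?_
    push_cast; simp; ring
  have d2 : HasDerivWithinAt (fun τ => (1/2) * ∑ i, (W τ i)^2 * (Real.sin (Θ τ i))^2)
      (∑ i, (W t i * Real.sin (Θ t i))
        * (F i * Real.sin (Θ t i) + W t i * Real.cos (Θ t i) * u i)) s t := by
    have := (HasDerivWithinAt.fun_sum (u := Finset.univ) fun i _ =>
      ((hW i).pow 2).mul ((hT i).sin.pow 2)).const_mul (1/2:ℝ)
    refine this.congr_deriv ?_
    rw [Finset.mul_sum]
    refine Finset.sum_congr rfl fun i _ => ?_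
    push_cast; simp; ring
  have d3 : HasDerivWithinAt (fun τ => ∑ i, U (Y τ i))
      (∑ i, deriv U (Y t i) * (W t i * Real.sin (Θ t i))) s t := by
    refine HasDerivWithinAt.fun_sum fun i _ => ?_
    have hdu : HasDerivAt U (deriv U (Y t i)) (Y t i) :=
      ((D.hU.differentiableOn (by norm_num)).differentiableAt
        (isOpen_Ioo.mem_nhds (hy i))).hasDerivAt
    exact hdu.comp_hasDerivWithinAt t (hY i)
  have d4 : HasDerivWithinAt
      (fun τ => (1/2) * ∑ i, ∑ j ∈ Finset.univ.erase i, V (dE p (X τ) (Y τ) i j))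
      (∑ i, (Sx p V (X t) (Y t) i * (W t i * Real.cos (Θ t i))
        + p * Sy p V (X t) (Y t) i * (W t i * Real.sin (Θ t i)))) s t := by
    have hdd : ∀ i, ∀ j ∈ Finset.univ.erase i, HasDerivWithinAt (fun τ => V (dE p (X τ) (Y τ) i j))
        (deriv V (dE p (X t) (Y t) i j) * (X t i - X t j) / dE p (X t) (Y t) i j
          * (W t i * Real.cos (Θ t i) - W t j * Real.cos (Θ t j))
        + p * (deriv V (dE p (X t) (Y t) i j) * (Y t i - Y t j) / dE p (X t) (Y t) i j
          * (W t i * Real.sin (Θ t i) - W t j * Real.sin (Θ t j)))) s t := by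
      intro i j hj
      have hij : i ≠ j := (Finset.ne_of_mem_erase hj).symm
      have hdp : L < dE p (X t) (Y t) i j := hd i j hij
      have hpos : 0 < dE p (X t) (Y t) i j := D.hL.trans hdp
      have hdv : HasDerivAt V (deriv V (dE p (X t) (Y t) i j)) (dE p (X t) (Y t) i j) :=
        ((D.hV.differentiableOn (by norm_num)).differentiableAt (Ioi_mem_nhds hdp)).hasDerivAt
      have hin : ((X t i - X t j)^2 + p * (Y t i - Y t j)^2) ≠ 0 := by
        intro h0
        unfold dE at hpos
        rw [h0] at hpos; simp at hpos
      have hsq := ((((hX i).sub (hX j)).pow 2).add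
        ((((hY i).sub (hY j)).pow 2).const_mul p)).sqrt (by simpa using hin)
      have hc := hdv.comp_hasDerivWithinAt t
        (h := fun τ => dE p (X τ) (Y τ) i j) (hsq)
      refine hc.congr_deriv ?_
      have he : Real.sqrt ((X t i - X t j)^2 + p * (Y t i - Y t j)^2) = dE p (X t) (Y t) i j := rfl
      simp
      rw [he]
      field_simp
    have := (HasDerivWithinAt.fun_sum (u := Finset.univ) fun i _ =>
      HasDerivWithinAt.fun_sum fun j hj => hdd i j hj).const_mul (1/2:ℝ)
    refine this.congr_deriv ?_
    simp only [Finset.sum_add_distrib, mul_add, ← Finset.mul_sum]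
    rw [antisymm_sum (fun i j => deriv V (dE p (X t) (Y t) i j) * (X t i - X t j)
      / dE p (X t) (Y t) i j) (fun i j => by rw [dE_comm p _ _ j i]; ring)
      (fun i => W t i * Real.cos (Θ t i)), mul_left_comm,
      antisymm_sum (fun i j => deriv V (dE p (X t) (Y t) i j) * (Y t i - Y t j)
      / dE p (X t) (Y t) i j) (fun i j => by rw [dE_comm p _ _ j i]; ring)
      (fun i => W t i * Real.sin (Θ t i)), Finset.mul_sum]
    unfold Sx Sy
    simp only [mul_assoc]
  have d5 : HasDerivWithinAt
      (fun τ => A * ∑ i, (1/(Real.cos (Θ τ i) - Real.cos φ) - 1/(1 - Real.cos φ)))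
      (∑ i, A * (Real.sin (Θ t i) * u i / (Real.cos (Θ t i) - Real.cos φ)^2)) s t := by
    have := (HasDerivWithinAt.fun_sum (u := Finset.univ) fun i _ =>
      (((hT i).cos.sub_const (Real.cos φ)).fun_inv (sub_ne_zero.2 (hc i).ne')).sub_const
        (1/(1 - Real.cos φ))).const_mul A
    simp only [one_div] at this ⊢
    refine this.congr_deriv ?_
    rw [Finset.mul_sum]
    refine Finset.sum_congr rfl fun i _ => ?_
    ring
  have htot := (((d1.add d2).add d3).add d4).add d5
  refine htot.congr_deriv ?_
  simp only [← Finset.sum_add_distrib]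
  have hterm : ∀ i, (W t i * Real.cos (Θ t i) - vstar)
        * (F i * Real.cos (Θ t i) - W t i * Real.sin (Θ t i) * u i)
      + (W t i * Real.sin (Θ t i)) * (F i * Real.sin (Θ t i) + W t i * Real.cos (Θ t i) * u i)
      + deriv U (Y t i) * (W t i * Real.sin (Θ t i))
      + (Sx p V (X t) (Y t) i * (W t i * Real.cos (Θ t i))
        + p * Sy p V (X t) (Y t) i * (W t i * Real.sin (Θ t i)))
      + A * (Real.sin (Θ t i) * u i / (Real.cos (Θ t i) - Real.cos φ)^2)
      = - (μ₁ * (W t i * Real.sin (Θ t i))^2 + kGain p vmax vstar μ₂ f V (X t) (Y t) (Θ t) i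
        * (W t i * Real.cos (Θ t i) - vstar)^2) + vstar * Sx p V (X t) (Y t) i := by
    intro i
    have hvi := (hv i).1
    have hDd : 0 < Real.cos (Θ t i) - Real.cos φ := sub_pos.2 (hc i)
    have hA := D.hA
    have hvs := D.hvs
    have := Hterm (vstar := vstar) (A := A) (μ₁ := μ₁) (W t i) (Real.cos (Θ t i))
      (Real.sin (Θ t i)) (F i) (u i)
      (kGain p vmax vstar μ₂ f V (X t) (Y t) (Θ t) i) (Sx p V (X t) (Y t) i)
      (p * Sy p V (X t) (Y t) i) (deriv U (Y t i)) (Real.cos (Θ t i) - Real.cos φ) hvi.ne' hDd.ne'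
      (D.hc0.trans (hc i)).ne' (by positivity) rfl rfl
    rw [← this]; ring
  rw [Finset.sum_congr rfl fun i _ => hterm i, Finset.sum_add_distrib, ← Finset.mul_sum]
  have hz : ∑ i, Sx p V (X t) (Y t) i = 0 :=
    antisymm_sum_zero (fun i j => deriv V (dE p (X t) (Y t) i j) * (X t i - X t j)
      / dE p (X t) (Y t) i j) (fun i j => by rw [dE_comm p _ _ j i]; ring)
  rw [hz, Finset.sum_neg_distrib]; ring

end Dyn

section Clamp

variable {n : ℕ} {a L lam p vmax vstar φ A μ₁ μ₂ : ℝ} {f V U : ℝ → ℝ} {m : ℕ}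

/-- state space -/
abbrev St (n : ℕ) : Type := (Fin n → ℝ) × (Fin n → ℝ) × (Fin n → ℝ) × (Fin n → ℝ)

theorem lip_x (i : Fin n) : LipschitzWith (1 * 1) (fun w : St n => w.1 i) :=
  (LipschitzWith.eval (α := fun _ : Fin n => ℝ) i).comp LipschitzWith.prod_fst
theorem lip_y (i : Fin n) : LipschitzWith (1 * (1 * 1)) (fun w : St n => w.2.1 i) :=
  (LipschitzWith.eval (α := fun _ : Fin n => ℝ) i).comp
    (LipschitzWith.prod_fst.comp LipschitzWith.prod_snd)
theorem lip_th (i : Fin n) : LipschitzWith (1 * (1 * (1 * 1))) (fun w : St n => w.2.2.1 i) :=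
  (LipschitzWith.eval (α := fun _ : Fin n => ℝ) i).comp
    (LipschitzWith.prod_fst.comp (LipschitzWith.prod_snd.comp LipschitzWith.prod_snd))
theorem lip_v (i : Fin n) : LipschitzWith (1 * (1 * (1 * 1))) (fun w : St n => w.2.2.2 i) :=
  (LipschitzWith.eval (α := fun _ : Fin n => ℝ) i).comp
    (LipschitzWith.prod_snd.comp (LipschitzWith.prod_snd.comp LipschitzWith.prod_snd))

theorem dE_eq_norm (p : ℝ) (hp : 0 ≤ p) (x y : Fin n → ℝ) (i j : Fin n) :
    dE p x y i j = ‖(⟨x i - x j, Real.sqrt p * (y i - y j)⟩ : ℂ)‖ := by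
  rw [Complex.norm_eq_sqrt_sq_add_sq, dE, mul_pow, Real.sq_sqrt hp]

theorem lip_dE (p : ℝ) (hp : 0 ≤ p) (i j : Fin n) :
    ∃ K, LipschitzWith K (fun w : St n => dE p w.1 w.2.1 i j) := by
  rw [lip_iff]
  refine ⟨2 + Real.sqrt p * 2, by positivity, fun w w' => ?_⟩
  rw [dE_eq_norm p hp, dE_eq_norm p hp]
  refine (abs_norm_sub_norm_le _ _).trans ((Complex.norm_le_abs_re_add_abs_im _).trans ?_)
  simp only [Complex.sub_re, Complex.sub_im]
  have hx : ∀ k, |w.1 k - w'.1 k| ≤ dist w w' := fun k => by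
    simpa [Real.dist_eq] using (lip_x k).dist_le_mul w w'
  have hy : ∀ k, |w.2.1 k - w'.2.1 k| ≤ dist w w' := fun k => by
    simpa [Real.dist_eq] using (lip_y k).dist_le_mul w w'
  have e1 : |w.1 i - w.1 j - (w'.1 i - w'.1 j)| ≤ 2 * dist w w' := by
    have := abs_sub (w.1 i - w'.1 i) (w.1 j - w'.1 j)
    have e : w.1 i - w.1 j - (w'.1 i - w'.1 j) = (w.1 i - w'.1 i) - (w.1 j - w'.1 j) := by ring
    rw [e]; linarith [hx i, hx j]
  have e2 : |Real.sqrt p * (w.2.1 i - w.2.1 j) - Real.sqrt p * (w'.2.1 i - w'.2.1 j)|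
      ≤ Real.sqrt p * (2 * dist w w') := by
    rw [← mul_sub, abs_mul, abs_of_nonneg (Real.sqrt_nonneg p)]
    refine mul_le_mul_of_nonneg_left ?_ (Real.sqrt_nonneg p)
    have := abs_sub (w.2.1 i - w'.2.1 i) (w.2.1 j - w'.2.1 j)
    have e : w.2.1 i - w.2.1 j - (w'.2.1 i - w'.2.1 j)
      = (w.2.1 i - w'.2.1 i) - (w.2.1 j - w'.2.1 j) := by ring
    rw [e]; linarith [hy i, hy j]
  linarith

/-- region in which clamps are inactive -/
def Reg (p vmax K' τ r : ℝ) (w : St n) : Prop :=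
  (∀ i, |w.2.1 i| ≤ K') ∧ (∀ i, |w.2.2.1 i| ≤ τ) ∧ (∀ i, w.2.2.2 i ∈ Set.Ioo 0 vmax) ∧
    (∀ i j, i ≠ j → r ≤ dE p w.1 w.2.1 i j)

theorem pair_field (D : Dat a L lam p vmax vstar φ A μ₁ μ₂ f V U m) (r : ℝ)
    (hr : r ∈ Set.Ioc L lam) (i : Fin n) (g : Fin n → St n → ℝ)
    (hg : ∀ j, ∃ K, LipschitzWith K (g j))
    (hgd : ∀ j w, |g j w| ≤ dE p w.1 w.2.1 i j) :
    ∃ S : St n → ℝ, BL S ∧ ∀ w : St n, (∀ i j, i ≠ j → r ≤ dE p w.1 w.2.1 i j) →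
      S w = ∑ j ∈ Finset.univ.erase i, deriv V (dE p w.1 w.2.1 i j) * g j w
        / dE p w.1 w.2.1 i j := by
  have hp0 : 0 ≤ p := by linarith [D.hp]
  have hlam0 : 0 < lam := D.hL.trans D.hlam
  refine ⟨fun w => ∑ j ∈ Finset.univ.erase i, (fun z => deriv V z / z)
    (cl r lam (dE p w.1 w.2.1 i j)) * (fun z => z) (cl (-lam) lam (g j w)), ?_, ?_⟩
  · refine BL.sum _ fun j _ => BL.mul ?_ ?_
    · refine cl_comp (φ := fun z => deriv V z / z) hr.2 (lip_dE p hp0 i j) fun z hz => ?_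
      have hzL : L < z := hr.1.trans_le hz.1
      exact ((derivV_contDiff L V D.hV).contDiffAt (Ioi_mem_nhds hzL)).div contDiffAt_id
        (D.hL.trans hzL).ne'
    · exact cl_comp (φ := fun z => z) (by linarith) (hg j) fun z _ => contDiffAt_id
  · intro w hw
    refine Finset.sum_congr rfl fun j hj => ?_
    have hij : i ≠ j := (Finset.ne_of_mem_erase hj).symm
    have h1 := hw i j hij
    by_cases h : dE p w.1 w.2.1 i j ≤ lam
    · rw [cl_eq ⟨h1, h⟩, cl_eq (abs_le.1 ((hgd j w).trans h))]; ring
    · have h2 : cl r lam (dE p w.1 w.2.1 i j) = lam := by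
        unfold cl; rw [min_eq_left (by linarith), max_eq_right hr.2]
      beta_reduce
      rw [h2, derivV_zero L lam D.hlam V D.hV D.hV0 lam le_rfl,
        derivV_zero L lam D.hlam V D.hV D.hV0 _ (not_le.1 h).le]
      simp

theorem clamp_field (D : Dat a L lam p vmax vstar φ A μ₁ μ₂ f V U m) (K' τ r : ℝ)
    (hK : K' ∈ Set.Ico 0 a) (hτ : τ ∈ Set.Ico 0 φ) (hr : r ∈ Set.Ioc L lam) (i : Fin n) :
    ∃ cC sC uC FC kC : St n → ℝ, BL cC ∧ BL sC ∧ BL uC ∧ BL FC ∧ BL kC ∧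
      ∀ w : St n, Reg p vmax K' τ r w →
        cC w = w.2.2.2 i * Real.cos (w.2.2.1 i) ∧
        sC w = w.2.2.2 i * Real.sin (w.2.2.1 i) ∧
        uC w = uctrl p vmax vstar φ A μ₁ μ₂ f U V w.1 w.2.1 w.2.2.1 w.2.2.2 i ∧
        FC w = Fctrl p vmax vstar μ₂ f V w.1 w.2.1 w.2.2.1 w.2.2.2 i ∧
        kC w = kGain p vmax vstar μ₂ f V w.1 w.2.1 w.2.2.1 i := by
  obtain ⟨S, hS, hSe⟩ := pair_field D r hr i (fun j w => w.1 i - w.1 j)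
    (fun j => ⟨_, (lip_x i).sub (lip_x j)⟩) (fun j w => abs_x_le_dE p D.hp _ _ i j)
  obtain ⟨P, hP, hPe⟩ := pair_field D r hr i (fun j w => w.2.1 i - w.2.1 j)
    (fun j => ⟨_, (lip_y i).sub (lip_y j)⟩) (fun j w => abs_y_le_dE' p D.hp _ _ i j)
  have hpi := Real.pi_pos
  have hcosτ : ∀ z ∈ Set.Icc (-τ) τ, Real.cos φ < Real.cos z := by
    intro z hz
    rw [← Real.cos_abs z]
    exact Real.cos_lt_cos_of_nonneg_of_le_pi_div_two (abs_nonneg _) D.hφ.2.le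
      ((abs_le.2 hz).trans_lt hτ.2)
  have hcos0 : ∀ z ∈ Set.Icc (-τ) τ, Real.cos z ≠ 0 := fun z hz =>
    (D.hc0.trans (hcosτ z hz)).ne'
  have hCv : ∀ z ∈ Set.Icc (-τ) τ, vstar * (vmax * Real.cos z - vstar) ≠ 0 := by
    intro z hz
    have := mul_lt_mul_of_pos_left (hcosτ z hz) D.hvmax
    exact (mul_pos D.hvs (by linarith [D.hφv])).ne'
  have hττ : -τ ≤ τ := by linarith [hτ.1]
  have lipT : ∃ K, LipschitzWith K (fun w : St n => w.2.2.1 i) := ⟨_, lip_th i⟩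
  have bcos := cl_comp hττ lipT (φ := Real.cos) fun z _ => Real.contDiff_cos.contDiffAt
  have bsin := cl_comp hττ lipT (φ := Real.sin) fun z _ => Real.contDiff_sin.contDiffAt
  have bicos := cl_comp hττ lipT (φ := fun z => 1 / Real.cos z) fun z hz =>
    contDiffAt_const.div Real.contDiff_cos.contDiffAt (hcos0 z hz)
  have bcoef := cl_comp hττ lipT
    (φ := fun z => (vmax * Real.cos z) / (vstar * (vmax * Real.cos z - vstar))) fun z hz =>
    (contDiffAt_const.mul Real.contDiff_cos.contDiffAt).div (contDiffAt_const.mul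
      ((contDiffAt_const.mul Real.contDiff_cos.contDiffAt).sub contDiffAt_const)) (hCv z hz)
  have bv := cl_comp D.hvmax.le (⟨_, lip_v i⟩ : ∃ K, LipschitzWith K (fun w : St n => w.2.2.2 i))
    (φ := fun z => z) fun z _ => contDiffAt_id
  have bU := cl_comp (show -K' ≤ K' by linarith [hK.1])
    (⟨_, lip_y i⟩ : ∃ K, LipschitzWith K (fun w : St n => w.2.1 i))
    (φ := deriv U) fun z hz => (derivU_contDiff a U D.hU).contDiffAt
      (Ioo_mem_nhds (by linarith [hz.1, hK.2]) (by linarith [hz.2, hK.2]))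
  have bf : BL (fun w => f (- S w)) := by
    obtain ⟨hl, B, hB⟩ := hS.neg
    exact BL.comp hl (fun w => abs_le.1 (hB w)) fun z _ => D.hf.contDiffAt
  have bk := ((BL.const μ₂).add ((BL.const (1/vstar)).mul hS)).add (bcoef.mul bf)
  have bF := ((bk.mul bicos).neg.mul ((bv.mul bcos).sub (BL.const vstar))).sub (bicos.mul hS)
  have bc := bcos.sub (BL.const (Real.cos φ))
  have bq := bv.mul (bc.mul bc)
  have biq : BL (fun w : St n => (cl 0 vmax (w.2.2.2 i)
      * ((Real.cos (cl (-τ) τ (w.2.2.1 i)) - Real.cos φ)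
        * (Real.cos (cl (-τ) τ (w.2.2.1 i)) - Real.cos φ)))
      / (vstar * (cl 0 vmax (w.2.2.2 i)
      * ((Real.cos (cl (-τ) τ (w.2.2.1 i)) - Real.cos φ)
        * (Real.cos (cl (-τ) τ (w.2.2.1 i)) - Real.cos φ))) + A)) := by
    obtain ⟨hl, B, hB⟩ := bq
    refine BL.comp (φ := fun z => z / (vstar * z + A)) (lo := 0) (hi := B) hl
      (fun w => ⟨?_, (le_abs_self _).trans (hB w)⟩) fun z hz => ?_
    · exact mul_nonneg (cl_mem D.hvmax.le _).1 (mul_self_nonneg _)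
    · refine contDiffAt_id.div ((contDiffAt_const.mul contDiffAt_id).add contDiffAt_const) ?_
      have := mul_nonneg D.hvs.le hz.1
      have := D.hA
      exact (by linarith : 0 < vstar * z + A).ne'
  have bu := biq.neg.mul ((((BL.const μ₁).mul bv).mul bsin).add bU |>.add
    ((BL.const p).mul hP) |>.add (bsin.mul bF))
  refine ⟨_, _, _, _, _, bv.mul bcos, bv.mul bsin, bu, bF, bk, ?_⟩
  rintro w ⟨hwy, hwt, hwv, hwd⟩
  have e1 := cl_eq (abs_le.1 (hwy i))
  have e2 := cl_eq (abs_le.1 (hwt i))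
  have e3 := cl_eq (⟨(hwv i).1.le, (hwv i).2.le⟩ : w.2.2.2 i ∈ Set.Icc 0 vmax)
  have e4 : S w = Sx p V w.1 w.2.1 i := hSe w hwd
  have e5 : P w = Sy p V w.1 w.2.1 i := hPe w hwd
  have ek : μ₂ + 1 / vstar * Sx p V w.1 w.2.1 i + vmax * Real.cos (w.2.2.1 i)
      / (vstar * (vmax * Real.cos (w.2.2.1 i) - vstar)) * f (-(Sx p V w.1 w.2.1 i))
      = kGain p vmax vstar μ₂ f V w.1 w.2.1 w.2.2.1 i := rfl
  have hFe : -(kGain p vmax vstar μ₂ f V w.1 w.2.1 w.2.2.1 i * (1 / Real.cos (w.2.2.1 i)))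
      * (w.2.2.2 i * Real.cos (w.2.2.1 i) - vstar)
      - 1 / Real.cos (w.2.2.1 i) * Sx p V w.1 w.2.1 i
      = Fctrl p vmax vstar μ₂ f V w.1 w.2.1 w.2.2.1 w.2.2.2 i := by
    unfold Fctrl; ring
  simp only [e1, e2, e3, e4, e5, ek, hFe]
  refine ⟨trivial, trivial, ?_, trivial, trivial⟩
  unfold uctrl
  congr 2
  have hvi := (hwv i).1
  have hd0 : 0 < Real.cos (w.2.2.1 i) - Real.cos φ := sub_pos.2 (hcosτ _ (abs_le.1 (hwt i)))
  have hA := D.hA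
  have hvs := D.hvs
  have : 0 < vstar * (w.2.2.2 i * ((Real.cos (w.2.2.1 i) - Real.cos φ)
    * (Real.cos (w.2.2.1 i) - Real.cos φ))) + A := by positivity
  rw [eq_comm, inv_eq_iff_eq_inv, inv_div]
  field_simp

theorem BL_pi {E : Type*} [PseudoMetricSpace E] (g : Fin n → E → ℝ) (hg : ∀ i, BL (g i)) :
    ∃ K M : NNReal, LipschitzWith K (fun w i => g i w) ∧ ∀ w, ‖(fun i => g i w)‖ ≤ M := by
  choose hK B hB using hg
  choose K hK using hK
  refine ⟨∑ i, K i, ∑ i, Real.toNNReal (B i), ?_, ?_⟩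
  · refine LipschitzWith.of_dist_le_mul fun w w' => ?_
    rw [dist_pi_le_iff (by positivity)]
    intro i
    refine ((hK i).dist_le_mul w w').trans ?_
    gcongr
    exact_mod_cast Finset.single_le_sum (f := K) (fun _ _ => zero_le) (Finset.mem_univ i)
  · intro w
    rw [pi_norm_le_iff_of_nonneg (by positivity)]
    intro i
    refine (hB i w).trans ((Real.le_coe_toNNReal (B i)).trans ?_)
    exact_mod_cast Finset.single_le_sum (f := fun i => Real.toNNReal (B i))
      (fun _ _ => zero_le) (Finset.mem_univ i)

theorem apriori (D : Dat a L lam p vmax vstar φ A μ₁ μ₂ f V U m) (κ ρ : ℝ → ℝ)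
    (hκ : ∀ s, 0 ≤ s → κ s ∈ Set.Ico 0 a)
    (hκU : ∀ s, 0 ≤ s → ∀ y ∈ Set.Ioo (-a) a, U y ≤ s → |y| ≤ κ s)
    (hρ : ∀ s, 0 ≤ s → ρ s ∈ Set.Ioc L lam)
    (hρV : ∀ s, 0 ≤ s → ∀ d, L < d → V d ≤ 2 * s → ρ s ≤ d)
    (X Y Θ W : ℝ → Fin n → ℝ) (T : ℝ)
    (hΩ : ∀ t ∈ Set.Ico 0 T, inOmega a L p vmax φ (X t) (Y t) (Θ t) (W t))
    (h : ∀ t ∈ Set.Ico 0 T, ∀ i,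
    HasDerivWithinAt (fun s => X s i) (W t i * Real.cos (Θ t i)) (Set.Ici 0) t ∧
    HasDerivWithinAt (fun s => Y s i) (W t i * Real.sin (Θ t i)) (Set.Ici 0) t ∧
    HasDerivWithinAt (fun s => Θ s i)
      (uctrl p vmax vstar φ A μ₁ μ₂ f U V (X t) (Y t) (Θ t) (W t) i) (Set.Ici 0) t ∧
    HasDerivWithinAt (fun s => W s i)
      (Fctrl p vmax vstar μ₂ f V (X t) (Y t) (Θ t) (W t) i) (Set.Ici 0) t) :
    AntitoneOn (fun t => Hfun p vstar φ A U V (X t) (Y t) (Θ t) (W t)) (Set.Ico 0 T) ∧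
    (∀ t ∈ Set.Ico 0 T, Hfun p vstar φ A U V (X t) (Y t) (Θ t) (W t)
      ≤ Hfun p vstar φ A U V (X 0) (Y 0) (Θ 0) (W 0)) ∧
    ∃ R : ℝ, ∀ t ∈ Set.Ico 0 T, ∀ i, W 0 i * Real.exp (-(R * t)) ≤ W t i ∧
      (vmax - W 0 i) * Real.exp (-(R * t)) ≤ vmax - W t i := by
  have hd := fun t ht => H_deriv D X Y Θ W t (Set.Ici 0) (hΩ t ht) (h t ht)
  have hanti : AntitoneOn (fun t => Hfun p vstar φ A U V (X t) (Y t) (Θ t) (W t))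
      (Set.Ico 0 T) := by
    refine antitoneOn_of_hasDerivWithinAt_nonpos (convex_Ico 0 T) ?_ (fun t ht =>
      (hd t (interior_subset ht)).mono (interior_subset.trans Set.Ico_subset_Ici_self)) ?_
    · exact fun t ht => ((hd t ht).continuousWithinAt).mono Set.Ico_subset_Ici_self
    · intro t ht
      have hst := (static_all D κ ρ hκ hκU hρ hρV _ _ _ _ (hΩ t (interior_subset ht)) _
        le_rfl).2.2.2.2
      rw [neg_nonpos]
      refine Finset.sum_nonneg fun i _ => ?_
      have h1 := D.hμ₂.le.trans (hst i).1
      have h2 := D.hμ₁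
      positivity
  have hle : ∀ t ∈ Set.Ico 0 T, Hfun p vstar φ A U V (X t) (Y t) (Θ t) (W t)
      ≤ Hfun p vstar φ A U V (X 0) (Y 0) (Θ 0) (W 0) := fun t ht =>
    hanti ⟨le_rfl, ht.1.trans_lt ht.2⟩ ht ht.1
  refine ⟨hanti, hle, Rfun lam vmax vstar φ A μ₂ m f V ρ
    (Hfun p vstar φ A U V (X 0) (Y 0) (Θ 0) (W 0)), fun t ht i => ?_⟩
  have hst := fun t ht => (static_all D κ ρ hκ hκU hρ hρV _ _ _ _ (hΩ t ht) _
        (hle t ht)).2.2.2.2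
  constructor
  · exact pos_prop (fun t => W t i) _ _ T (fun t ht => (h t ht i).2.2.2)
      (fun t ht => (hst t ht i).2.1) t ht
  · exact pos_prop (fun t => vmax - W t i) _ _ T (fun t ht => ((h t ht i).2.2.2).const_sub vmax)
      (fun t ht => neg_le_neg (hst t ht i).2.2.1) t ht

end Clamp

section Final

variable {n : ℕ} {a L lam p vmax vstar φ A μ₁ μ₂ : ℝ} {f V U : ℝ → ℝ} {m : ℕ}

theorem params (D : Dat a L lam p vmax vstar φ A μ₁ μ₂ f V U m) (κ ρ : ℝ → ℝ)
    (hκ : ∀ s, 0 ≤ s → κ s ∈ Set.Ico 0 a)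
    (hκU : ∀ s, 0 ≤ s → ∀ y ∈ Set.Ioo (-a) a, U y ≤ s → |y| ≤ κ s)
    (hρ : ∀ s, 0 ≤ s → ρ s ∈ Set.Ioc L lam)
    (hρV : ∀ s, 0 ≤ s → ∀ d, L < d → V d ≤ 2 * s → ρ s ≤ d) (s : ℝ) (hs : 0 ≤ s) :
    ∃ K1 K' τ1 τ r1 r : ℝ, K1 < K' ∧ K' ∈ Set.Ico 0 a ∧ τ1 < τ ∧ τ ∈ Set.Ico 0 φ ∧ r < r1 ∧
      r ∈ Set.Ioc L lam ∧ ∀ x y θ v : Fin n → ℝ, inOmega a L p vmax φ x y θ v →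
        Hfun p vstar φ A U V x y θ v ≤ s →
        (∀ i, |y i| ≤ K1) ∧ (∀ i, |θ i| ≤ τ1) ∧ (∀ i j, i ≠ j → r1 ≤ dE p x y i j) := by
  set C := (A + s * Real.cos φ * (1 - Real.cos φ)) / (A + s * (1 - Real.cos φ)) with hC
  have hA := D.hA
  have hc1 := D.hc1
  have hc0 := D.hc0
  have h1c : 0 < 1 - Real.cos φ := by linarith
  have hden : 0 < A + s * (1 - Real.cos φ) := by positivity
  have hCφ : Real.cos φ < C := by
    rw [hC, lt_div_iff₀ hden]
    nlinarith
  have hC1 : C ≤ 1 := by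
    rw [hC, div_le_one hden]
    have : 0 ≤ s * (1 - Real.cos φ) := by positivity
    nlinarith
  have hφ := D.hφ
  have hpi := Real.pi_pos
  have hτφ : Real.arccos C < φ := by
    have := Real.arccos_lt_arccos (by linarith) hCφ hC1
    rwa [Real.arccos_cos hφ.1.le (by linarith [hφ.2])] at this
  have hτ0 := Real.arccos_nonneg C
  have hk := hκ s hs
  have hr := hρ s hs
  refine ⟨κ s, (κ s + a) / 2, Real.arccos C, (Real.arccos C + φ) / 2, ρ s, (ρ s + L) / 2,
    by linarith [hk.2], ⟨by linarith [hk.1, hk.2], by linarith [hk.2]⟩, by linarith,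
    ⟨by linarith [hφ.1], by linarith⟩, by linarith [hr.1], ⟨by linarith [hr.1],
      by linarith [hr.1, hr.2, D.hlam]⟩, ?_⟩
  intro x y θ v hΩ hH
  obtain ⟨-, h1, h2, h3, -⟩ := static_all D κ ρ hκ hκU hρ hρV x y θ v hΩ s hH
  refine ⟨h1, fun i => ?_, h2⟩
  have h4 := Real.arccos_le_arccos (h3 i)
  have h5 := hΩ.2.1 i
  rw [← Real.cos_abs, Real.arccos_cos (abs_nonneg _)] at h4
  · exact h4
  · have := abs_lt.2 h5
    linarith [hφ.2]

theorem deriv_iff (α : ℝ → St n) (c s u F : Fin n → ℝ) (S : Set ℝ) (t : ℝ) :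
    HasDerivWithinAt α ((c, s, u, F) : St n) S t ↔ ∀ i,
      HasDerivWithinAt (fun r => (α r).1 i) (c i) S t ∧
      HasDerivWithinAt (fun r => (α r).2.1 i) (s i) S t ∧
      HasDerivWithinAt (fun r => (α r).2.2.1 i) (u i) S t ∧
      HasDerivWithinAt (fun r => (α r).2.2.2 i) (F i) S t := by
  constructor
  · intro h i
    have h1 := (ContinuousLinearMap.fst ℝ (Fin n → ℝ)
      ((Fin n → ℝ) × (Fin n → ℝ) × (Fin n → ℝ))).hasFDerivAt.comp_hasDerivWithinAt t h
    have h2 := (ContinuousLinearMap.snd ℝ (Fin n → ℝ)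
      ((Fin n → ℝ) × (Fin n → ℝ) × (Fin n → ℝ))).hasFDerivAt.comp_hasDerivWithinAt t h
    have h3 := (ContinuousLinearMap.fst ℝ (Fin n → ℝ)
      ((Fin n → ℝ) × (Fin n → ℝ))).hasFDerivAt.comp_hasDerivWithinAt t h2
    have h4 := (ContinuousLinearMap.snd ℝ (Fin n → ℝ)
      ((Fin n → ℝ) × (Fin n → ℝ))).hasFDerivAt.comp_hasDerivWithinAt t h2
    have h5 := (ContinuousLinearMap.fst ℝ (Fin n → ℝ)
      ((Fin n → ℝ))).hasFDerivAt.comp_hasDerivWithinAt t h4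
    have h6 := (ContinuousLinearMap.snd ℝ (Fin n → ℝ)
      ((Fin n → ℝ))).hasFDerivAt.comp_hasDerivWithinAt t h4
    exact ⟨hasDerivWithinAt_pi.1 h1 i, hasDerivWithinAt_pi.1 h3 i, hasDerivWithinAt_pi.1 h5 i,
      hasDerivWithinAt_pi.1 h6 i⟩
  · intro h
    exact (hasDerivWithinAt_pi.2 fun i => (h i).1).prodMk
      ((hasDerivWithinAt_pi.2 fun i => (h i).2.1).prodMk
      ((hasDerivWithinAt_pi.2 fun i => (h i).2.2.1).prodMk
      (hasDerivWithinAt_pi.2 fun i => (h i).2.2.2)))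

theorem field_exists (c s u F : Fin n → St n → ℝ) (hc : ∀ i, BL (c i)) (hs : ∀ i, BL (s i))
    (hu : ∀ i, BL (u i)) (hF : ∀ i, BL (F i)) :
    ∃ K M : NNReal, LipschitzWith K (fun w : St n =>
      ((fun i => c i w, fun i => s i w, fun i => u i w, fun i => F i w) : St n)) ∧
      ∀ w : St n, ‖((fun i => c i w, fun i => s i w, fun i => u i w, fun i => F i w) : St n)‖ ≤ M := by
  obtain ⟨K1, M1, h1, h1'⟩ := BL_pi c hc
  obtain ⟨K2, M2, h2, h2'⟩ := BL_pi s hs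
  obtain ⟨K3, M3, h3, h3'⟩ := BL_pi u hu
  obtain ⟨K4, M4, h4, h4'⟩ := BL_pi F hF
  refine ⟨_, max M1 (max M2 (max M3 M4)), h1.prodMk (h2.prodMk (h3.prodMk h4)), fun w => ?_⟩
  simp only [Prod.norm_mk, NNReal.coe_max]
  exact max_le_max (h1' w) (max_le_max (h2' w) (max_le_max (h3' w) (h4' w)))

/-- open invariant box is never left -/
theorem invariance (D : Dat a L lam p vmax vstar φ A μ₁ μ₂ f V U m) (κ ρ : ℝ → ℝ)
    (hκ : ∀ s, 0 ≤ s → κ s ∈ Set.Ico 0 a)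
    (hκU : ∀ s, 0 ≤ s → ∀ y ∈ Set.Ioo (-a) a, U y ≤ s → |y| ≤ κ s)
    (hρ : ∀ s, 0 ≤ s → ρ s ∈ Set.Ioc L lam)
    (hρV : ∀ s, 0 ≤ s → ∀ d, L < d → V d ≤ 2 * s → ρ s ≤ d)
    (K1 K' τ1 τ r1 r : ℝ) (hK1 : K1 < K') (hK : K' ∈ Set.Ico 0 a) (hτ1 : τ1 < τ)
    (hτ : τ ∈ Set.Ico 0 φ) (hr1 : r < r1) (hr : r ∈ Set.Ioc L lam)
    (α : ℝ → St n) (hα : ContinuousOn α (Set.Ici 0))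
    (hΩ : inOmega a L p vmax φ (α 0).1 (α 0).2.1 (α 0).2.2.1 (α 0).2.2.2)
    (hbd : ∀ x y θ v : Fin n → ℝ, inOmega a L p vmax φ x y θ v →
        Hfun p vstar φ A U V x y θ v
          ≤ Hfun p vstar φ A U V (α 0).1 (α 0).2.1 (α 0).2.2.1 (α 0).2.2.2 →
        (∀ i, |y i| ≤ K1) ∧ (∀ i, |θ i| ≤ τ1) ∧ (∀ i j, i ≠ j → r1 ≤ dE p x y i j))
    (hsol : ∀ t ∈ Set.Ici (0:ℝ), Reg p vmax K' τ r (α t) → ∀ i,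
      HasDerivWithinAt (fun s => (α s).1 i) ((α t).2.2.2 i * Real.cos ((α t).2.2.1 i)) (Set.Ici 0) t ∧
      HasDerivWithinAt (fun s => (α s).2.1 i) ((α t).2.2.2 i * Real.sin ((α t).2.2.1 i)) (Set.Ici 0) t ∧
      HasDerivWithinAt (fun s => (α s).2.2.1 i)
        (uctrl p vmax vstar φ A μ₁ μ₂ f U V (α t).1 (α t).2.1 (α t).2.2.1 (α t).2.2.2 i) (Set.Ici 0) t ∧
      HasDerivWithinAt (fun s => (α s).2.2.2 i)
        (Fctrl p vmax vstar μ₂ f V (α t).1 (α t).2.1 (α t).2.2.1 (α t).2.2.2 i) (Set.Ici 0) t) :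
    ∀ t ∈ Set.Ici (0:ℝ), Reg p vmax K' τ r (α t) ∧
      inOmega a L p vmax φ (α t).1 (α t).2.1 (α t).2.2.1 (α t).2.2.2 := by
  have hp0 : 0 ≤ p := by linarith [D.hp]
  let O : Set (St n) := {w | (∀ i, |w.2.1 i| < K') ∧ (∀ i, |w.2.2.1 i| < τ) ∧
    (∀ i, w.2.2.2 i ∈ Set.Ioo 0 vmax) ∧ (∀ i j, i ≠ j → r < dE p w.1 w.2.1 i j)}
  have cdE : ∀ i j, Continuous (fun w : St n => dE p w.1 w.2.1 i j) := fun i j => by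
    obtain ⟨K, hK⟩ := lip_dE (n := n) p hp0 i j
    exact hK.continuous
  have hOopen : IsOpen O := by
    have : O = (⋂ i, {w : St n | |w.2.1 i| < K'}) ∩ ((⋂ i, {w : St n | |w.2.2.1 i| < τ}) ∩
      ((⋂ i, ({w : St n | 0 < w.2.2.2 i} ∩ {w : St n | w.2.2.2 i < vmax})) ∩
      (⋂ i, ⋂ j, ⋂ _ : i ≠ j, {w : St n | r < dE p w.1 w.2.1 i j}))) := by
      ext w; simp [O]
    rw [this]
    refine IsOpen.inter (isOpen_iInter_of_finite fun i => ?_)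
      (IsOpen.inter (isOpen_iInter_of_finite fun i => ?_)
      (IsOpen.inter (isOpen_iInter_of_finite fun i => IsOpen.inter ?_ ?_)
      (isOpen_iInter_of_finite fun i => isOpen_iInter_of_finite fun j =>
        isOpen_iInter_of_finite fun _ => ?_)))
    · exact isOpen_lt (lip_y i).continuous.abs continuous_const
    · exact isOpen_lt (lip_th i).continuous.abs continuous_const
    · exact isOpen_lt continuous_const (lip_v i).continuous
    · exact isOpen_lt (lip_v i).continuous continuous_const
    · exact isOpen_lt continuous_const (cdE i j)
  have hOR : ∀ w ∈ O, Reg p vmax K' τ r w := fun w hw =>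
    ⟨fun i => (hw.1 i).le, fun i => (hw.2.1 i).le, hw.2.2.1, fun i j h => (hw.2.2.2 i j h).le⟩
  have hOΩ : ∀ w ∈ O, inOmega a L p vmax φ w.1 w.2.1 w.2.2.1 w.2.2.2 := fun w hw =>
    ⟨fun i => abs_lt.1 ((hw.1 i).trans hK.2), fun i => abs_lt.1 ((hw.2.1 i).trans hτ.2), hw.2.2.1,
      fun i j h => hr.1.trans (hw.2.2.2 i j h)⟩
  suffices hmain : ∀ t ∈ Set.Ici (0:ℝ), α t ∈ O from fun t ht => ⟨hOR _ (hmain t ht), hOΩ _ (hmain t ht)⟩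
  have h0O : α 0 ∈ O := by
    obtain ⟨h1, h2, h3⟩ := hbd _ _ _ _ hΩ le_rfl
    exact ⟨fun i => (h1 i).trans_lt hK1, fun i => (h2 i).trans_lt hτ1, hΩ.2.2.1,
      fun i j h => hr1.trans_le (h3 i j h)⟩
  by_contra hcon
  push Not at hcon
  obtain ⟨tb, htb, htbO⟩ := hcon
  let B : Set ℝ := Set.Ici 0 ∩ α ⁻¹' Oᶜ
  have hBc : IsClosed B := hα.preimage_isClosed_of_isClosed isClosed_Ici hOopen.isClosed_compl
  have hBn : B.Nonempty := ⟨tb, htb, htbO⟩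
  have hBb : BddBelow B := ⟨0, fun t ht => ht.1⟩
  have ht1 := hBc.csInf_mem hBn hBb
  set t1 := sInf B with ht1d
  have hpos : 0 < t1 := lt_of_le_of_ne ht1.1 (fun h => ht1.2 (h ▸ h0O))
  have hin : ∀ t ∈ Set.Ico 0 t1, α t ∈ O := by
    intro t ht
    by_contra h
    exact absurd (csInf_le hBb ⟨ht.1, h⟩) (not_le.2 ht.2)
  obtain ⟨-, hH, R, hR⟩ := apriori D κ ρ hκ hκU hρ hρV (fun t => (α t).1) (fun t => (α t).2.1)
    (fun t => (α t).2.2.1) (fun t => (α t).2.2.2) t1 (fun t ht => hOΩ _ (hin t ht))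
    (fun t ht => hsol t ht.1 (hOR _ (hin t ht)))
  have hbd' := fun t ht => hbd _ _ _ _ (hOΩ _ (hin t ht)) (hH t ht)
  apply ht1.2
  have hne : (nhdsWithin t1 (Set.Ico 0 t1)).NeBot := by
    rw [← mem_closure_iff_nhdsWithin_neBot, closure_Ico hpos.ne]
    exact ⟨hpos.le, le_rfl⟩
  have hαt : Filter.Tendsto α (nhdsWithin t1 (Set.Ico 0 t1)) (nhds (α t1)) :=
    (hα t1 ht1.1).mono Set.Ico_subset_Ici_self
  have lim : ∀ g : St n → ℝ, Continuous g → Filter.Tendsto (fun t => g (α t))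
      (nhdsWithin t1 (Set.Ico 0 t1)) (nhds (g (α t1))) := fun g hg => (hg.tendsto _).comp hαt
  have le_lim : ∀ (g : St n → ℝ) (e : ℝ → ℝ), Continuous g → Continuous e →
      (∀ t ∈ Set.Ico 0 t1, e t ≤ g (α t)) → e t1 ≤ g (α t1) := by
    intro g e hg he h
    refine le_of_tendsto_of_tendsto ((he.tendsto t1).mono_left nhdsWithin_le_nhds) (lim g hg) ?_
    filter_upwards [self_mem_nhdsWithin] with t ht using h t ht
  have hexp : ∀ q : ℝ, Continuous (fun t : ℝ => q * Real.exp (-(R * t))) := fun q => by fun_prop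
  refine ⟨fun i => ?_, fun i => ?_, fun i => ⟨?_, ?_⟩, fun i j hij => ?_⟩
  · have := le_lim (fun w => - |w.2.1 i|) (fun _ => -K1) (lip_y i).continuous.abs.neg continuous_const
      (fun t ht => neg_le_neg ((hbd' t ht).1 i))
    linarith
  · have := le_lim (fun w => - |w.2.2.1 i|) (fun _ => -τ1) (lip_th i).continuous.abs.neg
      continuous_const (fun t ht => neg_le_neg ((hbd' t ht).2.1 i))
    linarith
  · have := le_lim (fun w => w.2.2.2 i) _ (lip_v i).continuous
      (hexp ((α 0).2.2.2 i)) (fun t ht => (hR t ht i).1)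
    exact lt_of_lt_of_le (mul_pos (hΩ.2.2.1 i).1 (Real.exp_pos _)) this
  · have := le_lim (fun w => vmax - w.2.2.2 i) _ (continuous_const.sub (lip_v i).continuous)
      (hexp (vmax - (α 0).2.2.2 i)) (fun t ht => (hR t ht i).2)
    have h2 := lt_of_lt_of_le (mul_pos (sub_pos.2 (hΩ.2.2.1 i).2) (Real.exp_pos _)) this
    simpa using h2
  · have := le_lim (fun w => dE p w.1 w.2.1 i j) (fun _ => r1) (cdE i j)
      continuous_const (fun t ht => (hbd' t ht).2.2 i j hij)
    exact hr1.trans_le this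

end Final

section Conv

variable {n : ℕ} {a L lam p vmax vstar φ A μ₁ μ₂ : ℝ} {f V U : ℝ → ℝ} {m : ℕ}

/-- a bounded Lipschitz observable along a trajectory is Lipschitz in time -/
theorem BL_along {E : Type*} [NormedAddCommGroup E] [NormedSpace ℝ E] (G : E → E) (M : NNReal)
    (hM : ∀ x, ‖G x‖ ≤ M) (α : ℝ → E)
    (hα : ∀ t ∈ Set.Ici (0:ℝ), HasDerivWithinAt α (G (α t)) (Set.Ici 0) t)
    (g : E → ℝ) (hg : BL g) :
    ∃ C : ℝ, 0 ≤ C ∧ ∀ s t, 0 ≤ s → s ≤ t → |g (α s) - g (α t)| ≤ C * (t - s) := by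
  obtain ⟨⟨K, hK⟩, -⟩ := hg
  refine ⟨K * M, by positivity, fun s t hs hst => ?_⟩
  have h1 := (convex_Ici (0:ℝ)).norm_image_sub_le_of_norm_hasDerivWithin_le hα
    (fun t _ => hM (α t)) (show t ∈ Set.Ici (0:ℝ) from hs.trans hst) (show s ∈ Set.Ici (0:ℝ) from hs)
  have h2 := hK.dist_le_mul (α s) (α t)
  rw [Real.dist_eq, dist_eq_norm] at h2
  rw [Real.norm_eq_abs, abs_sub_comm, abs_of_nonneg (sub_nonneg.2 hst)] at h1
  refine h2.trans ?_
  rw [mul_assoc]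
  gcongr

theorem sq_tend (q : ℝ → ℝ) (c : ℝ) (Q : ℝ → ℝ) (hc : 0 < c)
    (h : ∀ t, 0 ≤ t → c * q t ^ 2 ≤ Q t) (hQ : Tendsto Q atTop (nhds 0)) :
    Tendsto q atTop (nhds 0) := by
  have h1 : Tendsto (fun t => q t ^ 2) atTop (nhds 0) := by
    refine squeeze_zero' (g := fun t => Q t / c) (Eventually.of_forall fun t => sq_nonneg _) ?_ ?_
    · filter_upwards [eventually_ge_atTop 0] with t ht
      rw [le_div_iff₀ hc]; linarith [h t ht]
    · simpa using hQ.div_const c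
  have h2 := h1.sqrt
  simp only [Real.sqrt_sq_eq_abs, Real.sqrt_zero] at h2
  exact (tendsto_zero_iff_abs_tendsto_zero _).2 h2

theorem main_w0 (D : Dat a L lam p vmax vstar φ A μ₁ μ₂ f V U m) (κ ρ : ℝ → ℝ)
    (hκ : ∀ s, 0 ≤ s → κ s ∈ Set.Ico 0 a)
    (hκU : ∀ s, 0 ≤ s → ∀ y ∈ Set.Ioo (-a) a, U y ≤ s → |y| ≤ κ s)
    (hρ : ∀ s, 0 ≤ s → ρ s ∈ Set.Ioc L lam)
    (hρV : ∀ s, 0 ≤ s → ∀ d, L < d → V d ≤ 2 * s → ρ s ≤ d)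
    (x₀ y₀ θ₀ v₀ : Fin n → ℝ) (hΩ0 : inOmega a L p vmax φ x₀ y₀ θ₀ v₀) :
        ∃ X Y Θ W : ℝ → Fin n → ℝ,
          IsSol a L p vmax vstar φ A μ₁ μ₂ f U V x₀ y₀ θ₀ v₀ X Y Θ W ∧
          (∀ X' Y' Θ' W' : ℝ → Fin n → ℝ,
            IsSol a L p vmax vstar φ A μ₁ μ₂ f U V x₀ y₀ θ₀ v₀ X' Y' Θ' W' →
            ∀ t ∈ Set.Ici (0:ℝ), X' t = X t ∧ Y' t = Y t ∧ Θ' t = Θ t ∧ W' t = W t) ∧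
          (∀ i, Filter.Tendsto (fun t => W t i) Filter.atTop (nhds vstar)) ∧
          (∀ i, Filter.Tendsto (fun t => Θ t i) Filter.atTop (nhds 0)) ∧
          (∀ i, Filter.Tendsto
            (fun t => uctrl p vmax vstar φ A μ₁ μ₂ f U V (X t) (Y t) (Θ t) (W t) i)
            Filter.atTop (nhds 0)) ∧
          (∀ i, Filter.Tendsto
            (fun t => Fctrl p vmax vstar μ₂ f V (X t) (Y t) (Θ t) (W t) i)
            Filter.atTop (nhds 0)) ∧
          (∀ t ∈ Set.Ici (0:ℝ), ∀ i,
            |Fctrl p vmax vstar μ₂ f V (X t) (Y t) (Θ t) (W t) i|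
              ≤ Rfun lam vmax vstar φ A μ₂ m f V ρ
                  (Hfun p vstar φ A U V x₀ y₀ θ₀ v₀) * vmax ∧
            |uctrl p vmax vstar φ A μ₁ μ₂ f U V (X t) (Y t) (Θ t) (W t) i|
              ≤ (1/vstar) * ((μ₁ + Rfun lam vmax vstar φ A μ₂ m f V ρ
                    (Hfun p vstar φ A U V x₀ y₀ θ₀ v₀)) * vmax
                  + b2 U (κ (Hfun p vstar φ A U V x₀ y₀ θ₀ v₀))
                  + m * Real.sqrt p * b1 lam V (ρ (Hfun p vstar φ A U V x₀ y₀ θ₀ v₀)))) := by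
  have hs0 := (static_all D κ ρ hκ hκU hρ hρV _ _ _ _ hΩ0 _ le_rfl).1
  obtain ⟨K1, K', τ1, τ, r1, r, hK1, hK, hτ1, hτ, hr1, hr, hbd⟩ :=
    params (n := n) D κ ρ hκ hκU hρ hρV _ hs0
  choose c s u F k hc hs hu hF hk heq using
    fun i : Fin n => clamp_field (n := n) D K' τ r hK hτ hr i
  obtain ⟨KG, M, hKG, hM⟩ := field_exists c s u F hc hs hu hF
  set G : St n → St n := fun w : St n =>
      ((fun i => c i w, fun i => s i w, fun i => u i w, fun i => F i w) : St n) with hGd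
  obtain ⟨α, hα0, hα⟩ := global_exist G KG M hKG hM (x₀, y₀, θ₀, v₀)
  have hcont : ContinuousOn α (Set.Ici 0) := fun t ht => (hα t ht).continuousWithinAt
  have hder := fun t ht => (deriv_iff α _ _ _ _ _ t).1 (hα t ht)
  have hsol : ∀ t ∈ Set.Ici (0:ℝ), Reg p vmax K' τ r (α t) → ∀ i,
      HasDerivWithinAt (fun s => (α s).1 i) ((α t).2.2.2 i * Real.cos ((α t).2.2.1 i)) (Set.Ici 0) t ∧
      HasDerivWithinAt (fun s => (α s).2.1 i) ((α t).2.2.2 i * Real.sin ((α t).2.2.1 i)) (Set.Ici 0) t ∧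
      HasDerivWithinAt (fun s => (α s).2.2.1 i)
        (uctrl p vmax vstar φ A μ₁ μ₂ f U V (α t).1 (α t).2.1 (α t).2.2.1 (α t).2.2.2 i) (Set.Ici 0) t ∧
      HasDerivWithinAt (fun s => (α s).2.2.2 i)
        (Fctrl p vmax vstar μ₂ f V (α t).1 (α t).2.1 (α t).2.2.1 (α t).2.2.2 i) (Set.Ici 0) t := by
    intro t ht hreg i
    obtain ⟨e1, e2, e3, e4, -⟩ := heq i _ hreg
    rw [← e1, ← e2, ← e3, ← e4]
    exact hder t ht i
  have hinv := invariance D κ ρ hκ hκU hρ hρV K1 K' τ1 τ r1 r hK1 hK hτ1 hτ hr1 hr α hcont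
    (by rw [hα0]; exact hΩ0) (by rw [hα0]; exact hbd) hsol
  have hode := fun t ht => hsol t ht (hinv t ht).1
  have hap := fun T : ℝ => apriori D κ ρ hκ hκU hρ hρV (fun t => (α t).1) (fun t => (α t).2.1)
    (fun t => (α t).2.2.1) (fun t => (α t).2.2.2) T (fun t ht => (hinv t ht.1).2)
    (fun t ht => hode t ht.1)
  have hHle : ∀ t ∈ Set.Ici (0:ℝ), Hfun p vstar φ A U V (α t).1 (α t).2.1 (α t).2.2.1 (α t).2.2.2
      ≤ Hfun p vstar φ A U V x₀ y₀ θ₀ v₀ := by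
    intro t ht
    have := (hap (t + 1)).2.1 t ⟨ht, by linarith⟩
    simpa only [hα0] using this
  have hst := fun t ht => static_all D κ ρ hκ hκU hρ hρV _ _ _ _ (hinv t ht).2 _ (hHle t ht)
  -- Lipschitz in time of observables
  have hlip := BL_along G M hM α hα
  -- limit of H
  obtain ⟨cH, hcH⟩ : ∃ cH, Tendsto (fun t => Hfun p vstar φ A U V (α t).1 (α t).2.1 (α t).2.2.1
      (α t).2.2.2) atTop (nhds cH) := by
    let g : ℝ → ℝ := fun t => Hfun p vstar φ A U V (α (max t 0)).1 (α (max t 0)).2.1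
      (α (max t 0)).2.2.1 (α (max t 0)).2.2.2
    have hg : Antitone g := by
      intro t t' htt
      have hm := max_le_max_right 0 htt
      have hx : max t 0 ∈ Set.Ico 0 (max t' 0 + 1) := ⟨le_max_right _ _, by linarith⟩
      have hy : max t' 0 ∈ Set.Ico 0 (max t' 0 + 1) := ⟨le_max_right _ _, by linarith⟩
      exact (hap (max t' 0 + 1)).1 hx hy hm
    have hgb : BddBelow (Set.range g) := by
      refine ⟨0, ?_⟩
      rintro _ ⟨t, rfl⟩
      exact (static_all D κ ρ hκ hκU hρ hρV _ _ _ _ (hinv (max t 0) (Set.mem_Ici.2 (le_max_right _ _))).2 _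
        le_rfl).1
    refine ⟨_, (tendsto_atTop_ciInf hg hgb).congr' ?_⟩
    filter_upwards [eventually_ge_atTop 0] with t ht
    simp only [g, max_eq_left ht]
  -- dissipation tends to zero
  let q : St n → ℝ := fun w => - ∑ i, (μ₁ * (s i w * s i w)
    + k i w * ((c i w - vstar) * (c i w - vstar)))
  have hqBL : BL q := (BL.sum _ fun i _ => ((BL.const μ₁).mul ((hs i).mul (hs i))).add
    ((hk i).mul (((hc i).sub (BL.const vstar)).mul ((hc i).sub (BL.const vstar))))).neg
  have hqe : ∀ t ∈ Set.Ici (0:ℝ), q (α t) = -∑ i, (μ₁ * ((α t).2.2.2 i * Real.sin ((α t).2.2.1 i))^2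
      + kGain p vmax vstar μ₂ f V (α t).1 (α t).2.1 (α t).2.2.1 i
        * ((α t).2.2.2 i * Real.cos ((α t).2.2.1 i) - vstar)^2) := by
    intro t ht
    simp only [q]
    congr 1
    refine Finset.sum_congr rfl fun i _ => ?_
    obtain ⟨e1, e2, e3, e4, e5⟩ := heq i _ (hinv t ht).1
    rw [e1, e2, e5]; ring
  have hq0 : Tendsto (fun t => q (α t)) atTop (nhds 0) := by
    obtain ⟨C, hC, hCl⟩ := hlip q hqBL
    refine barbalat _ (fun t => q (α t)) cH C hC (fun t ht => ?_) hcH hCl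
    have := H_deriv D (fun t => (α t).1) (fun t => (α t).2.1) (fun t => (α t).2.2.1)
      (fun t => (α t).2.2.2) t (Set.Ici 0) (hinv t ht).2 (hode t ht)
    rw [hqe t ht]
    exact this
  have hQ0 : Tendsto (fun t => - q (α t)) atTop (nhds 0) := by simpa using hq0.neg
  have hterm : ∀ t, 0 ≤ t → ∀ i, μ₁ * ((α t).2.2.2 i * Real.sin ((α t).2.2.1 i))^2
      + μ₂ * ((α t).2.2.2 i * Real.cos ((α t).2.2.1 i) - vstar)^2 ≤ - q (α t) := by
    intro t ht i
    rw [hqe t ht, neg_neg]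
    have hμ₁ := D.hμ₁
    have hμ₂ := D.hμ₂
    have h2 := fun j => ((hst t ht).2.2.2.2 j).1
    refine le_trans ?_ (Finset.single_le_sum (f := fun i =>
      (μ₁ * ((α t).2.2.2 i * Real.sin ((α t).2.2.1 i))^2
      + kGain p vmax vstar μ₂ f V (α t).1 (α t).2.1 (α t).2.2.1 i
        * ((α t).2.2.2 i * Real.cos ((α t).2.2.1 i) - vstar)^2)) (fun j _ => ?_)
        (Finset.mem_univ i))
    · have := mul_le_mul_of_nonneg_right (h2 i)
        (sq_nonneg ((α t).2.2.2 i * Real.cos ((α t).2.2.1 i) - vstar))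
      linarith
    · have := hμ₂.le.trans (h2 j)
      positivity
  have hsin : ∀ i, Tendsto (fun t => (α t).2.2.2 i * Real.sin ((α t).2.2.1 i)) atTop (nhds 0) :=
    fun i => sq_tend _ μ₁ _ D.hμ₁ (fun t ht => by
      have := hterm t ht i
      have := mul_nonneg D.hμ₂.le (sq_nonneg ((α t).2.2.2 i * Real.cos ((α t).2.2.1 i) - vstar))
      linarith) hQ0
  have hcos : ∀ i, Tendsto (fun t => (α t).2.2.2 i * Real.cos ((α t).2.2.1 i)) atTop
      (nhds vstar) := fun i => by
    have := sq_tend (fun t => (α t).2.2.2 i * Real.cos ((α t).2.2.1 i) - vstar) μ₂ _ D.hμ₂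
      (fun t ht => by
      have := hterm t ht i
      have := mul_nonneg D.hμ₁.le (sq_nonneg ((α t).2.2.2 i * Real.sin ((α t).2.2.1 i)))
      linarith) hQ0
    simpa using this.add_const vstar
  have hW : ∀ i, Tendsto (fun t => (α t).2.2.2 i) atTop (nhds vstar) := by
    intro i
    have h1 := (((hsin i).pow 2).add ((hcos i).pow 2)).sqrt
    have e : Real.sqrt (0 ^ 2 + vstar ^ 2) = vstar := by
      rw [zero_pow two_ne_zero, zero_add, Real.sqrt_sq D.hvs.le]
    rw [e] at h1
    refine h1.congr' ?_
    filter_upwards [eventually_ge_atTop 0] with t ht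
    have e2 : ((α t).2.2.2 i * Real.sin ((α t).2.2.1 i))^2
      + ((α t).2.2.2 i * Real.cos ((α t).2.2.1 i))^2 = (α t).2.2.2 i ^ 2 := by
      have := Real.sin_sq_add_cos_sq ((α t).2.2.1 i)
      linear_combination (α t).2.2.2 i ^ 2 * this
    rw [e2, Real.sqrt_sq ((hinv t ht).2.2.2.1 i).1.le]
  have hΘ : ∀ i, Tendsto (fun t => (α t).2.2.1 i) atTop (nhds 0) := by
    intro i
    have h1 := (hsin i).div (hW i) D.hvs.ne'
    have h2 := (Real.continuous_arcsin.tendsto _).comp h1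
    rw [zero_div, Real.arcsin_zero] at h2
    refine h2.congr' ?_
    filter_upwards [eventually_ge_atTop 0] with t ht
    have hv := ((hinv t ht).2.2.2.1 i).1
    have hθ := (hinv t ht).2.2.1 i
    have hφ := D.hφ.2
    simp only [Function.comp]
    rw [show ((fun t => (α t).2.2.2 i * Real.sin ((α t).2.2.1 i)) / fun t => (α t).2.2.2 i) t
      = (α t).2.2.2 i * Real.sin ((α t).2.2.1 i) / (α t).2.2.2 i from rfl,
      mul_div_cancel_left₀ _ hv.ne',
      Real.arcsin_sin (by linarith [hθ.1]) (by linarith [hθ.2])]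
  refine ⟨fun t => (α t).1, fun t => (α t).2.1, fun t => (α t).2.2.1, fun t => (α t).2.2.2,
    ⟨by simp only [hα0], by simp only [hα0], by simp only [hα0], by simp only [hα0],
      fun t ht => (hinv t ht).2, hode⟩, ?_, hW, hΘ, fun i => ?_, fun i => ?_, fun t ht i =>
      ⟨((hst t ht).2.2.2.2 i).2.2.2.1, ((hst t ht).2.2.2.2 i).2.2.2.2⟩⟩
  · intro X Y Θ W ⟨hX0, hY0, hΘ0, hW0, hΩ', hode'⟩ t ht
    have hreg : ∀ t ∈ Set.Ici (0:ℝ), Reg p vmax K' τ r ((X t, Y t, Θ t, W t) : St n) := by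
      intro t ht
      have hH := (apriori D κ ρ hκ hκU hρ hρV X Y Θ W (t + 1) (fun t ht => hΩ' t ht.1)
        (fun t ht => hode' t ht.1)).2.1 t ⟨ht, by linarith⟩
      rw [hX0, hY0, hΘ0, hW0] at hH
      obtain ⟨h1, h2, h3⟩ := hbd _ _ _ _ (hΩ' t ht) hH
      exact ⟨fun i => (h1 i).trans hK1.le, fun i => (h2 i).trans hτ1.le, (hΩ' t ht).2.2.1,
        fun i j h => hr1.le.trans (h3 i j h)⟩
    have := unique_global G KG hKG (fun t => ((X t, Y t, Θ t, W t) : St n)) α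
      (by simp only [hα0, hX0, hY0, hΘ0, hW0]) (fun t ht => (deriv_iff _ _ _ _ _ _ t).2 fun i => by
        obtain ⟨e1, e2, e3, e4, -⟩ := heq i _ (hreg t ht)
        rw [e1, e2, e3, e4]
        exact hode' t ht i) hα t ht
    beta_reduce
    rw [← this]
    exact ⟨rfl, rfl, rfl, rfl⟩
  · obtain ⟨C, hC, hCl⟩ := hlip (u i) (hu i)
    refine (barbalat _ (fun t => u i (α t)) _ C hC (fun t ht => (hder t ht i).2.2.1) (hΘ i)
      hCl).congr' ?_
    filter_upwards [eventually_ge_atTop 0] with t ht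
    exact (heq i _ (hinv t ht).1).2.2.1
  · obtain ⟨C, hC, hCl⟩ := hlip (F i) (hF i)
    refine (barbalat _ (fun t => F i (α t)) _ C hC (fun t ht => (hder t ht i).2.2.2) (hW i)
      hCl).congr' ?_
    filter_upwards [eventually_ge_atTop 0] with t ht
    exact (heq i _ (hinv t ht).1).2.2.2.1

end Conv

theorem stmt17 {n : ℕ} (hn : 2 ≤ n) (a L lam p vmax vstar φ A μ₁ μ₂ : ℝ)
    (ha : 0 < a) (hL : 0 < L) (hlam : L < lam) (hp : 1 ≤ p)
    (hvmax : 0 < vmax) (hvstar : vstar ∈ Set.Ioo 0 vmax)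
    (hφ : φ ∈ Set.Ioo 0 (Real.pi/2)) (hφv : vstar / vmax ≤ Real.cos φ) (hA : 0 < A)
    (hμ₁ : 0 < μ₁) (hμ₂ : 0 < μ₂)
    (f V U : ℝ → ℝ) (hf : ContDiff ℝ 1 f) (hfmax : ∀ z, max z 0 ≤ f z)
    (hV : ContDiffOn ℝ 2 V (Set.Ioi L))
    (hVlim : Filter.Tendsto V (nhdsWithin L (Set.Ioi L)) Filter.atTop)
    (hV0 : ∀ d, lam ≤ d → V d = 0) (hVnonneg : ∀ d, L < d → 0 ≤ V d)
    (hU : ContDiffOn ℝ 2 U (Set.Ioo (-a) a))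
    (hUlim1 : Filter.Tendsto U (nhdsWithin (-a) (Set.Ioi (-a))) Filter.atTop)
    (hUlim2 : Filter.Tendsto U (nhdsWithin a (Set.Iio a)) Filter.atTop)
    (hU0 : U 0 = 0) (hUnonneg : ∀ z ∈ Set.Ioo (-a) a, 0 ≤ U z)
    (m : ℕ) (hm : 2 ≤ m)
    (hmmax : IsGreatest {k : ℕ | ∃ S : Finset (ℝ × ℝ), S.card = k ∧
      (∀ z ∈ S, L ≤ Real.sqrt (z.1^2 + p * z.2^2) ∧
        Real.sqrt (z.1^2 + p * z.2^2) ≤ lam) ∧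
      (∀ z ∈ S, ∀ z' ∈ S, z ≠ z' →
        L ≤ Real.sqrt ((z.1 - z'.1)^2 + p * (z.2 - z'.2)^2))} m) :
    ∃ κ ρ : ℝ → ℝ,
      MonotoneOn κ (Set.Ici 0) ∧ (∀ s, 0 ≤ s → κ s ∈ Set.Ico 0 a) ∧
      AntitoneOn ρ (Set.Ici 0) ∧ (∀ s, 0 ≤ s → ρ s ∈ Set.Ioc L lam) ∧
      ∀ (x₀ y₀ θ₀ v₀ : Fin n → ℝ), inOmega a L p vmax φ x₀ y₀ θ₀ v₀ →
        ∃ X Y Θ W : ℝ → Fin n → ℝ,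
          IsSol a L p vmax vstar φ A μ₁ μ₂ f U V x₀ y₀ θ₀ v₀ X Y Θ W ∧
          (∀ X' Y' Θ' W' : ℝ → Fin n → ℝ,
            IsSol a L p vmax vstar φ A μ₁ μ₂ f U V x₀ y₀ θ₀ v₀ X' Y' Θ' W' →
            ∀ t ∈ Set.Ici (0:ℝ), X' t = X t ∧ Y' t = Y t ∧ Θ' t = Θ t ∧ W' t = W t) ∧
          (∀ i, Filter.Tendsto (fun t => W t i) Filter.atTop (nhds vstar)) ∧
          (∀ i, Filter.Tendsto (fun t => Θ t i) Filter.atTop (nhds 0)) ∧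
          (∀ i, Filter.Tendsto
            (fun t => uctrl p vmax vstar φ A μ₁ μ₂ f U V (X t) (Y t) (Θ t) (W t) i)
            Filter.atTop (nhds 0)) ∧
          (∀ i, Filter.Tendsto
            (fun t => Fctrl p vmax vstar μ₂ f V (X t) (Y t) (Θ t) (W t) i)
            Filter.atTop (nhds 0)) ∧
          (∀ t ∈ Set.Ici (0:ℝ), ∀ i,
            |Fctrl p vmax vstar μ₂ f V (X t) (Y t) (Θ t) (W t) i|
              ≤ Rfun lam vmax vstar φ A μ₂ m f V ρ
                  (Hfun p vstar φ A U V x₀ y₀ θ₀ v₀) * vmax ∧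
            |uctrl p vmax vstar φ A μ₁ μ₂ f U V (X t) (Y t) (Θ t) (W t) i|
              ≤ (1/vstar) * ((μ₁ + Rfun lam vmax vstar φ A μ₂ m f V ρ
                    (Hfun p vstar φ A U V x₀ y₀ θ₀ v₀)) * vmax
                  + b2 U (κ (Hfun p vstar φ A U V x₀ y₀ θ₀ v₀))
                  + m * Real.sqrt p * b1 lam V (ρ (Hfun p vstar φ A U V x₀ y₀ θ₀ v₀)))) := by
  obtain ⟨κ, hκm, hκ, hκU⟩ := kappa_exists a ha U hUlim1 hUlim2 hU0
  obtain ⟨ρ, hρm, hρ, hρV⟩ := rho_exists L lam hlam V hVlim hV0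
  have hpi := Real.pi_pos
  have hc0 : 0 < Real.cos φ := Real.cos_pos_of_mem_Ioo ⟨by linarith [hφ.1], hφ.2⟩
  have hc1 : Real.cos φ < 1 := by
    have := Real.cos_lt_cos_of_nonneg_of_le_pi_div_two le_rfl hφ.2.le hφ.1
    rwa [Real.cos_zero] at this
  have D : Dat a L lam p vmax vstar φ A μ₁ μ₂ f V U m :=
    { ha := ha, hL := hL, hlam := hlam, hp := hp, hvmax := hvmax, hvs := hvstar.1, hvv := hvstar.2,
      hφ := hφ, hφv := by rwa [div_le_iff₀' hvmax] at hφv,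
      hc0 := hc0, hc1 := hc1, hA := hA, hμ₁ := hμ₁, hμ₂ := hμ₂, hf := hf, hfmax := hfmax, hV := hV,
      hV0 := hV0, hVnonneg := hVnonneg, hU := hU, hUnonneg := hUnonneg, hmmax := hmmax.2 }
  exact ⟨κ, ρ, hκm, hκ, hρm, hρ, fun x₀ y₀ θ₀ v₀ hΩ0 =>
    main_w0 D κ ρ hκ hκU hρ hρV x₀ y₀ θ₀ v₀ hΩ0⟩
end

section
/- With the above data, for every w ∈ Ω the derivative of H along the closed-loop vector field satisfies the identity ∇H(w)·ẇ = −Σ_{i=1}^{n} k_i(w)(v_i cos θ_i − v*)² − μ₁ Σ_{i=1}^{n} v_i² sin² θ_i, where ẇ denotes the vector (v₁ cos θ₁,…, vₙ cos θₙ, v₁ sin θ₁,…, vₙ sin θₙ, u₁(w),…, uₙ(w), F₁(w),…, Fₙ(w)). Moreover k_i(w) ≥ μ₂ for all i, and hence ∇H(w)·ẇ ≤ −μ₂ Σ_{i=1}^{n} (v_i cos θ_i − v*)² − μ₁ Σ_{i=1}^{n} v_i² sin² θ_i ≤ 0. -/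
open Real Set Filter

noncomputable def Hprod (p vstar φ A : ℝ) (U V : ℝ → ℝ) {n : ℕ}
    (w : (Fin n → ℝ) × (Fin n → ℝ) × (Fin n → ℝ) × (Fin n → ℝ)) : ℝ :=
  Hfun p vstar φ A U V w.1 w.2.1 w.2.2.1 w.2.2.2

noncomputable def wdot (p vmax vstar φ A μ₁ μ₂ : ℝ) (f U V : ℝ → ℝ) {n : ℕ}
    (x y θ v : Fin n → ℝ) :
    (Fin n → ℝ) × (Fin n → ℝ) × (Fin n → ℝ) × (Fin n → ℝ) :=
  (fun i => v i * Real.cos (θ i),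
   fun i => v i * Real.sin (θ i),
   fun i => uctrl p vmax vstar φ A μ₁ μ₂ f U V x y θ v i,
   fun i => Fctrl p vmax vstar μ₂ f V x y θ v i)

lemma aux_clm_fderiv {E : Type*} [NormedAddCommGroup E] [NormedSpace ℝ E] (g : E → ℝ)
    (D : E →L[ℝ] ℝ) (w : E) (h : ∀ w, g w = D w) : HasFDerivAt g D w := by
  rw [show g = D from funext h]
  exact D.hasFDerivAt

lemma aux_dE_fderiv {n : ℕ} (p : ℝ) (x y θ v : Fin n → ℝ) (i j : Fin n)
    (hd : 0 < dE p x y i j) (V : ℝ → ℝ) (hV : DifferentiableAt ℝ V (dE p x y i j)) :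
    ∃ D : ((Fin n → ℝ) × (Fin n → ℝ) × (Fin n → ℝ) × (Fin n → ℝ)) →L[ℝ] ℝ,
      HasFDerivAt (fun w : ((Fin n → ℝ) × (Fin n → ℝ) × (Fin n → ℝ) × (Fin n → ℝ)) =>
        V (dE p w.1 w.2.1 i j)) D (x, y, θ, v) ∧
      ∀ z, D z = deriv V (dE p x y i j) * (x i - x j) / dE p x y i j * (z.1 i - z.1 j)
        + p * (deriv V (dE p x y i j) * (y i - y j) / dE p x y i j * (z.2.1 i - z.2.1 j)) := by
  have hne : (x i - x j)^2 + p * (y i - y j)^2 ≠ 0 := by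
    intro h
    simp [dE, h] at hd
  have hx : ∀ k, HasFDerivAt (fun w : ((Fin n → ℝ) × (Fin n → ℝ) × (Fin n → ℝ) × (Fin n → ℝ)) =>
      w.1 k) ((ContinuousLinearMap.proj k).comp (ContinuousLinearMap.fst ℝ _ _)) (x, y, θ, v) :=
    fun k => aux_clm_fderiv _ _ _ (fun _ => rfl)
  have hy : ∀ k, HasFDerivAt (fun w : ((Fin n → ℝ) × (Fin n → ℝ) × (Fin n → ℝ) × (Fin n → ℝ)) =>
      w.2.1 k) ((ContinuousLinearMap.proj k).comp ((ContinuousLinearMap.fst ℝ _ _).comp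
        (ContinuousLinearMap.snd ℝ _ _))) (x, y, θ, v) :=
    fun k => aux_clm_fderiv _ _ _ (fun _ => rfl)
  have h1 := ((((hx i).sub (hx j)).pow 2).add ((((hy i).sub (hy j)).pow 2).const_mul p))
  have h2 := h1.sqrt hne
  have h3 := HasDerivAt.comp_hasFDerivAt (x, y, θ, v) (h₂ := V) hV.hasDerivAt h2
  refine ⟨_, h3, ?_⟩
  intro z
  simp only [dE] at hd ⊢
  simp
  field_simp

lemma aux_single_fderiv {n : ℕ} (vstar φ A : ℝ) (U : ℝ → ℝ) (x y θ v : Fin n → ℝ) (i : Fin n)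
    (hU : DifferentiableAt ℝ U (y i)) (hc : Real.cos (θ i) - Real.cos φ ≠ 0) :
    ∃ D : ((Fin n → ℝ) × (Fin n → ℝ) × (Fin n → ℝ) × (Fin n → ℝ)) →L[ℝ] ℝ,
      HasFDerivAt (fun w : ((Fin n → ℝ) × (Fin n → ℝ) × (Fin n → ℝ) × (Fin n → ℝ)) =>
        (1/2) * (w.2.2.2 i * Real.cos (w.2.2.1 i) - vstar)^2
        + (1/2) * ((w.2.2.2 i)^2 * (Real.sin (w.2.2.1 i))^2) + U (w.2.1 i)
        + A * (1/(Real.cos (w.2.2.1 i) - Real.cos φ) - 1/(1 - Real.cos φ))) D (x, y, θ, v) ∧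
      ∀ z, D z = (v i * Real.cos (θ i) - vstar) *
          (z.2.2.2 i * Real.cos (θ i) - v i * Real.sin (θ i) * z.2.2.1 i)
        + v i * Real.sin (θ i) *
          (z.2.2.2 i * Real.sin (θ i) + v i * Real.cos (θ i) * z.2.2.1 i)
        + deriv U (y i) * z.2.1 i
        + A * (Real.sin (θ i) / (Real.cos (θ i) - Real.cos φ)^2 * z.2.2.1 i) := by
  have hy : HasFDerivAt (fun w : ((Fin n → ℝ) × (Fin n → ℝ) × (Fin n → ℝ) × (Fin n → ℝ)) =>
      w.2.1 i) ((ContinuousLinearMap.proj i).comp ((ContinuousLinearMap.fst ℝ _ _).comp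
        (ContinuousLinearMap.snd ℝ _ _))) (x, y, θ, v) :=
    aux_clm_fderiv _ _ _ (fun _ => rfl)
  have ht : HasFDerivAt (fun w : ((Fin n → ℝ) × (Fin n → ℝ) × (Fin n → ℝ) × (Fin n → ℝ)) =>
      w.2.2.1 i) ((ContinuousLinearMap.proj i).comp ((ContinuousLinearMap.fst ℝ _ _).comp
        ((ContinuousLinearMap.snd ℝ _ _).comp (ContinuousLinearMap.snd ℝ _ _)))) (x, y, θ, v) :=
    aux_clm_fderiv _ _ _ (fun _ => rfl)
  have hv : HasFDerivAt (fun w : ((Fin n → ℝ) × (Fin n → ℝ) × (Fin n → ℝ) × (Fin n → ℝ)) =>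
      w.2.2.2 i) ((ContinuousLinearMap.proj i).comp ((ContinuousLinearMap.snd ℝ _ _).comp
        ((ContinuousLinearMap.snd ℝ _ _).comp (ContinuousLinearMap.snd ℝ _ _)))) (x, y, θ, v) :=
    aux_clm_fderiv _ _ _ (fun _ => rfl)
  have h1 := ((((hv.mul ht.cos).sub_const vstar).pow 2).const_mul (1/2))
  have h2 := ((hv.pow 2).mul (ht.sin.pow 2)).const_mul (1/2)
  have h3 := HasDerivAt.comp_hasFDerivAt (x, y, θ, v) (h₂ := U) hU.hasDerivAt hy
  have hg : HasDerivAt (fun s => A * (1/(Real.cos s - Real.cos φ) - 1/(1 - Real.cos φ)))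
      (A * (Real.sin (θ i) / (Real.cos (θ i) - Real.cos φ)^2)) (θ i) := by
    have := ((((Real.hasDerivAt_cos (θ i)).sub_const (Real.cos φ)).inv hc).sub_const
      (1/(1 - Real.cos φ))).const_mul A
    simpa [one_div] using this
  have h4 := HasDerivAt.comp_hasFDerivAt (x, y, θ, v)
    (h₂ := (fun s => A * (1/(Real.cos s - Real.cos φ) - 1/(1 - Real.cos φ)))) hg ht
  refine ⟨_, ((h1.add h2).add h3).add h4, ?_⟩
  intro z
  simp
  ring

lemma aux_dE_symm {n : ℕ} (p : ℝ) (x y : Fin n → ℝ) (i j : Fin n) :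
    dE p x y i j = dE p x y j i := by
  unfold dE; congr 1; ring

lemma aux_sum_antisymm {n : ℕ} (G : Fin n → Fin n → ℝ) (hG : ∀ i j, G j i = - G i j)
    (z : Fin n → ℝ) :
    (1/2) * ∑ i, ∑ j ∈ Finset.univ.erase i, G i j * (z i - z j)
      = ∑ i, (∑ j ∈ Finset.univ.erase i, G i j) * z i := by
  have h0 : ∀ i, G i i = 0 := fun i => by have := hG i i; linarith
  have e1 : ∀ i, ∑ j ∈ Finset.univ.erase i, G i j * (z i - z j) = ∑ j, G i j * (z i - z j) :=
    fun i => Finset.sum_erase _ (by simp)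
  have e2 : ∀ i, ∑ j ∈ Finset.univ.erase i, G i j = ∑ j, G i j :=
    fun i => Finset.sum_erase _ (h0 i)
  simp only [e1, e2]
  simp only [mul_sub, Finset.sum_sub_distrib, Finset.sum_mul]
  have : ∑ i, ∑ j, G i j * z j = - ∑ i, ∑ j, G i j * z i := by
    rw [Finset.sum_comm, ← Finset.sum_neg_distrib]
    refine Finset.sum_congr rfl fun i _ => ?_
    rw [← Finset.sum_neg_distrib]
    refine Finset.sum_congr rfl fun j _ => ?_
    rw [hG i j]; ring
  rw [this]; ring

theorem stmt18 {n : ℕ} (hn : 2 ≤ n) (a L lam p vmax vstar φ A μ₁ μ₂ : ℝ)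
    (ha : 0 < a) (hL : 0 < L) (hlam : L < lam) (hp : 1 ≤ p)
    (hvmax : 0 < vmax) (hvstar : vstar ∈ Set.Ioo 0 vmax)
    (hφ : φ ∈ Set.Ioo 0 (Real.pi/2)) (hφv : vstar / vmax ≤ Real.cos φ) (hA : 0 < A)
    (hμ₁ : 0 < μ₁) (hμ₂ : 0 < μ₂)
    (f V U : ℝ → ℝ) (hf : ContDiff ℝ 1 f) (hfmax : ∀ z, max z 0 ≤ f z)
    (hV : ContDiffOn ℝ 2 V (Set.Ioi L))
    (hVlim : Filter.Tendsto V (nhdsWithin L (Set.Ioi L)) Filter.atTop)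
    (hV0 : ∀ d, lam ≤ d → V d = 0) (hVnonneg : ∀ d, L < d → 0 ≤ V d)
    (hU : ContDiffOn ℝ 2 U (Set.Ioo (-a) a))
    (hUlim1 : Filter.Tendsto U (nhdsWithin (-a) (Set.Ioi (-a))) Filter.atTop)
    (hUlim2 : Filter.Tendsto U (nhdsWithin a (Set.Iio a)) Filter.atTop)
    (hU0 : U 0 = 0) (hUnonneg : ∀ z ∈ Set.Ioo (-a) a, 0 ≤ U z)
    (x y θ v : Fin n → ℝ) (hΩ : inOmega a L p vmax φ x y θ v) :
    ∃ D : ((Fin n → ℝ) × (Fin n → ℝ) × (Fin n → ℝ) × (Fin n → ℝ)) →L[ℝ] ℝ,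
      HasFDerivAt (Hprod p vstar φ A U V) D (x, y, θ, v) ∧
      D (wdot p vmax vstar φ A μ₁ μ₂ f U V x y θ v)
        = -∑ i, kGain p vmax vstar μ₂ f V x y θ i * (v i * Real.cos (θ i) - vstar)^2
          - μ₁ * ∑ i, (v i)^2 * (Real.sin (θ i))^2 ∧
      (∀ i, μ₂ ≤ kGain p vmax vstar μ₂ f V x y θ i) ∧
      D (wdot p vmax vstar φ A μ₁ μ₂ f U V x y θ v)
        ≤ -(μ₂ * ∑ i, (v i * Real.cos (θ i) - vstar)^2)
          - μ₁ * ∑ i, (v i)^2 * (Real.sin (θ i))^2 ∧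
      D (wdot p vmax vstar φ A μ₁ μ₂ f U V x y θ v) ≤ 0 := by
  obtain ⟨hy, hθ, hv, hd⟩ := hΩ
  obtain ⟨hvs0, hvsm⟩ := hvstar
  obtain ⟨hφ0, hφ1⟩ := hφ
  have hcφ : 0 < Real.cos φ := Real.cos_pos_of_mem_Ioo ⟨by linarith, hφ1⟩
  have hcc : ∀ i, Real.cos φ < Real.cos (θ i) := by
    intro i
    rw [← Real.cos_abs (θ i)]
    exact Real.cos_lt_cos_of_nonneg_of_le_pi (abs_nonneg _) (by linarith [Real.pi_pos])
      (abs_lt.mpr ⟨(hθ i).1, (hθ i).2⟩)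
  have hVd : ∀ i j, i ≠ j → DifferentiableAt ℝ V (dE p x y i j) := fun i j hij =>
    (hV.differentiableOn (by norm_num)).differentiableAt (Ioi_mem_nhds (hd i j hij))
  have hUd : ∀ i, DifferentiableAt ℝ U (y i) := fun i =>
    (hU.differentiableOn (by norm_num)).differentiableAt (Ioo_mem_nhds (hy i).1 (hy i).2)
  -- gain bound
  have hk : ∀ i, μ₂ ≤ kGain p vmax vstar μ₂ f V x y θ i := by
    intro i
    unfold kGain
    set S := Sx p V x y i
    have hS := hfmax (-S)
    have h1 : vstar < vmax * Real.cos (θ i) := by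
      have := (div_le_iff₀ hvmax).1 hφv
      have := mul_lt_mul_of_pos_left (hcc i) hvmax
      linarith
    have hfS : -S ≤ f (-S) := le_trans (le_max_left _ _) hS
    have hf0 : 0 ≤ f (-S) := le_trans (le_max_right _ _) hS
    have hden : 0 < vmax * Real.cos (θ i) - vstar := by linarith
    have hge : 1 / vstar ≤ (vmax * Real.cos (θ i)) / (vstar * (vmax * Real.cos (θ i) - vstar)) := by
      rw [div_le_div_iff₀ hvs0 (by positivity)]
      nlinarith [mul_pos hvs0 hvs0]
    have h2 := mul_le_mul_of_nonneg_right hge hf0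
    have h3 : 1 / vstar * (-S) ≤ 1 / vstar * f (-S) :=
      mul_le_mul_of_nonneg_left hfS (by positivity)
    linarith
  -- derivatives
  choose D1 hD1 hD1z using fun i => aux_single_fderiv vstar φ A U x y θ v i (hUd i)
    (by linarith [hcc i])
  have hpair : ∀ i j, ∃ D : ((Fin n → ℝ) × (Fin n → ℝ) × (Fin n → ℝ) × (Fin n → ℝ)) →L[ℝ] ℝ,
      i ≠ j → HasFDerivAt (fun w : ((Fin n → ℝ) × (Fin n → ℝ) × (Fin n → ℝ) × (Fin n → ℝ)) =>
        V (dE p w.1 w.2.1 i j)) D (x, y, θ, v) ∧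
      ∀ z, D z = deriv V (dE p x y i j) * (x i - x j) / dE p x y i j * (z.1 i - z.1 j)
        + p * (deriv V (dE p x y i j) * (y i - y j) / dE p x y i j * (z.2.1 i - z.2.1 j)) := by
    intro i j
    by_cases hij : i = j
    · exact ⟨0, fun h => absurd hij h⟩
    · obtain ⟨D, hD⟩ := aux_dE_fderiv p x y θ v i j (hL.trans (hd i j hij)) V (hVd i j hij)
      exact ⟨D, fun _ => hD⟩
  choose D2 hD2 using hpair
  have hne : ∀ i j : Fin n, j ∈ Finset.univ.erase i → i ≠ j := fun i j h =>
    (Finset.ne_of_mem_erase h).symm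
  have hDer : HasFDerivAt (Hprod p vstar φ A U V)
      (∑ i, D1 i + (1/2 : ℝ) • ∑ i, ∑ j ∈ Finset.univ.erase i, D2 i j) (x, y, θ, v) := by
    have h1 := HasFDerivAt.fun_sum (u := Finset.univ) (fun i _ => hD1 i)
    have h2 := HasFDerivAt.fun_sum (u := Finset.univ) (fun i _ =>
      HasFDerivAt.fun_sum (u := Finset.univ.erase i) (fun j hj => (hD2 i j (hne i j hj)).1))
    have h3 := h1.add (h2.const_mul (1/2))
    refine h3.congr_of_eventuallyEq (Eventually.of_forall fun w => ?_)
    simp only [Hprod, Hfun, Pi.add_apply, Finset.sum_add_distrib, ← Finset.mul_sum]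
    ring
  have hid : (∑ i, D1 i + (1/2 : ℝ) • ∑ i, ∑ j ∈ Finset.univ.erase i, D2 i j)
      (wdot p vmax vstar φ A μ₁ μ₂ f U V x y θ v)
        = -∑ i, kGain p vmax vstar μ₂ f V x y θ i * (v i * Real.cos (θ i) - vstar)^2
          - μ₁ * ∑ i, (v i)^2 * (Real.sin (θ i))^2 := by
    set z := wdot p vmax vstar φ A μ₁ μ₂ f U V x y θ v with hz
    have hGx := aux_sum_antisymm (fun i j => deriv V (dE p x y i j) * (x i - x j) / dE p x y i j)
      (fun i j => by simp only [aux_dE_symm p x y j i]; ring)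
    have hGy := aux_sum_antisymm (fun i j => deriv V (dE p x y i j) * (y i - y j) / dE p x y i j)
      (fun i j => by simp only [aux_dE_symm p x y j i]; ring) z.2.1
    have hzero : ∑ i, Sx p V x y i * vstar = 0 := by
      have := hGx (fun _ => vstar)
      simp only [sub_self, mul_zero, Finset.sum_const_zero] at this
      exact this.symm
    have hGx := hGx z.1
    have hS2 : (1/2) * ∑ i, ∑ j ∈ Finset.univ.erase i, D2 i j z
        = ∑ i, Sx p V x y i * z.1 i + p * ∑ i, Sy p V x y i * z.2.1 i := by
      have : ∑ i, ∑ j ∈ Finset.univ.erase i, D2 i j z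
          = ∑ i, ∑ j ∈ Finset.univ.erase i,
            (deriv V (dE p x y i j) * (x i - x j) / dE p x y i j * (z.1 i - z.1 j)
        + p * (deriv V (dE p x y i j) * (y i - y j) / dE p x y i j * (z.2.1 i - z.2.1 j))) :=
        Finset.sum_congr rfl fun i _ => Finset.sum_congr rfl fun j hj =>
          (hD2 i j (hne i j hj)).2 z
      rw [this]
      simp only [Finset.sum_add_distrib, ← Finset.mul_sum]
      unfold Sx Sy
      rw [← hGx, ← hGy]
      ring
    have happ : (∑ i, D1 i + (1/2 : ℝ) • ∑ i, ∑ j ∈ Finset.univ.erase i, D2 i j) z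
        = ∑ i, D1 i z + (1/2) * ∑ i, ∑ j ∈ Finset.univ.erase i, D2 i j z := by
      simp
    rw [happ, hS2]
    have key : ∀ i, D1 i z + (Sx p V x y i * z.1 i + p * (Sy p V x y i * z.2.1 i))
        = -(kGain p vmax vstar μ₂ f V x y θ i * (v i * Real.cos (θ i) - vstar)^2)
          - μ₁ * ((v i)^2 * (Real.sin (θ i))^2) + Sx p V x y i * vstar := by
      intro i
      rw [hD1z i z]
      have e1 : z.1 i = v i * Real.cos (θ i) := rfl
      have e2 : z.2.1 i = v i * Real.sin (θ i) := rfl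
      have e3 : z.2.2.1 i = uctrl p vmax vstar φ A μ₁ μ₂ f U V x y θ v i := rfl
      have e4 : z.2.2.2 i = Fctrl p vmax vstar μ₂ f V x y θ v i := rfl
      rw [e1, e2, e3, e4]
      have hc0 : 0 < Real.cos (θ i) := hcφ.trans (hcc i)
      have hF : Real.cos (θ i) * Fctrl p vmax vstar μ₂ f V x y θ v i
          = -kGain p vmax vstar μ₂ f V x y θ i * (v i * Real.cos (θ i) - vstar)
            - Sx p V x y i := by
        unfold Fctrl; field_simp
      have hvi := (hv i).1
      have hci : 0 < Real.cos (θ i) - Real.cos φ := by linarith [hcc i]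
      have hq : 0 < vstar + A / (v i * (Real.cos (θ i) - Real.cos φ)^2) := by positivity
      have hu : (vstar + A / (v i * (Real.cos (θ i) - Real.cos φ)^2)) *
          uctrl p vmax vstar φ A μ₁ μ₂ f U V x y θ v i
          = -(μ₁ * v i * Real.sin (θ i) + deriv U (y i) + p * Sy p V x y i
            + Real.sin (θ i) * Fctrl p vmax vstar μ₂ f V x y θ v i) := by
        unfold uctrl
        rw [← mul_assoc, mul_neg, mul_inv_cancel₀ hq.ne']; ring
      have hA2 : A * (Real.sin (θ i) / (Real.cos (θ i) - Real.cos φ)^2 *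
            uctrl p vmax vstar φ A μ₁ μ₂ f U V x y θ v i)
          = v i * Real.sin (θ i) * (A / (v i * (Real.cos (θ i) - Real.cos φ)^2) *
            uctrl p vmax vstar φ A μ₁ μ₂ f U V x y θ v i) := by
        field_simp
      rw [hA2]
      linear_combination (v i * Real.cos (θ i) - vstar) * hF + v i * Real.sin (θ i) * hu
    have hsum := Finset.sum_congr (rfl : (Finset.univ : Finset (Fin n)) = _) (fun i _ => key i)
    simp only [Finset.sum_add_distrib, Finset.sum_sub_distrib, ← Finset.mul_sum,
      Finset.sum_neg_distrib] at hsum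
    rw [hsum, hzero, add_zero]
  have hle : -∑ i, kGain p vmax vstar μ₂ f V x y θ i * (v i * Real.cos (θ i) - vstar)^2
      ≤ -(μ₂ * ∑ i, (v i * Real.cos (θ i) - vstar)^2) := by
    rw [Finset.mul_sum, neg_le_neg_iff]
    exact Finset.sum_le_sum fun i _ => mul_le_mul_of_nonneg_right (hk i) (sq_nonneg _)
  have hn1 : 0 ≤ μ₂ * ∑ i, (v i * Real.cos (θ i) - vstar)^2 :=
    mul_nonneg hμ₂.le (Finset.sum_nonneg fun i _ => sq_nonneg _)
  have hn2 : 0 ≤ μ₁ * ∑ i, (v i)^2 * (Real.sin (θ i))^2 :=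
    mul_nonneg hμ₁.le (Finset.sum_nonneg fun i _ => mul_nonneg (sq_nonneg _) (sq_nonneg _))
  exact ⟨_, hDer, hid, hk, by rw [hid]; linarith, by rw [hid]; linarith⟩
end
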